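/- Let X₀ be a smooth, embedded, closed plane curve that is star-shaped and centrosymmetric with respect to the origin O, and let A₀ be its enclosed area. Then Gage's area-preserving flow with initial curve X₀ admits a smooth solution X(·,t) for all t ∈ [0, ∞); there exists a finite time T₀ such that for every t > T₀ the curvature of X(·,t) is strictly positive everywhere (the evolving curve is convex); and as t → ∞ the evolving curve converges to a circle of radius √(A₀/π), in particular its curvature converges uniformly to √(π/A₀). -/

import Mathlib

open Real Set MeasureTheory Filter

noncomputable section

/-- Euclidean norm of a plane vector. -/
def vnorm (v : ℝ × ℝ) : ℝ := Real.sqrt (v.1 ^ 2 + v.2 ^ 2)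

/-- Determinant of the 2×2 matrix whose rows are the plane vectors `a`, `b`. -/
def vdet (a b : ℝ × ℝ) : ℝ := a.1 * b.2 - a.2 * b.1

/-- Unit tangent vector of a plane curve. -/
def unitTangent (X : ℝ → ℝ × ℝ) (φ : ℝ) : ℝ × ℝ :=
  (vnorm (deriv X φ))⁻¹ • deriv X φ

/-- Inward unit normal: the rotation of the unit tangent by +π/2. -/
def innerNormal (X : ℝ → ℝ × ℝ) (φ : ℝ) : ℝ × ℝ :=
  (-(unitTangent X φ).2, (unitTangent X φ).1)

/-- Curvature of a plane curve. -/
def curv (X : ℝ → ℝ × ℝ) (φ : ℝ) : ℝ :=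
  vdet (deriv X φ) (deriv (deriv X) φ) / vnorm (deriv X φ) ^ 3

/-- Length of a closed plane curve parametrized on `[0, 2π]`. -/
def clen (X : ℝ → ℝ × ℝ) : ℝ := ∫ φ in (0:ℝ)..(2 * π), vnorm (deriv X φ)

/-- Enclosed area of a closed plane curve. -/
def carea (X : ℝ → ℝ × ℝ) : ℝ :=
  (1 / 2) * ∫ φ in (0:ℝ)..(2 * π), vdet (X φ) (deriv X φ)

/-- A smooth closed plane curve: a smooth `2π`-periodic map `ℝ → ℝ²` with
nonvanishing derivative. -/
structure IsSmoothClosedCurve (X : ℝ → ℝ × ℝ) : Prop where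
  smooth : ContDiff ℝ (⊤ : ℕ∞) X
  periodic : Function.Periodic X (2 * π)
  regular : ∀ φ, deriv X φ ≠ 0

/-- An embedded closed curve: injective over one period. -/
def IsEmbeddedCurve (X : ℝ → ℝ × ℝ) : Prop := Set.InjOn X (Set.Ico 0 (2 * π))

/-- Star-shapedness with respect to a point `O`: `det(X − O, T) > 0` everywhere. -/
def StarShapedWrt (X : ℝ → ℝ × ℝ) (O : ℝ × ℝ) : Prop :=
  ∀ φ, 0 < vdet (X φ - O) (unitTangent X φ)

/-- Centrosymmetry with respect to a point `O`: the image of the curve is invariant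
under the point reflection `Z ↦ 2O − Z`. -/
def CentroSymmetricWrt (X : ℝ → ℝ × ℝ) (O : ℝ × ℝ) : Prop :=
  (fun Z => (2 : ℝ) • O - Z) '' Set.range X = Set.range X

/-- `X` is a smooth solution of Gage's area-preserving flow on the time set `I`
with initial curve `X₀`: `∂X/∂t = α T + (κ − 2π/L) N`. -/
structure IsGAPFSolutionOn (X : ℝ → ℝ → ℝ × ℝ) (X₀ : ℝ → ℝ × ℝ) (I : Set ℝ) : Prop where
  init : ∀ φ, X 0 φ = X₀ φ
  curve : ∀ t ∈ I, IsSmoothClosedCurve (X t)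
  smooth : ContDiffOn ℝ (⊤ : ℕ∞) (fun p : ℝ × ℝ => X p.1 p.2) (I ×ˢ Set.univ)
  flow : ∃ α : ℝ → ℝ → ℝ,
    ∀ t ∈ I, ∀ φ,
      HasDerivWithinAt (fun τ => X τ φ)
        (α t φ • unitTangent (X t) φ +
          (curv (X t) φ - 2 * π / clen (X t)) • innerNormal (X t) φ) I t


open scoped Topology

namespace GF

theorem max_principle {Z : Type*} [TopologicalSpace Z] [T2Space Z] {K : Set Z} (hK : IsCompact K)
    {T : ℝ} (u : ℝ → Z → ℝ)
    (hc : ContinuousOn (fun q : ℝ × Z => u q.1 q.2) (Icc 0 T ×ˢ K))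
    (h0 : ∀ z ∈ K, 0 < u 0 z)
    (hcontact : ∀ τ ∈ Ioc 0 T, ∀ z ∈ K, u τ z = 0 →
      (∀ s ∈ Icc 0 τ, ∀ y ∈ K, 0 ≤ u s y) →
      ∃ d > 0, HasDerivWithinAt (fun s => u s z) d (Icc 0 T) τ) :
    ∀ τ ∈ Icc 0 T, ∀ z ∈ K, 0 < u τ z := by
  by_contra hcon
  push Not at hcon
  obtain ⟨τ₁, hτ₁, z₁, hz₁, hu₁⟩ := hcon
  set B : Set (ℝ × Z) := (Icc 0 T ×ˢ K) ∩ {q | u q.1 q.2 ≤ 0} with hB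
  have hcomp : IsCompact (Icc (0:ℝ) T ×ˢ K) := isCompact_Icc.prod hK
  have hBc : IsCompact B := by
    have : IsClosed B := hc.preimage_isClosed_of_isClosed hcomp.isClosed isClosed_Iic
    exact hcomp.of_isClosed_subset this inter_subset_left
  have hBne : B.Nonempty := ⟨(τ₁, z₁), ⟨⟨hτ₁, hz₁⟩, hu₁⟩⟩
  obtain ⟨⟨τ, z⟩, ⟨⟨hτ, hz⟩, huz⟩, hmin⟩ := hBc.exists_isMinOn hBne continuous_fst.continuousOn
  simp only [mem_ofPred_eq] at huz hτ hz
  have hpos : ∀ s ∈ Icc 0 T, s < τ → ∀ y ∈ K, 0 < u s y := by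
    intro s hs hsτ y hy
    by_contra hle
    push Not at hle
    have := hmin (show (s, y) ∈ B from ⟨⟨hs, hy⟩, hle⟩)
    simp at this
    linarith
  have hτ0 : 0 < τ := by
    rcases hτ.1.lt_or_eq with h | h
    · exact h
    · exfalso
      have := h0 z hz
      rw [h] at this
      linarith
  have hcs : ∀ y ∈ K, ContinuousWithinAt (fun s => u s y) (Icc 0 T) τ := by
    intro y hy
    have h1 : ContinuousWithinAt (fun q : ℝ × Z => u q.1 q.2) (Icc 0 T ×ˢ K) (τ, y) :=
      hc (τ, y) ⟨hτ, hy⟩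
    have h2 : ContinuousWithinAt (fun s : ℝ => (s, y)) (Icc 0 T) τ := by fun_prop
    exact ContinuousWithinAt.comp (f := fun s : ℝ => (s, y)) (x := τ) (t := Icc 0 T ×ˢ K) h1 h2
      (fun s hs => ⟨hs, hy⟩)
  have hsub : Ioo 0 τ ⊆ Icc 0 T := fun s hs => ⟨hs.1.le, hs.2.le.trans hτ.2⟩
  have hnb : (𝓝[Ioo 0 τ] τ).NeBot := by
    rw [← mem_closure_iff_nhdsWithin_neBot, closure_Ioo hτ0.ne]
    exact ⟨hτ0.le, le_rfl⟩
  have hnn : ∀ y ∈ K, 0 ≤ u τ y := by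
    intro y hy
    have h1 := (hcs y hy).mono hsub
    refine ge_of_tendsto h1 ?_
    filter_upwards [self_mem_nhdsWithin] with s hs
    exact (hpos s (hsub hs) hs.2 y hy).le
  have hall : ∀ s ∈ Icc 0 τ, ∀ y ∈ K, 0 ≤ u s y := by
    intro s hs y hy
    rcases hs.2.lt_or_eq with h | h
    · exact (hpos s ⟨hs.1, h.le.trans hτ.2⟩ h y hy).le
    · rw [h]; exact hnn y hy
  obtain ⟨d, hd, hder⟩ := hcontact τ ⟨hτ0, hτ.2⟩ z hz (le_antisymm huz (hnn z hz)) hall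
  have hder2 := hder.mono hsub
  rw [hasDerivWithinAt_iff_tendsto_slope] at hder2
  have hd' : Ioo 0 τ \ {τ} = Ioo 0 τ := by
    ext s; simp
  rw [hd'] at hder2
  have : d ≤ 0 := by
    refine le_of_tendsto hder2 ?_
    filter_upwards [self_mem_nhdsWithin] with s hs
    rw [slope_def_field]
    have h1 := hpos s (hsub hs) hs.2 z hz
    have h2 : u τ z = 0 := le_antisymm huz (hnn z hz)
    rw [h2]
    apply div_nonpos_of_nonneg_of_nonpos
    · linarith
    · linarith [hs.2]
  linarith

/-- joint differentiability from partials -/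
theorem hasFDerivWithinAt_of_partials {F : Type*} [NormedAddCommGroup F] [NormedSpace ℝ F]
    {T : ℝ} {f g₁ g₂ : ℝ → ℝ → F}
    (h1 : ∀ τ ∈ Icc 0 T, ∀ σ, HasDerivWithinAt (fun s => f s σ) (g₁ τ σ) (Icc 0 T) τ)
    (h2 : ∀ τ ∈ Icc 0 T, ∀ σ, HasDerivAt (fun s => f τ s) (g₂ τ σ) σ)
    (hc2 : ContinuousOn (fun q : ℝ × ℝ => g₂ q.1 q.2) (Icc 0 T ×ˢ univ))
    (q : ℝ × ℝ) (hq : q ∈ Icc (0:ℝ) T ×ˢ (univ : Set ℝ)) :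
    HasFDerivWithinAt (fun q : ℝ × ℝ => f q.1 q.2)
      ((ContinuousLinearMap.fst ℝ ℝ ℝ).smulRight (g₁ q.1 q.2) +
        (ContinuousLinearMap.snd ℝ ℝ ℝ).smulRight (g₂ q.1 q.2)) (Icc 0 T ×ˢ univ) q := by
  obtain ⟨τ, σ⟩ := q
  have hτ : τ ∈ Icc 0 T := hq.1
  rw [hasFDerivWithinAt_iff_isLittleO]
  rw [Asymptotics.isLittleO_iff]
  intro ε hε
  have hA := h1 τ hτ σ
  rw [hasDerivWithinAt_iff_isLittleO, Asymptotics.isLittleO_iff] at hA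
  have hA' := hA (half_pos hε)
  rw [eventually_nhdsWithin_iff, Metric.eventually_nhds_iff] at hA'
  obtain ⟨δ₁, hδ₁, hA''⟩ := hA'
  have hB := hc2 (τ, σ) hq
  rw [Metric.continuousWithinAt_iff] at hB
  obtain ⟨δ₂, hδ₂, hB'⟩ := hB (ε/2) (half_pos hε)
  rw [eventually_nhdsWithin_iff, Metric.eventually_nhds_iff]
  refine ⟨min δ₁ δ₂, lt_min hδ₁ hδ₂, ?_⟩
  rintro ⟨τ', σ'⟩ hd ⟨hτ', -⟩
  simp only at hτ'
  rw [Prod.dist_eq, max_lt_iff] at hd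
  obtain ⟨hd1, hd2⟩ := hd
  simp only at hd1 hd2
  have e1 := hA'' (lt_of_lt_of_le hd1 (min_le_left _ _)) hτ'
  have e2 : ‖(f τ' σ' - σ' • g₂ τ σ) - (f τ' σ - σ • g₂ τ σ)‖ ≤ ε/2 * ‖σ' - σ‖ := by
    apply (convex_ball σ (min δ₁ δ₂)).norm_image_sub_le_of_norm_hasDerivWithin_le
      (f := fun y => f τ' y - y • g₂ τ σ) (f' := fun y => g₂ τ' y - (1:ℝ) • g₂ τ σ)
    · intro y hy
      exact ((h2 τ' hτ' y).sub ((hasDerivAt_id y).smul_const (g₂ τ σ))).hasDerivWithinAt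
    · intro y hy
      have := hB' (show ((τ', y) : ℝ × ℝ) ∈ Icc (0:ℝ) T ×ˢ univ from ⟨hτ', mem_univ _⟩) (by
        rw [Prod.dist_eq, max_lt_iff]
        exact ⟨lt_of_lt_of_le hd1 (min_le_right _ _), lt_of_lt_of_le hy (min_le_right _ _)⟩)
      rw [dist_eq_norm] at this
      simpa using this.le
    · exact Metric.mem_ball_self (lt_min hδ₁ hδ₂)
    · exact hd2
  have n1 : ‖τ' - τ‖ ≤ ‖((τ', σ') : ℝ × ℝ) - (τ, σ)‖ := by
    simp
  have n2 : ‖σ' - σ‖ ≤ ‖((τ', σ') : ℝ × ℝ) - (τ, σ)‖ := by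
    simp
  have key : f τ' σ' - f τ σ - ((τ' - τ) • g₁ τ σ + (σ' - σ) • g₂ τ σ)
      = (f τ' σ - f τ σ - (τ' - τ) • g₁ τ σ) +
        ((f τ' σ' - σ' • g₂ τ σ) - (f τ' σ - σ • g₂ τ σ)) := by
    rw [sub_smul]; rw [sub_smul]; abel
  simp only [add_apply, ContinuousLinearMap.smulRight_apply,
    ContinuousLinearMap.coe_fst', ContinuousLinearMap.coe_snd', Prod.fst_sub, Prod.snd_sub]
  rw [key]
  calc _ ≤ _ + _ := norm_add_le _ _
    _ ≤ ε/2 * ‖τ' - τ‖ + ε/2 * ‖σ' - σ‖ := add_le_add e1 e2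
    _ ≤ ε/2 * ‖((τ', σ') : ℝ × ℝ) - (τ, σ)‖ + ε/2 * ‖((τ', σ') : ℝ × ℝ) - (τ, σ)‖ := by gcongr
    _ = ε * ‖((τ', σ') : ℝ × ℝ) - (τ, σ)‖ := by ring

theorem uniqueDiffOn_strip {T : ℝ} (hT : 0 < T) :
    UniqueDiffOn ℝ (Icc (0:ℝ) T ×ˢ (univ : Set ℝ)) :=
  (uniqueDiffOn_Icc hT).prod uniqueDiffOn_univ

theorem contDiffOn_succ_of_partials {F : Type*} [NormedAddCommGroup F] [NormedSpace ℝ F]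
    {T : ℝ} (hT : 0 < T) {f g₁ g₂ : ℝ → ℝ → F} {n : ℕ}
    (h1 : ∀ τ ∈ Icc 0 T, ∀ σ, HasDerivWithinAt (fun s => f s σ) (g₁ τ σ) (Icc 0 T) τ)
    (h2 : ∀ τ ∈ Icc 0 T, ∀ σ, HasDerivAt (fun s => f τ s) (g₂ τ σ) σ)
    (hc1 : ContDiffOn ℝ n (fun q : ℝ × ℝ => g₁ q.1 q.2) (Icc 0 T ×ˢ univ))
    (hc2 : ContDiffOn ℝ n (fun q : ℝ × ℝ => g₂ q.1 q.2) (Icc 0 T ×ˢ univ)) :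
    ContDiffOn ℝ (n + 1 : ℕ) (fun q : ℝ × ℝ => f q.1 q.2) (Icc 0 T ×ˢ univ) := by
  push_cast
  rw [contDiffOn_succ_iff_hasFDerivWithinAt_of_uniqueDiffOn (uniqueDiffOn_strip hT)]
  refine ⟨by simp, fun q => ((ContinuousLinearMap.fst ℝ ℝ ℝ).smulRight (g₁ q.1 q.2) +
        (ContinuousLinearMap.snd ℝ ℝ ℝ).smulRight (g₂ q.1 q.2)), ?_, ?_⟩
  · apply ContDiffOn.add
    · exact contDiffOn_const.smulRight hc1
    · exact contDiffOn_const.smulRight hc2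
  · intro q hq
    exact hasFDerivWithinAt_of_partials h1 h2 hc2.continuousOn q hq

/-- extension of a one-sided C1 function -/
theorem exists_extension {F : Type*} [NormedAddCommGroup F] [NormedSpace ℝ F] [CompleteSpace F]
    {T : ℝ} (hT : 0 ≤ T) {f f' : ℝ → F}
    (h : ∀ τ ∈ Icc 0 T, HasDerivWithinAt f (f' τ) (Icc 0 T) τ) (hc : ContinuousOn f' (Icc 0 T)) :
    ∃ g : ℝ → F, (∀ τ, HasDerivAt g (f' (projIcc 0 T hT τ)) τ) ∧ ∀ τ ∈ Icc 0 T, g τ = f τ := by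
  have hc' : Continuous (fun τ => f' (projIcc 0 T hT τ)) := by
    have := hc.domRestrict
    exact this.comp continuous_projIcc
  refine ⟨fun τ => f 0 + ∫ s in (0:ℝ)..τ, f' (projIcc 0 T hT s), ?_, ?_⟩
  · intro τ
    exact (hc'.integral_hasStrictDerivAt 0 τ).hasDerivAt.const_add (f 0)
  · intro τ hτ
    have : ∫ s in (0:ℝ)..τ, f' (projIcc 0 T hT s) = f τ - f 0 := by
      apply intervalIntegral.integral_eq_sub_of_hasDeriv_right_of_le hτ.1
      · intro s hs
        exact ((h s ⟨hs.1, hs.2.trans hτ.2⟩).continuousWithinAt).mono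
          (Icc_subset_Icc_right hτ.2)
      · intro s hs
        have hs' : s ∈ Icc 0 T := ⟨hs.1.le, hs.2.le.trans hτ.2⟩
        rw [projIcc_of_mem hT hs']
        have h3 : HasDerivAt f (f' s) s :=
          (h s hs').hasDerivAt (Icc_mem_nhds hs.1 (hs.2.trans_le hτ.2))
        exact h3.hasDerivWithinAt
      · exact hc'.intervalIntegrable _ _
    simp only [this]
    abel

theorem hasDerivWithinAt_tsum {ι : Type*} {F : Type*} [NormedAddCommGroup F] [NormedSpace ℝ F]
    [CompleteSpace F] {T : ℝ} (hT : 0 ≤ T) {f f' : ι → ℝ → F} {M : ι → ℝ} (hM : Summable M)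
    (h : ∀ n, ∀ τ ∈ Icc 0 T, HasDerivWithinAt (f n) (f' n τ) (Icc 0 T) τ)
    (hc : ∀ n, ContinuousOn (f' n) (Icc 0 T)) (hb : ∀ n, ∀ τ ∈ Icc 0 T, ‖f' n τ‖ ≤ M n)
    (h0 : Summable (fun n => f n 0)) (τ : ℝ) (hτ : τ ∈ Icc 0 T) :
    HasDerivWithinAt (fun s => ∑' n, f n s) (∑' n, f' n τ) (Icc 0 T) τ := by
  choose g hg hgf using fun n => exists_extension hT (h n) (hc n)
  have h0T : (0:ℝ) ∈ Icc 0 T := ⟨le_rfl, hT⟩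
  have h3 := hasDerivAt_tsum (g := g) (g' := fun n τ => f' n (projIcc 0 T hT τ)) hM
    (fun n y => hg n y) (fun n y => hb n _ (projIcc 0 T hT y).2) (y₀ := 0)
    (by simpa only [hgf _ 0 h0T] using h0) τ
  simp only [projIcc_of_mem hT hτ] at h3
  refine h3.hasDerivWithinAt.congr ?_ ?_
  · intro s hs
    simp only [hgf _ s hs]
  · simp only [hgf _ τ hτ]

theorem hasDerivWithinAt_integral {F : Type*} [NormedAddCommGroup F] [NormedSpace ℝ F]
    [CompleteSpace F] {T : ℝ} (hT : 0 ≤ T) {G G' : ℝ → ℝ → F} (a b : ℝ)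
    (h : ∀ τ ∈ Icc 0 T, ∀ σ, HasDerivWithinAt (fun s => G s σ) (G' τ σ) (Icc 0 T) τ)
    (hcG : ∀ τ ∈ Icc 0 T, Continuous (G τ))
    (hc : ContinuousOn (fun q : ℝ × ℝ => G' q.1 q.2) (Icc 0 T ×ˢ univ)) (τ : ℝ)
    (hτ : τ ∈ Icc 0 T) :
    HasDerivWithinAt (fun s => ∫ σ in a..b, G s σ) (∫ σ in a..b, G' τ σ) (Icc 0 T) τ := by
  have hcσ : ∀ σ, ContinuousOn (fun s => G' s σ) (Icc 0 T) := fun σ =>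
    hc.comp (f := fun s : ℝ => (s, σ)) (by fun_prop) (fun s hs => ⟨hs, mem_univ _⟩)
  have hC : Continuous (fun q : ℝ × ℝ => G' (projIcc 0 T hT q.1) q.2) := by
    have : Continuous (fun q : ℝ × ℝ => ((projIcc 0 T hT q.1 : ℝ), q.2)) := by fun_prop
    exact hc.comp_continuous this (fun q => ⟨(projIcc 0 T hT q.1).2, mem_univ _⟩)
  have hC0 : Continuous (G 0) := hcG 0 ⟨le_rfl, hT⟩
  set g : ℝ → ℝ → F := fun τ σ => G 0 σ + ∫ s in (0:ℝ)..τ, G' (projIcc 0 T hT s) σ with hg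
  have hgd : ∀ τ σ, HasDerivAt (fun s => g s σ) (G' (projIcc 0 T hT τ) σ) τ := by
    intro τ σ
    have : Continuous (fun s => G' (projIcc 0 T hT s) σ) :=
      hC.comp (f := fun s : ℝ => (s, σ)) (by fun_prop)
    exact (this.integral_hasStrictDerivAt 0 τ).hasDerivAt.const_add (G 0 σ)
  have hgG : ∀ τ ∈ Icc 0 T, ∀ σ, g τ σ = G τ σ := by
    intro τ hτ σ
    have : ∫ s in (0:ℝ)..τ, G' (projIcc 0 T hT s) σ = G τ σ - G 0 σ := by
      apply intervalIntegral.integral_eq_sub_of_hasDeriv_right_of_le (f := fun s => G s σ) hτ.1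
      · intro s hs
        exact ((h s ⟨hs.1, hs.2.trans hτ.2⟩ σ).continuousWithinAt).mono
          (Icc_subset_Icc_right hτ.2)
      · intro s hs
        have hs' : s ∈ Icc 0 T := ⟨hs.1.le, hs.2.le.trans hτ.2⟩
        rw [projIcc_of_mem hT hs']
        have h3 : HasDerivAt (fun s => G s σ) (G' s σ) s :=
          (h s hs' σ).hasDerivAt (Icc_mem_nhds hs.1 (hs.2.trans_le hτ.2))
        exact h3.hasDerivWithinAt
      · exact (hC.comp (f := fun s : ℝ => (s, σ)) (by fun_prop)).intervalIntegrable _ _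
    simp only [hg, this]
    abel
  have hgc : ∀ τ, Continuous (g τ) := by
    intro τ
    apply hC0.add
    apply intervalIntegral.continuous_parametric_intervalIntegral_of_continuous'
    have : Continuous (fun q : ℝ × ℝ => (q.2, q.1)) := by fun_prop
    exact hC.comp this
  obtain ⟨C, hCb⟩ : ∃ C, ∀ q ∈ Icc (0:ℝ) T ×ˢ uIcc a b, ‖G' q.1 q.2‖ ≤ C := by
    apply (isCompact_Icc.prod isCompact_uIcc).exists_bound_of_continuousOn
    exact hc.mono (prod_mono le_rfl (subset_univ _))
  have key := (intervalIntegral.hasDerivAt_integral_of_dominated_loc_of_deriv_le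
    (μ := volume) (a := a) (b := b) (F := g) (F' := fun τ σ => G' (projIcc 0 T hT τ) σ) (x₀ := τ)
    (bound := fun _ => C) (s := univ) univ_mem
    (Eventually.of_forall fun s => (hgc s).aestronglyMeasurable)
    ((hgc τ).intervalIntegrable _ _)
    ((hC.comp (f := fun s : ℝ => (τ, s)) (by fun_prop)).aestronglyMeasurable)
    (Eventually.of_forall fun σ hσ s _ => hCb (projIcc 0 T hT s, σ)
      ⟨(projIcc 0 T hT s).2, uIoc_subset_uIcc hσ⟩)
    (by simp)
    (Eventually.of_forall fun σ hσ s _ => hgd s σ)).2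
  simp only [projIcc_of_mem hT hτ] at key
  refine key.hasDerivWithinAt.congr ?_ ?_
  · intro s hs
    simp only [hgG s hs]
  · simp only [hgG τ hτ]

end GF

open scoped Topology ComplexConjugate

namespace GF

def wt (n : ℤ) : ℝ := 1 + |(n:ℝ)|

theorem one_le_wt (n : ℤ) : 1 ≤ wt n := by unfold wt; linarith [abs_nonneg (n:ℝ)]
theorem wt_pos (n : ℤ) : 0 < wt n := lt_of_lt_of_le one_pos (one_le_wt n)
theorem wt_mul (n j : ℤ) : wt n ≤ wt j * wt (n - j) := by
  unfold wt
  have h : |(n:ℝ)| ≤ |(j:ℝ)| + |((n - j : ℤ) : ℝ)| := by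
    calc |(n:ℝ)| = |(j:ℝ) + ((n - j : ℤ) : ℝ)| := by congr 1; push_cast; ring
      _ ≤ _ := abs_add_le _ _
  nlinarith [abs_nonneg (j:ℝ), abs_nonneg ((n-j:ℤ):ℝ)]
theorem wt_neg (n : ℤ) : wt (-n) = wt n := by simp [wt]

def convEquiv : ℤ × ℤ ≃ ℤ × ℤ where
  toFun x := (x.2, x.1 - x.2)
  invFun x := (x.1 + x.2, x.1)
  left_inv x := by simp
  right_inv x := by simp

theorem summable_conv_pair {a b : ℤ → ℝ} (ha : Summable a) (hb : Summable b)
    (ha0 : ∀ n, 0 ≤ a n) (hb0 : ∀ n, 0 ≤ b n) :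
    Summable (fun x : ℤ × ℤ => a x.2 * b (x.1 - x.2)) := by
  have h := ha.mul_of_nonneg hb ha0 hb0
  exact (convEquiv.summable_iff (f := fun x : ℤ × ℤ => a x.1 * b x.2)).2 h

theorem summable_conv_fiber {a b : ℤ → ℝ} (ha : Summable a) (hb : Summable b)
    (ha0 : ∀ n, 0 ≤ a n) (hb0 : ∀ n, 0 ≤ b n) (n : ℤ) :
    Summable (fun j => a j * b (n - j)) :=
  (summable_conv_pair ha hb ha0 hb0).prod_factor n

theorem summable_conv {a b : ℤ → ℝ} (ha : Summable a) (hb : Summable b)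
    (ha0 : ∀ n, 0 ≤ a n) (hb0 : ∀ n, 0 ≤ b n) :
    Summable (fun n => ∑' j, a j * b (n - j)) :=
  (summable_conv_pair ha hb ha0 hb0).prod

theorem tsum_conv {a b : ℤ → ℝ} (ha : Summable a) (hb : Summable b)
    (ha0 : ∀ n, 0 ≤ a n) (hb0 : ∀ n, 0 ≤ b n) :
    ∑' n, ∑' j, a j * b (n - j) = (∑' n, a n) * ∑' n, b n := by
  have h1 := (summable_conv_pair ha hb ha0 hb0)
  rw [← h1.tsum_prod' (fun n => h1.prod_factor n)]
  rw [ha.tsum_mul_tsum hb (ha.mul_of_nonneg hb ha0 hb0)]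
  exact convEquiv.tsum_eq (fun x : ℤ × ℤ => a x.1 * b x.2)

theorem summable_of_wt {m : ℕ} {M : ℤ → ℝ} (h : Summable (fun n => wt n ^ m * M n))
    (h0 : ∀ n, 0 ≤ M n) : Summable M := by
  refine h.of_nonneg_of_le h0 (fun n => ?_)
  have := one_le_pow₀ (n := m) (one_le_wt n)
  nlinarith [h0 n]

theorem summable_wt_conv {m : ℕ} {a b : ℤ → ℝ} (ha : Summable (fun n => wt n ^ m * a n))
    (hb : Summable (fun n => wt n ^ m * b n))
    (ha0 : ∀ n, 0 ≤ a n) (hb0 : ∀ n, 0 ≤ b n) :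
    Summable (fun n => wt n ^ m * ∑' j, a j * b (n - j)) := by
  have p : ∀ n, 0 ≤ wt n ^ m := fun n => (pow_pos (wt_pos n) m).le
  have hA : ∀ n, 0 ≤ wt n ^ m * a n := fun n => mul_nonneg (p n) (ha0 n)
  have hB : ∀ n, 0 ≤ wt n ^ m * b n := fun n => mul_nonneg (p n) (hb0 n)
  refine (summable_conv ha hb hA hB).of_nonneg_of_le (fun n => ?_) (fun n => ?_)
  · exact mul_nonneg (p n) (tsum_nonneg fun j => mul_nonneg (ha0 _) (hb0 _))
  · rw [← tsum_mul_left]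
    refine Summable.tsum_le_tsum (fun j => ?_) ?_ (summable_conv_fiber ha hb hA hB n)
    · have h1 : wt n ^ m ≤ wt j ^ m * wt (n-j) ^ m := by
        rw [← mul_pow]
        exact pow_le_pow_left₀ (wt_pos n).le (wt_mul n j) m
      have h2 : 0 ≤ a j * b (n-j) := mul_nonneg (ha0 _) (hb0 _)
      calc wt n ^ m * (a j * b (n-j)) ≤ (wt j ^ m * wt (n-j) ^ m) * (a j * b (n-j)) := by gcongr
        _ = _ := by ring
    · exact (summable_conv_fiber (summable_of_wt ha ha0) (summable_of_wt hb hb0) ha0 hb0 n).mul_left _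

/-- weighted summable majorant, uniform in time -/
def WS (T : ℝ) (m : ℕ) (f : ℤ → ℝ → ℂ) : Prop :=
  ∃ M : ℤ → ℝ, (∀ n, 0 ≤ M n) ∧ Summable (fun n => wt n ^ m * M n) ∧
    ∀ n, ∀ τ ∈ Icc 0 T, ‖f n τ‖ ≤ M n

def cnv (f g : ℤ → ℝ → ℂ) (n : ℤ) (τ : ℝ) : ℂ := ∑' j, f j τ * g (n - j) τ

theorem WS.mono {T : ℝ} {m l : ℕ} {f : ℤ → ℝ → ℂ} (h : WS T m f) (hl : l ≤ m) : WS T l f := by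
  obtain ⟨M, h0, hs, hb⟩ := h
  refine ⟨M, h0, hs.of_nonneg_of_le (fun n => mul_nonneg (pow_pos (wt_pos n) l).le (h0 n))
    (fun n => ?_), hb⟩
  exact mul_le_mul_of_nonneg_right (pow_le_pow_right₀ (one_le_wt n) hl) (h0 n)

theorem WS.restrict {T T' : ℝ} {m : ℕ} {f : ℤ → ℝ → ℂ} (h : WS T m f) (hl : T' ≤ T) :
    WS T' m f := by
  obtain ⟨M, h0, hs, hb⟩ := h
  exact ⟨M, h0, hs, fun n τ hτ => hb n τ ⟨hτ.1, hτ.2.trans hl⟩⟩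

theorem WS.add {T : ℝ} {m : ℕ} {f g : ℤ → ℝ → ℂ} (hf : WS T m f) (hg : WS T m g) :
    WS T m (fun n τ => f n τ + g n τ) := by
  obtain ⟨M, h0, hs, hb⟩ := hf
  obtain ⟨M', h0', hs', hb'⟩ := hg
  refine ⟨fun n => M n + M' n, fun n => add_nonneg (h0 n) (h0' n), ?_, fun n τ hτ =>
    (norm_add_le _ _).trans (add_le_add (hb n τ hτ) (hb' n τ hτ))⟩
  simpa [mul_add] using hs.add hs'

theorem WS.mult {T : ℝ} {m s : ℕ} {f : ℤ → ℝ → ℂ} {c : ℤ → ℂ} {C : ℝ} (hf : WS T (m + s) f)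
    (hc : ∀ n, ‖c n‖ ≤ C * wt n ^ s) :
    WS T m (fun n τ => c n * f n τ) := by
  obtain ⟨M, h0, hs, hb⟩ := hf
  have hC : 0 ≤ C := by
    have := (norm_nonneg _).trans (hc 0)
    have h1 := pow_pos (wt_pos 0) s
    by_contra h
    push Not at h
    nlinarith
  refine ⟨fun n => C * wt n ^ s * M n, fun n => ?_, ?_, fun n τ hτ => ?_⟩
  · have := (pow_pos (wt_pos n) s).le
    have := h0 n
    positivity
  · refine (hs.mul_left C).congr (fun n => ?_)
    rw [pow_add]; ring
  · rw [norm_mul]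
    exact mul_le_mul (hc n) (hb n τ hτ) (norm_nonneg _) ((norm_nonneg _).trans (hc n))

theorem WS.summable {T : ℝ} {m : ℕ} {f : ℤ → ℝ → ℂ} (h : WS T m f) {τ : ℝ} (hτ : τ ∈ Icc 0 T) :
    Summable (fun n => ‖f n τ‖) := by
  obtain ⟨M, h0, hs, hb⟩ := h
  exact (summable_of_wt hs h0).of_nonneg_of_le (fun n => norm_nonneg _) (fun n => hb n τ hτ)

theorem summable_cnv {T : ℝ} {m l : ℕ} {f g : ℤ → ℝ → ℂ} (hf : WS T m f) (hg : WS T l g) (n : ℤ)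
    {τ : ℝ} (hτ : τ ∈ Icc 0 T) : Summable (fun j => ‖f j τ * g (n - j) τ‖) := by
  simp only [norm_mul]
  exact summable_conv_fiber (hf.summable hτ) (hg.summable hτ) (fun _ => norm_nonneg _)
    (fun _ => norm_nonneg _) n

theorem WS.cnv {T : ℝ} {m : ℕ} {f g : ℤ → ℝ → ℂ} (hf : WS T m f) (hg : WS T m g) :
    WS T m (cnv f g) := by
  obtain ⟨M, h0, hs, hb⟩ := hf
  obtain ⟨M', h0', hs', hb'⟩ := hg
  refine ⟨fun n => ∑' j, M j * M' (n - j), fun n => tsum_nonneg fun j => mul_nonneg (h0 _) (h0' _),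
    summable_wt_conv hs hs' h0 h0', fun n τ hτ => ?_⟩
  refine tsum_of_norm_bounded (summable_conv_fiber (summable_of_wt hs h0) (summable_of_wt hs' h0')
    h0 h0' n).hasSum (fun j => ?_)
  rw [norm_mul]
  exact mul_le_mul (hb _ _ hτ) (hb' _ _ hτ) (norm_nonneg _) (h0 _)

/-! Fourier modes -/
def em (n : ℤ) (σ : ℝ) : ℂ := Complex.exp (2 * Complex.I * n * σ)

theorem norm_em (n : ℤ) (σ : ℝ) : ‖em n σ‖ = 1 := by
  unfold em
  rw [show (2 * Complex.I * n * σ : ℂ) = ((2 * n * σ : ℝ) : ℂ) * Complex.I by push_cast; ring]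
  exact Complex.norm_exp_ofReal_mul_I _

theorem em_add (n m : ℤ) (σ : ℝ) : em (n + m) σ = em n σ * em m σ := by
  unfold em; rw [← Complex.exp_add]; congr 1; push_cast; ring

theorem em_zero (σ : ℝ) : em 0 σ = 1 := by simp [em]

theorem em_conj (n : ℤ) (σ : ℝ) : conj (em n σ) = em (-n) σ := by
  unfold em; rw [← Complex.exp_conj]; congr 1; simp [Complex.conj_ofNat]

theorem em_periodic (n : ℤ) (σ : ℝ) : em n (σ + π) = em n σ := by
  unfold em
  rw [show (2 * Complex.I * n * ((σ + π : ℝ) : ℂ) : ℂ)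
    = 2 * Complex.I * n * σ + n * (2 * π * Complex.I) by push_cast; ring]
  rw [Complex.exp_add, Complex.exp_int_mul_two_pi_mul_I, mul_one]

theorem hasDerivAt_em (n : ℤ) (σ : ℝ) : HasDerivAt (em n) (2 * Complex.I * n * em n σ) σ := by
  unfold em
  have h : HasDerivAt (fun σ : ℝ => (2 * Complex.I * n * σ : ℂ)) (2 * Complex.I * n) σ := by
    simpa using (Complex.ofRealCLM.hasDerivAt (x := σ)).const_mul (2 * Complex.I * n : ℂ)
  convert h.cexp using 1
  ring

theorem continuous_em (n : ℤ) : Continuous (em n) :=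
  continuous_iff_continuousAt.2 fun σ => (hasDerivAt_em n σ).continuousAt

def ev (f : ℤ → ℝ → ℂ) (τ σ : ℝ) : ℂ := ∑' n, f n τ * em n σ

def ds (f : ℤ → ℝ → ℂ) : ℤ → ℝ → ℂ := fun n τ => (2 * Complex.I * n) * f n τ

theorem norm_two_I (n : ℤ) : ‖(2 * Complex.I * n : ℂ)‖ = 2 * |(n:ℝ)| := by
  simp

theorem WS.ds {T : ℝ} {m : ℕ} {f : ℤ → ℝ → ℂ} (h : WS T (m + 1) f) : WS T m (ds f) := by
  refine WS.mult (C := 2) (s := 1) h (fun n => ?_)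
  rw [norm_two_I, pow_one]
  unfold wt
  linarith

theorem ev_summable {T : ℝ} {m : ℕ} {f : ℤ → ℝ → ℂ} (h : WS T m f) {τ : ℝ} (hτ : τ ∈ Icc 0 T)
    (σ : ℝ) : Summable (fun n => ‖f n τ * em n σ‖) := by
  simpa [norm_mul, norm_em] using h.summable hτ

theorem ev_add {T : ℝ} {m l : ℕ} {f g : ℤ → ℝ → ℂ} (hf : WS T m f) (hg : WS T l g) {τ : ℝ}
    (hτ : τ ∈ Icc 0 T) (σ : ℝ) :
    ev (fun n τ => f n τ + g n τ) τ σ = ev f τ σ + ev g τ σ := by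
  unfold ev
  simp only [add_mul]
  exact (ev_summable hf hτ σ).of_norm.tsum_add (ev_summable hg hτ σ).of_norm

theorem ev_const_mul (c : ℂ) (f : ℤ → ℝ → ℂ) (τ σ : ℝ) :
    ev (fun n τ => c * f n τ) τ σ = c * ev f τ σ := by
  unfold ev
  rw [← tsum_mul_left]
  simp only [mul_assoc]

theorem ev_cnv {T : ℝ} {m l : ℕ} {f g : ℤ → ℝ → ℂ} (hf : WS T m f) (hg : WS T l g) {τ : ℝ}
    (hτ : τ ∈ Icc 0 T) (σ : ℝ) : ev (cnv f g) τ σ = ev f τ σ * ev g τ σ := by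
  have h1 := ev_summable hf hτ σ
  have h2 := ev_summable hg hτ σ
  unfold ev cnv
  rw [tsum_mul_tsum_of_summable_norm h1 h2]
  have hs := summable_mul_of_summable_norm h1 h2
  rw [← convEquiv.tsum_eq]
  have hs' := convEquiv.summable_iff.2 hs
  refine Eq.trans ?_ (hs'.tsum_prod' (fun n => hs'.prod_factor n)).symm
  refine tsum_congr (fun n => ?_)
  rw [← tsum_mul_right]
  refine tsum_congr (fun j => ?_)
  simp only [convEquiv, Equiv.coe_fn_mk, Function.comp]
  have : em n σ = em j σ * em (n - j) σ := by rw [← em_add]; congr 1; ring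
  rw [this]; ring

theorem ev_periodic (f : ℤ → ℝ → ℂ) (τ σ : ℝ) : ev f τ (σ + π) = ev f τ σ := by
  simp only [ev, em_periodic]

theorem ev_hasDerivAt {T : ℝ} {f : ℤ → ℝ → ℂ} (h : WS T 1 f) {τ : ℝ} (hτ : τ ∈ Icc 0 T)
    (σ : ℝ) : HasDerivAt (fun s => ev f τ s) (ev (ds f) τ σ) σ := by
  have h2 : WS T 0 (ds f) := WS.ds h
  have := hasDerivAt_tsum (g := fun n s => f n τ * em n s)
    (g' := fun n s => ds f n τ * em n s) (h2.summable hτ) (y₀ := 0)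
    (fun n y => by
      have := (hasDerivAt_em n y).const_mul (f n τ)
      exact this.congr_deriv (by unfold GF.ds; ring))
    (fun n y => by rw [norm_mul, norm_em, mul_one]) (ev_summable h hτ 0).of_norm σ
  exact this

theorem ev_continuousOn {T : ℝ} {m : ℕ} {f : ℤ → ℝ → ℂ} (h : WS T m f)
    (hc : ∀ n, ContinuousOn (f n) (Icc 0 T)) :
    ContinuousOn (fun q : ℝ × ℝ => ev f q.1 q.2) (Icc 0 T ×ˢ univ) := by
  obtain ⟨M, h0, hs, hb⟩ := h
  refine continuousOn_tsum (u := M) (fun n => ?_) (summable_of_wt hs h0) (fun n q hq => ?_)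
  · apply ContinuousOn.mul
    · exact (hc n).comp continuous_fst.continuousOn (fun q hq => hq.1)
    · exact ((continuous_em n).comp continuous_snd).continuousOn
  · rw [norm_mul, norm_em, mul_one]
    exact hb n q.1 hq.1

theorem ev_hasDerivWithinAt {T : ℝ} (hT : 0 ≤ T) {m l : ℕ} {f f' : ℤ → ℝ → ℂ} (h : WS T m f)
    (h' : WS T l f') (hc : ∀ n, ContinuousOn (f' n) (Icc 0 T))
    (hd : ∀ n, ∀ τ ∈ Icc 0 T, HasDerivWithinAt (f n) (f' n τ) (Icc 0 T) τ) {τ : ℝ}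
    (hτ : τ ∈ Icc 0 T) (σ : ℝ) :
    HasDerivWithinAt (fun s => ev f s σ) (ev f' τ σ) (Icc 0 T) τ := by
  obtain ⟨M, h0, hs, hb⟩ := h'
  refine hasDerivWithinAt_tsum hT (f := fun n s => f n s * em n σ)
    (f' := fun n s => f' n s * em n σ) (M := M) (summable_of_wt hs h0) ?_ ?_ ?_ ?_ τ hτ
  · intro n s hs
    exact (hd n s hs).mul_const _
  · intro n; exact (hc n).mul continuousOn_const
  · intro n s hs
    rw [norm_mul, norm_em, mul_one]
    exact hb n s hs
  · exact (ev_summable h ⟨le_rfl, hT⟩ σ).of_norm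

theorem integral_em (n : ℤ) : ∫ σ in (0:ℝ)..π, em n σ = if n = 0 then (π : ℂ) else 0 := by
  split_ifs with h
  · subst h; simp [em_zero]
  · have hn : (2 * Complex.I * n : ℂ) ≠ 0 := by simp [h]
    have hd : ∀ σ, HasDerivAt (fun s => em n s / (2 * Complex.I * n)) (em n σ) σ := by
      intro σ
      have := (hasDerivAt_em n σ).div_const (2 * Complex.I * n)
      exact this.congr_deriv (mul_div_cancel_left₀ _ hn)
    rw [intervalIntegral.integral_eq_sub_of_hasDerivAt (fun σ _ => hd σ)
      ((continuous_em n).intervalIntegrable _ _)]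
    have := em_periodic n 0
    rw [zero_add] at this
    rw [this]; ring

theorem integral_ev {T : ℝ} {m : ℕ} {f : ℤ → ℝ → ℂ} (h : WS T m f) {τ : ℝ} (hτ : τ ∈ Icc 0 T) :
    ∫ σ in (0:ℝ)..π, ev f τ σ = π * f 0 τ := by
  have h1 := intervalIntegral.hasSum_intervalIntegral_of_summable_norm (a := 0) (b := π)
    (f := fun n : ℤ => (⟨fun σ => f n τ * em n σ, by
      exact continuous_const.mul (continuous_em n)⟩ : C(ℝ, ℂ))) (by
      refine (h.summable hτ).of_nonneg_of_le (fun n => norm_nonneg _) (fun n => ?_)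
      rw [ContinuousMap.norm_le _ (norm_nonneg _)]
      intro x
      simp [norm_em])
  have h2 := h1.tsum_eq
  simp only [ContinuousMap.coe_mk, intervalIntegral.integral_const_mul, integral_em] at h2
  unfold ev
  rw [← h2]
  rw [tsum_eq_single 0]
  · simp; ring
  · intro n hn; simp [hn]

/-! reality -/
def CS (T : ℝ) (f : ℤ → ℝ → ℂ) : Prop := ∀ n, ∀ τ ∈ Icc 0 T, f (-n) τ = conj (f n τ)

theorem CS.ev_conj {T : ℝ} {f : ℤ → ℝ → ℂ} (h : CS T f) {τ : ℝ} (hτ : τ ∈ Icc 0 T) (σ : ℝ) :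
    conj (ev f τ σ) = ev f τ σ := by
  unfold ev
  rw [Complex.conj_tsum, ← (Equiv.neg ℤ).tsum_eq]
  refine tsum_congr (fun n => ?_)
  simp only [Equiv.neg_apply, map_mul, em_conj, neg_neg]
  rw [h n τ hτ]; simp

theorem CS.ev_re {T : ℝ} {f : ℤ → ℝ → ℂ} (h : CS T f) {τ : ℝ} (hτ : τ ∈ Icc 0 T) (σ : ℝ) :
    (((ev f τ σ).re : ℝ) : ℂ) = ev f τ σ := Complex.conj_eq_iff_re.1 (h.ev_conj hτ σ)

theorem CS.add {T : ℝ} {f g : ℤ → ℝ → ℂ} (hf : CS T f) (hg : CS T g) :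
    CS T (fun n τ => f n τ + g n τ) := by
  intro n τ hτ
  simp only [hf n τ hτ, hg n τ hτ, map_add]

theorem CS.cnv {T : ℝ} {f g : ℤ → ℝ → ℂ} (hf : CS T f) (hg : CS T g) : CS T (cnv f g) := by
  intro n τ hτ
  unfold GF.cnv
  rw [Complex.conj_tsum, ← (Equiv.neg ℤ).tsum_eq]
  refine tsum_congr (fun j => ?_)
  simp only [Equiv.neg_apply, map_mul]
  rw [hf j τ hτ, show -n - -j = -(n - j) by ring, hg _ τ hτ]

theorem CS.ds {T : ℝ} {f : ℤ → ℝ → ℂ} (hf : CS T f) : CS T (ds f) := by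
  intro n τ hτ
  unfold GF.ds
  rw [hf n τ hτ]; simp [Complex.conj_ofNat]

end GF

open scoped Topology ComplexConjugate

namespace GF

/-! time-regular sequences -/
def SM (T : ℝ) : ℕ → (ℤ → ℝ → ℂ) → Prop
  | 0, f => (∀ n, ContinuousOn (f n) (Icc 0 T)) ∧ ∀ m, WS T m f
  | j + 1, f => ((∀ n, ContinuousOn (f n) (Icc 0 T)) ∧ ∀ m, WS T m f) ∧
      ∃ f' : ℤ → ℝ → ℂ, (∀ n, ∀ τ ∈ Icc 0 T, HasDerivWithinAt (f n) (f' n τ) (Icc 0 T) τ) ∧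
        SM T j f'

theorem SM.zero {T : ℝ} {j : ℕ} {f : ℤ → ℝ → ℂ} (h : SM T j f) :
    (∀ n, ContinuousOn (f n) (Icc 0 T)) ∧ ∀ m, WS T m f := by
  cases j with
  | zero => exact h
  | succ j => exact h.1

theorem SM.pred {T : ℝ} : ∀ {j : ℕ} {f : ℤ → ℝ → ℂ}, SM T (j + 1) f → SM T j f
  | 0, _, h => h.1
  | _ + 1, _, h => ⟨h.1, h.2.choose, h.2.choose_spec.1, h.2.choose_spec.2.pred⟩

theorem SM.add {T : ℝ} : ∀ {j : ℕ} {f g : ℤ → ℝ → ℂ}, SM T j f → SM T j g →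
    SM T j (fun n τ => f n τ + g n τ)
  | 0, _, _, hf, hg => ⟨fun n => (hf.1 n).add (hg.1 n), fun m => (hf.2 m).add (hg.2 m)⟩
  | j + 1, f, g, hf, hg => by
    obtain ⟨hf0, f', hf1, hf2⟩ := hf
    obtain ⟨hg0, g', hg1, hg2⟩ := hg
    exact ⟨⟨fun n => (hf0.1 n).add (hg0.1 n), fun m => (hf0.2 m).add (hg0.2 m)⟩,
      fun n τ => f' n τ + g' n τ, fun n τ hτ => (hf1 n τ hτ).add (hg1 n τ hτ), hf2.add hg2⟩

theorem SM.mult {T : ℝ} {c : ℤ → ℂ} {C : ℝ} {s : ℕ} (hc : ∀ n, ‖c n‖ ≤ C * wt n ^ s) :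
    ∀ {j : ℕ} {f : ℤ → ℝ → ℂ}, SM T j f → SM T j (fun n τ => c n * f n τ)
  | 0, _, hf => ⟨fun n => continuousOn_const.mul (hf.1 n), fun m => (hf.2 (m + s)).mult hc⟩
  | j + 1, f, hf => by
    obtain ⟨hf0, f', hf1, hf2⟩ := hf
    exact ⟨⟨fun n => continuousOn_const.mul (hf0.1 n), fun m => (hf0.2 (m + s)).mult hc⟩,
      fun n τ => c n * f' n τ, fun n τ hτ => (hf1 n τ hτ).const_mul (c n), SM.mult hc hf2⟩

theorem norm_two_I_le (n : ℤ) : ‖(2 * Complex.I * n : ℂ)‖ ≤ 2 * wt n ^ 1 := by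
  rw [norm_two_I, pow_one]; unfold wt; linarith

theorem norm_inv_two_I_le (n : ℤ) : ‖(2 * Complex.I * n : ℂ)⁻¹‖ ≤ 1 * wt n ^ 0 := by
  rw [norm_inv, norm_two_I, pow_zero, mul_one]
  rcases eq_or_ne n 0 with h | h
  · simp [h]
  · have : (1:ℝ) ≤ |(n:ℝ)| := by exact_mod_cast Int.one_le_abs h
    exact inv_le_one_of_one_le₀ (by linarith)

theorem SM.ds {T : ℝ} {j : ℕ} {f : ℤ → ℝ → ℂ} (h : SM T j f) : SM T j (ds f) :=
  SM.mult norm_two_I_le h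

theorem cnv_continuousOn {T : ℝ} {m l : ℕ} {f g : ℤ → ℝ → ℂ} (hf : WS T m f) (hg : WS T l g)
    (hcf : ∀ n, ContinuousOn (f n) (Icc 0 T)) (hcg : ∀ n, ContinuousOn (g n) (Icc 0 T)) (n : ℤ) :
    ContinuousOn (cnv f g n) (Icc 0 T) := by
  obtain ⟨M, h0, hs, hb⟩ := hf
  obtain ⟨M', h0', hs', hb'⟩ := hg
  refine continuousOn_tsum (u := fun j => M j * M' (n - j))
    (fun j => (hcf j).mul (hcg (n - j))) (summable_conv_fiber (summable_of_wt hs h0)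
      (summable_of_wt hs' h0') h0 h0' n) (fun j τ hτ => ?_)
  rw [norm_mul]
  exact mul_le_mul (hb _ _ hτ) (hb' _ _ hτ) (norm_nonneg _) (h0 _)

theorem cnv_hasDerivWithinAt {T : ℝ} (hT : 0 ≤ T) {f g f' g' : ℤ → ℝ → ℂ} (hf : WS T 0 f)
    (hg : WS T 0 g) (hf' : WS T 0 f') (hg' : WS T 0 g')
    (hcf : ∀ n, ContinuousOn (f n) (Icc 0 T)) (hcg : ∀ n, ContinuousOn (g n) (Icc 0 T))
    (hcf' : ∀ n, ContinuousOn (f' n) (Icc 0 T)) (hcg' : ∀ n, ContinuousOn (g' n) (Icc 0 T))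
    (h1 : ∀ n, ∀ τ ∈ Icc 0 T, HasDerivWithinAt (f n) (f' n τ) (Icc 0 T) τ)
    (h2 : ∀ n, ∀ τ ∈ Icc 0 T, HasDerivWithinAt (g n) (g' n τ) (Icc 0 T) τ) (n : ℤ) (τ : ℝ)
    (hτ : τ ∈ Icc 0 T) :
    HasDerivWithinAt (cnv f g n) (cnv f' g n τ + cnv f g' n τ) (Icc 0 T) τ := by
  have hsum : cnv f' g n τ + cnv f g' n τ
      = ∑' j, (f' j τ * g (n - j) τ + f j τ * g' (n - j) τ) := by
    unfold cnv
    exact ((summable_cnv hf' hg n hτ).of_norm.tsum_add (summable_cnv hf hg' n hτ).of_norm).symm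
  rw [hsum]
  have hz := (summable_cnv hf hg n (⟨le_rfl, hT⟩ : (0:ℝ) ∈ Icc 0 T)).of_norm
  obtain ⟨M, m0, ms, mb⟩ := hf
  obtain ⟨N, n0, ns, nb⟩ := hg
  obtain ⟨M', m0', ms', mb'⟩ := hf'
  obtain ⟨N', n0', ns', nb'⟩ := hg'
  have s1 := summable_conv_fiber (summable_of_wt ms' m0') (summable_of_wt ns n0) m0' n0 n
  have s2 := summable_conv_fiber (summable_of_wt ms m0) (summable_of_wt ns' n0') m0 n0' n
  refine hasDerivWithinAt_tsum hT (f := fun j s => f j s * g (n - j) s)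
    (f' := fun j s => f' j s * g (n - j) s + f j s * g' (n - j) s) (s1.add s2) ?_ ?_ ?_ hz τ hτ
  · intro j s hs
    exact (h1 j s hs).mul (h2 (n - j) s hs)
  · intro j
    exact ((hcf' j).mul (hcg _)).add ((hcf j).mul (hcg' _))
  · intro j s hs
    refine (norm_add_le _ _).trans (add_le_add ?_ ?_)
    · rw [norm_mul]
      exact mul_le_mul (mb' _ _ hs) (nb _ _ hs) (norm_nonneg _) (m0' _)
    · rw [norm_mul]
      exact mul_le_mul (mb _ _ hs) (nb' _ _ hs) (norm_nonneg _) (m0 _)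

theorem SM.cnv {T : ℝ} (hT : 0 ≤ T) : ∀ {j : ℕ} {f g : ℤ → ℝ → ℂ}, SM T j f → SM T j g →
    SM T j (cnv f g)
  | 0, _, _, hf, hg => ⟨cnv_continuousOn (hf.2 0) (hg.2 0) hf.1 hg.1,
      fun m => (hf.2 m).cnv (hg.2 m)⟩
  | j + 1, f, g, hf, hg => by
    have hf' := hf.pred
    have hg' := hg.pred
    obtain ⟨hf0, f', hf1, hf2⟩ := hf
    obtain ⟨hg0, g', hg1, hg2⟩ := hg
    refine ⟨⟨cnv_continuousOn (hf0.2 0) (hg0.2 0) hf0.1 hg0.1, fun m => (hf0.2 m).cnv (hg0.2 m)⟩,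
      fun n τ => GF.cnv f' g n τ + GF.cnv f g' n τ, fun n τ hτ => ?_,
      (SM.cnv hT hf2 hg').add (SM.cnv hT hf' hg2)⟩
    exact cnv_hasDerivWithinAt hT (hf0.2 0) (hg0.2 0) (hf2.zero.2 0) (hg2.zero.2 0) hf0.1 hg0.1
      hf2.zero.1 hg2.zero.1 hf1 hg1 n τ hτ

theorem SM.contDiffOn {T : ℝ} (hT : 0 < T) : ∀ {j : ℕ} {f : ℤ → ℝ → ℂ}, SM T j f →
    ContDiffOn ℝ j (fun q : ℝ × ℝ => ev f q.1 q.2) (Icc 0 T ×ˢ univ)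
  | 0, f, h => by
    rw [Nat.cast_zero, contDiffOn_zero]
    exact ev_continuousOn (h.2 0) h.1
  | j + 1, f, h => by
    have hd := h.pred.ds
    obtain ⟨h0, f', h1, h2⟩ := h
    exact contDiffOn_succ_of_partials hT
      (fun τ hτ σ => ev_hasDerivWithinAt hT.le (h0.2 0) (h2.zero.2 0) h2.zero.1 h1 hτ σ)
      (fun τ hτ σ => ev_hasDerivAt (h0.2 1) hτ σ) (SM.contDiffOn hT h2) (SM.contDiffOn hT hd)

/-! the Fourier system -/
def Qs (d : ℤ → ℝ → ℂ) : ℤ → ℝ → ℂ := fun n τ => cnv (ds d) (ds d) n τ + ds d n τ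
def As (d : ℤ → ℝ → ℂ) : ℤ → ℝ → ℂ := fun n τ => (2 * Complex.I * n : ℂ)⁻¹ * Qs d n τ
def NL (d : ℤ → ℝ → ℂ) : ℤ → ℝ → ℂ := fun n τ => As d n τ + cnv (As d) (ds d) n τ

structure Sol (T : ℝ) (d : ℤ → ℝ → ℂ) : Prop where
  ws : WS T 1 d
  cs : CS T d
  ode : ∀ n, ∀ τ ∈ Icc 0 T,
    HasDerivWithinAt (d n) (-(4 * (n:ℝ) ^ 2 : ℝ) * d n τ + NL d n τ) (Icc 0 T) τ

theorem WS.Qs {T : ℝ} {m : ℕ} {d : ℤ → ℝ → ℂ} (h : WS T (m + 1) d) : WS T m (Qs d) :=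
  (h.ds.cnv h.ds).add h.ds

theorem WS.As {T : ℝ} {m : ℕ} {d : ℤ → ℝ → ℂ} (h : WS T (m + 1) d) : WS T m (As d) :=
  WS.mult (s := 0) h.Qs norm_inv_two_I_le

theorem WS.NL {T : ℝ} {m : ℕ} {d : ℤ → ℝ → ℂ} (h : WS T (m + 1) d) : WS T m (NL d) :=
  h.As.add (h.As.cnv h.ds)

theorem CS.As {T : ℝ} {d : ℤ → ℝ → ℂ} (h : CS T d) : CS T (As d) := by
  intro n τ hτ
  have : CS T (GF.Qs d) := (h.ds.cnv h.ds).add h.ds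
  unfold GF.As
  rw [this n τ hτ]
  simp [Complex.conj_ofNat]

theorem CS.NL {T : ℝ} {d : ℤ → ℝ → ℂ} (h : CS T d) : CS T (NL d) :=
  h.As.add (h.As.cnv h.ds)

theorem ode_bound {T l : ℝ} (hl : 0 < l) {M : ℝ} (hM : 0 ≤ M) {y f : ℝ → ℂ}
    (h : ∀ τ ∈ Icc 0 T, HasDerivWithinAt y (-(l : ℂ) * y τ + f τ) (Icc 0 T) τ)
    (hf : ∀ τ ∈ Icc 0 T, ‖f τ‖ ≤ M) (τ : ℝ) (hτ : τ ∈ Icc 0 T) :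
    ‖y τ‖ ≤ ‖y 0‖ + M / l := by
  set g : ℝ → ℂ := fun s => (Real.exp (l * s) : ℂ) * y s with hg
  have hexp : ∀ s : ℝ, HasDerivAt (fun s : ℝ => Real.exp (l * s)) (Real.exp (l * s) * l) s := by
    intro s
    have := ((hasDerivAt_id s).const_mul l).exp
    simpa using this
  have hd : ∀ s ∈ Icc 0 T, HasDerivWithinAt g ((Real.exp (l * s) : ℂ) * f s) (Icc 0 T) s := by
    intro s hs
    have h1 := ((hexp s).ofReal_comp.hasDerivWithinAt (s := Icc 0 T)).mul (h s hs)
    refine h1.congr_deriv ?_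
    push_cast; ring
  have key := image_norm_le_of_norm_deriv_right_le_deriv_boundary (a := 0) (b := T) (f := g)
    (f' := fun s => (Real.exp (l * s) : ℂ) * f s)
    (B := fun s => ‖y 0‖ + M / l * (Real.exp (l * s) - 1)) (B' := fun s => M * Real.exp (l * s))
    (fun s hs => (hd s hs).continuousWithinAt)
    (fun s hs => (hd s ⟨hs.1, hs.2.le⟩).mono_of_mem_nhdsWithin
      (mem_of_superset (Icc_mem_nhdsGE hs.2) (Icc_subset_Icc_left hs.1)))
    (by simp [hg])
    (fun s => by
      have := (((hexp s).sub_const 1).const_mul (M / l)).const_add ‖y 0‖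
      refine this.congr_deriv ?_
      field_simp)
    (fun s hs => by
      rw [norm_mul, Complex.norm_real, Real.norm_of_nonneg (Real.exp_pos _).le, mul_comm]
      exact mul_le_mul_of_nonneg_right (hf s ⟨hs.1, hs.2.le⟩) (Real.exp_pos _).le)
  have := key hτ
  simp only [hg] at this
  rw [norm_mul, Complex.norm_real, Real.norm_of_nonneg (Real.exp_pos _).le] at this
  have he : 1 ≤ Real.exp (l * τ) := Real.one_le_exp (mul_nonneg hl.le hτ.1)
  have hq : 0 ≤ M / l := div_nonneg hM hl.le
  have hy := norm_nonneg (y 0)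
  by_contra hcon
  push Not at hcon
  nlinarith [mul_le_mul_of_nonneg_left hcon.le (Real.exp_pos (l*τ)).le]

theorem summable_single (c : ℝ) (m : ℕ) :
    Summable (fun n : ℤ => wt n ^ m * (if n = 0 then c else 0)) := by
  refine summable_of_ne_finset_zero (s := {0}) (fun n hn => ?_)
  simp at hn
  simp [hn]

theorem Sol.ws_succ {T : ℝ} {d : ℤ → ℝ → ℂ} (h : Sol T d)
    (hi : ∀ m : ℕ, Summable (fun n => wt n ^ m * ‖d n 0‖)) {m : ℕ} (hm : WS T (m + 1) d) :
    WS T (m + 2) d := by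
  obtain ⟨N, n0, ns, nb⟩ := hm.NL
  obtain ⟨M, m0, ms, mb⟩ := hm
  refine ⟨fun n => ‖d n 0‖ + N n / wt n ^ 2 + (if n = 0 then M 0 else 0), fun n => ?_, ?_, ?_⟩
  · have := n0 n
    have := m0 0
    have := wt_pos n
    dsimp only
    split_ifs <;> positivity
  · have := ((hi (m + 2)).add ns).add (summable_single (M 0) (m + 2))
    refine this.congr (fun n => ?_)
    have h0 : wt n ^ (m + 2) * (N n / wt n ^ 2) = wt n ^ m * N n := by
      have := (wt_pos n).ne'
      rw [pow_add]; field_simp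
    rw [mul_add, mul_add, h0]
  · intro n τ hτ
    rcases eq_or_ne n 0 with hn | hn
    · subst hn
      have := mb 0 τ hτ
      have h1 := norm_nonneg (d 0 0)
      have h2 : 0 ≤ N 0 / wt 0 ^ 2 := div_nonneg (n0 0) (pow_pos (wt_pos 0) 2).le
      simp only [if_true]
      linarith
    · have h1 : (1:ℝ) ≤ |(n:ℝ)| := by exact_mod_cast Int.one_le_abs hn
      have hl : (0:ℝ) < 4 * (n:ℝ)^2 := by
        rw [← sq_abs]; positivity
      have := ode_bound hl (n0 n) (f := fun s => GF.NL d n s) (h.ode n) (nb n) τ hτ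
      refine this.trans ?_
      simp only [hn, if_false, add_zero]
      have h3 : N n / (4 * (n:ℝ)^2) ≤ N n / wt n ^ 2 := by
        apply div_le_div_of_nonneg_left (n0 n) (pow_pos (wt_pos n) 2)
        unfold wt
        rw [← sq_abs (n:ℝ)]
        nlinarith
      linarith

theorem Sol.ws_all {T : ℝ} {d : ℤ → ℝ → ℂ} (h : Sol T d)
    (hi : ∀ m : ℕ, Summable (fun n => wt n ^ m * ‖d n 0‖)) (m : ℕ) : WS T m d := by
  have : ∀ m : ℕ, WS T (m + 1) d := by
    intro m
    induction m with
    | zero => exact h.ws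
    | succ m ih => exact h.ws_succ hi ih
  exact (this m).mono (Nat.le_succ m)

theorem SM.As {T : ℝ} (hT : 0 ≤ T) {j : ℕ} {d : ℤ → ℝ → ℂ} (h : SM T j d) : SM T j (As d) :=
  SM.mult norm_inv_two_I_le ((SM.cnv hT h.ds h.ds).add h.ds)

theorem SM.NL {T : ℝ} (hT : 0 ≤ T) {j : ℕ} {d : ℤ → ℝ → ℂ} (h : SM T j d) : SM T j (NL d) :=
  (h.As hT).add (SM.cnv hT (h.As hT) h.ds)

theorem norm_sq_le (n : ℤ) : ‖(-(4 * (n:ℝ) ^ 2 : ℝ) : ℂ)‖ ≤ 4 * wt n ^ 2 := by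
  rw [norm_neg, Complex.norm_real, Real.norm_of_nonneg (by positivity), ← sq_abs]
  unfold wt
  nlinarith [abs_nonneg (n:ℝ)]

theorem Sol.sm {T : ℝ} (hT : 0 ≤ T) {d : ℤ → ℝ → ℂ} (h : Sol T d)
    (hi : ∀ m : ℕ, Summable (fun n => wt n ^ m * ‖d n 0‖)) (j : ℕ) : SM T j d := by
  have h0 : (∀ n, ContinuousOn (d n) (Icc 0 T)) ∧ ∀ m, WS T m d :=
    ⟨fun n τ hτ => (h.ode n τ hτ).continuousWithinAt, h.ws_all hi⟩
  induction j with
  | zero => exact h0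
  | succ j ih =>
    exact ⟨h0, _, h.ode, (SM.mult norm_sq_le ih).add (ih.NL hT)⟩

end GF

open scoped Topology ComplexConjugate ENNReal NNReal

namespace GF

abbrev CI (T : ℝ) := C(Icc (0:ℝ) T, ℂ)
abbrev ES (T : ℝ) := lp (fun _ : ℤ => CI T) 1

theorem ES.summable {T : ℝ} (f : ES T) : Summable (fun n => ‖f n‖) := by
  have := (lp.memℓp f).summable (by simp)
  simpa using this

theorem ES.norm_eq {T : ℝ} (f : ES T) : ‖f‖ = ∑' n, ‖f n‖ := by
  rw [lp.norm_eq_tsum_rpow (by simp)]; simp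

def mkE {T : ℝ} (f : ℤ → CI T) (h : Summable (fun n => ‖f n‖)) : ES T :=
  ⟨f, memℓp_gen (by simpa using h)⟩

theorem mkE_apply {T : ℝ} (f : ℤ → CI T) (h : Summable (fun n => ‖f n‖)) (n : ℤ) :
    mkE f h n = f n := rfl

theorem norm_mkE_le {T : ℝ} (f : ℤ → CI T) (h : Summable (fun n => ‖f n‖)) {b : ℤ → ℝ}
    (hb : Summable b) (hfb : ∀ n, ‖f n‖ ≤ b n) : ‖mkE f h‖ ≤ ∑' n, b n := by
  rw [ES.norm_eq]
  exact Summable.tsum_le_tsum hfb h hb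

theorem cv_fib {T : ℝ} (f g : ES T) (n : ℤ) : Summable (fun j => ‖f j * g (n - j)‖) :=
  (summable_conv_fiber (a := fun n => ‖f n‖) (b := fun n => ‖g n‖) (ES.summable f) (ES.summable g) (fun _ => norm_nonneg _) (fun _ => norm_nonneg _)
    n).of_nonneg_of_le (fun _ => norm_nonneg _) (fun _ => norm_mul_le _ _)

theorem cv_bd {T : ℝ} (f g : ES T) (n : ℤ) :
    ‖∑' j, f j * g (n - j)‖ ≤ ∑' j, ‖f j‖ * ‖g (n - j)‖ :=
  tsum_of_norm_bounded (summable_conv_fiber (a := fun n => ‖f n‖) (b := fun n => ‖g n‖) (ES.summable f) (ES.summable g) (fun _ => norm_nonneg _)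
    (fun _ => norm_nonneg _) n).hasSum (fun _ => norm_mul_le _ _)

def cv {T : ℝ} (f g : ES T) : ES T :=
  mkE (fun n => ∑' j, f j * g (n - j))
    ((summable_conv (a := fun n => ‖f n‖) (b := fun n => ‖g n‖) (ES.summable f) (ES.summable g) (fun _ => norm_nonneg _)
      (fun _ => norm_nonneg _)).of_nonneg_of_le (fun _ => norm_nonneg _) (cv_bd f g))

theorem norm_cv_le {T : ℝ} (f g : ES T) : ‖cv f g‖ ≤ ‖f‖ * ‖g‖ := by
  have h1 : Summable (fun n => ∑' j, ‖f j‖ * ‖g (n - j)‖) :=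
    summable_conv (a := fun n => ‖f n‖) (b := fun n => ‖g n‖) (ES.summable f) (ES.summable g) (fun _ => norm_nonneg _) (fun _ => norm_nonneg _)
  have h2 : ∑' n, ∑' j, ‖f j‖ * ‖g (n - j)‖ = (∑' n, ‖f n‖) * ∑' n, ‖g n‖ :=
    tsum_conv (a := fun n => ‖f n‖) (b := fun n => ‖g n‖) (ES.summable f) (ES.summable g)
      (fun _ => norm_nonneg _) (fun _ => norm_nonneg _)
  have h3 : ‖cv f g‖ ≤ ∑' n, ∑' j, ‖f j‖ * ‖g (n - j)‖ := norm_mkE_le _ _ h1 (cv_bd f g)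
  rw [ES.norm_eq f, ES.norm_eq g]
  exact h3.trans h2.le

theorem cv_sub_left {T : ℝ} (f f' g : ES T) : cv (f - f') g = cv f g - cv f' g := by
  apply lp.ext
  funext n
  rw [lp.coeFn_sub, Pi.sub_apply]
  change ∑' j, (f - f') j * g (n - j) = (∑' j, f j * g (n - j)) - ∑' j, f' j * g (n - j)
  rw [← (cv_fib f g n).of_norm.tsum_sub (cv_fib f' g n).of_norm]
  refine tsum_congr (fun j => ?_)
  rw [lp.coeFn_sub, Pi.sub_apply, sub_mul]

theorem cv_sub_right {T : ℝ} (f g g' : ES T) : cv f (g - g') = cv f g - cv f g' := by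
  apply lp.ext
  funext n
  rw [lp.coeFn_sub, Pi.sub_apply]
  change ∑' j, f j * (g - g') (n - j) = (∑' j, f j * g (n - j)) - ∑' j, f j * g' (n - j)
  rw [← (cv_fib f g n).of_norm.tsum_sub (cv_fib f g' n).of_norm]
  refine tsum_congr (fun j => ?_)
  rw [lp.coeFn_sub, Pi.sub_apply, mul_sub]

/-- apply a bounded map modewise -/
def mapE {T C : ℝ} (D : ℤ → CI T → CI T) (hD : ∀ n f, ‖D n f‖ ≤ C * ‖f‖) (f : ES T) : ES T :=
  mkE (fun n => D n (f n)) (((ES.summable f).mul_left C).of_nonneg_of_le (fun _ => norm_nonneg _)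
    (fun n => hD n _))

theorem norm_mapE_le {T C : ℝ} (D : ℤ → CI T → CI T) (hD : ∀ n f, ‖D n f‖ ≤ C * ‖f‖) (f : ES T) :
    ‖mapE D hD f‖ ≤ C * ‖f‖ := by
  rw [ES.norm_eq f, ← tsum_mul_left]
  exact norm_mkE_le _ _ ((ES.summable f).mul_left C) (fun n => hD n _)

theorem mapE_sub {T C : ℝ} (D : ℤ → CI T → CI T) (hD : ∀ n f, ‖D n f‖ ≤ C * ‖f‖)
    (hs : ∀ n f g, D n (f - g) = D n f - D n g) (f g : ES T) :
    mapE D hD (f - g) = mapE D hD f - mapE D hD g := by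
  apply lp.ext
  funext n
  rw [lp.coeFn_sub, Pi.sub_apply]
  change D n ((f - g) n) = D n (f n) - D n (g n)
  rw [lp.coeFn_sub, Pi.sub_apply, hs]

/-- Duhamel operator on functions -/
def duhf (n : ℤ) (g : ℝ → ℂ) (τ : ℝ) : ℂ :=
  (Real.exp (-(4 * (n:ℝ)^2 * τ)) : ℂ) * ∫ s in (0:ℝ)..τ, (Real.exp (4 * (n:ℝ)^2 * s) : ℂ) * g s

theorem duhf_hasDerivAt (n : ℤ) {g : ℝ → ℂ} (hg : Continuous g) (τ : ℝ) :
    HasDerivAt (duhf n g) (-(4 * (n:ℝ)^2 : ℝ) * duhf n g τ + g τ) τ := by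
  have hc : Continuous (fun s => (Real.exp (4 * (n:ℝ)^2 * s) : ℂ) * g s) := by fun_prop
  have h1 := intervalIntegral.integral_hasDerivAt_right (hc.intervalIntegrable 0 τ)
    (hc.stronglyMeasurableAtFilter _ _) hc.continuousAt
  have h2 : HasDerivAt (fun t : ℝ => Real.exp (-(4 * (n:ℝ)^2 * t)))
      (Real.exp (-(4 * (n:ℝ)^2 * τ)) * -(4 * (n:ℝ)^2)) τ := by
    have := ((hasDerivAt_id τ).const_mul (4 * (n:ℝ)^2)).neg.exp
    simpa using this
  have h3 := h2.ofReal_comp.mul h1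
  refine h3.congr_deriv ?_
  unfold duhf
  have he : (Real.exp (-(4 * (n:ℝ)^2 * τ)) : ℂ) * (Real.exp (4 * (n:ℝ)^2 * τ) : ℂ) = 1 := by
    rw [← Complex.ofReal_mul, ← Real.exp_add]; simp
  rw [← mul_assoc, he]
  push_cast; ring

theorem duhf_zero (n : ℤ) (g : ℝ → ℂ) : duhf n g 0 = 0 := by simp [duhf]

theorem one_sub_exp_le (y : ℝ) (hy : 0 ≤ y) : 1 - Real.exp (-y) ≤ Real.sqrt y := by
  have h1 := Real.add_one_le_exp (-y)
  rcases le_total y 1 with h | h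
  · have : y ≤ Real.sqrt y := by
      apply Real.le_sqrt_of_sq_le; nlinarith
    linarith
  · have : 1 ≤ Real.sqrt y := Real.one_le_sqrt.2 h
    linarith [Real.exp_pos (-y)]

theorem duhf_bound (n : ℤ) {g : ℝ → ℂ} {T M τ : ℝ} (hτ : τ ∈ Icc 0 T)
    (hM : ∀ s, ‖g s‖ ≤ M) : ‖(2 * Complex.I * n : ℂ) * duhf n g τ‖ ≤ Real.sqrt T * M := by
  have hM0 : 0 ≤ M := (norm_nonneg _).trans (hM 0)
  rcases eq_or_ne n 0 with hn | hn
  · subst hn; simp; positivity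
  have h1 : (1:ℝ) ≤ |(n:ℝ)| := by exact_mod_cast Int.one_le_abs hn
  set l : ℝ := 4 * (n:ℝ)^2 with hl
  have hl0 : 0 < l := by rw [hl, ← sq_abs]; positivity
  have hsl : Real.sqrt l = 2 * |(n:ℝ)| := by
    rw [hl, show 4 * (n:ℝ)^2 = (2 * |(n:ℝ)|)^2 by rw [mul_pow, sq_abs]; norm_num]
    exact Real.sqrt_sq (by positivity)
  have hintg : ‖∫ s in (0:ℝ)..τ, (Real.exp (l * s) : ℂ) * g s‖ ≤ (Real.exp (l*τ) - 1) / l * M := by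
    have hI : ∫ s in (0:ℝ)..τ, Real.exp (l * s) * M = (Real.exp (l*τ) - 1) / l * M := by
      rw [intervalIntegral.integral_mul_const]
      congr 1
      rw [intervalIntegral.integral_eq_sub_of_hasDerivAt (f := fun s => Real.exp (l * s) / l)
        (fun s _ => by
          have := (((hasDerivAt_id s).const_mul l).exp).div_const l
          refine this.congr_deriv ?_
          simp [hl0.ne']) (Continuous.intervalIntegrable (by fun_prop) _ _)]
      simp; ring
    rw [← hI]
    refine intervalIntegral.norm_integral_le_of_norm_le hτ.1 ?_ ?_
    · refine Eventually.of_forall (fun s _ => ?_)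
      rw [norm_mul, Complex.norm_real, Real.norm_of_nonneg (Real.exp_pos _).le]
      exact mul_le_mul_of_nonneg_left (hM s) (Real.exp_pos _).le
    · exact Continuous.intervalIntegrable (by fun_prop) _ _
  unfold duhf
  rw [norm_mul, norm_two_I, norm_mul, Complex.norm_real, Real.norm_of_nonneg (Real.exp_pos _).le,
    ← hsl, ← hl]
  have hs0 : 0 < Real.sqrt l := Real.sqrt_pos.2 hl0
  have hss : Real.sqrt l * Real.sqrt l = l := Real.mul_self_sqrt hl0.le
  have he : Real.exp (-(l*τ)) * Real.exp (l*τ) = 1 := by rw [← Real.exp_add]; simp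
  have hb := one_sub_exp_le (l * τ) (mul_nonneg hl0.le hτ.1)
  rw [Real.sqrt_mul hl0.le] at hb
  have hτT : Real.sqrt τ ≤ Real.sqrt T := Real.sqrt_le_sqrt hτ.2
  calc Real.sqrt l * (Real.exp (-(l*τ)) * ‖∫ s in (0:ℝ)..τ, (Real.exp (l * s) : ℂ) * g s‖)
      ≤ Real.sqrt l * (Real.exp (-(l*τ)) * ((Real.exp (l*τ) - 1) / l * M)) := by
        gcongr
    _ = (1 - Real.exp (-(l*τ))) / Real.sqrt l * M := by
        have hd : Real.sqrt l / l = 1 / Real.sqrt l := by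
          rw [div_eq_div_iff hl0.ne' hs0.ne']; linarith
        calc _ = (Real.sqrt l / l) * (Real.exp (-(l*τ)) * Real.exp (l*τ) - Real.exp (-(l*τ))) * M := by
              ring
          _ = _ := by rw [hd, he]; ring
    _ ≤ Real.sqrt T * M := by
        apply mul_le_mul_of_nonneg_right _ hM0
        rw [div_le_iff₀ hs0]
        nlinarith

theorem duhf_conj {T : ℝ} {f : ℤ → ℝ → ℂ} (h : CS T f) : CS T (fun n => duhf n (f n)) := by
  intro n τ hτ
  simp only [duhf]
  rw [map_mul, Complex.conj_ofReal]
  have h1 : conj (∫ s in (0:ℝ)..τ, (Real.exp (4 * (n:ℝ)^2 * s) : ℂ) * f n s)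
      = ∫ s in (0:ℝ)..τ, conj ((Real.exp (4 * (n:ℝ)^2 * s) : ℂ) * f n s) := by
    rw [intervalIntegral.integral_of_le hτ.1, intervalIntegral.integral_of_le hτ.1, integral_conj]
  rw [h1]
  congr 1
  · push_cast; ring_nf
  · refine intervalIntegral.integral_congr (fun s hs => ?_)
    rw [uIcc_of_le hτ.1] at hs
    simp only [map_mul, Complex.conj_ofReal]
    rw [h n s ⟨hs.1, hs.2.trans hτ.2⟩]
    push_cast; ring_nf

end GF

open scoped Topology ComplexConjugate ENNReal NNReal

namespace GF

/-- functions on the line from an element of the sequence space -/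
def fn {T : ℝ} (hT : 0 ≤ T) (f : ES T) : ℤ → ℝ → ℂ := fun n τ => f n (projIcc 0 T hT τ)

theorem fn_continuous {T : ℝ} (hT : 0 ≤ T) (f : ES T) (n : ℤ) : Continuous (fn hT f n) :=
  (f n).continuous.comp continuous_projIcc

theorem fn_le {T : ℝ} (hT : 0 ≤ T) (f : ES T) (n : ℤ) (τ : ℝ) : ‖fn hT f n τ‖ ≤ ‖f n‖ :=
  (f n).norm_coe_le_norm _

theorem fn_ws {T : ℝ} (hT : 0 ≤ T) (f : ES T) : WS T 0 (fn hT f) :=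
  ⟨fun n => ‖f n‖, fun _ => norm_nonneg _, by simpa using ES.summable f,
    fun n τ _ => fn_le hT f n τ⟩

theorem fn_cv {T : ℝ} (hT : 0 ≤ T) (f g : ES T) : fn hT (cv f g) = cnv (fn hT f) (fn hT g) := by
  funext n τ
  exact (ContinuousMap.tsum_apply (cv_fib f g n).of_norm (projIcc 0 T hT τ)).symm

def cI {T : ℝ} (c : ℂ) : CI T → CI T := fun f => c • f

/-- multiplication by `1/(2 i n)` -/
def invE {T : ℝ} : ES T → ES T := mapE (C := 1) (fun n f => (2 * Complex.I * n : ℂ)⁻¹ • f) (by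
  intro n f
  rw [norm_smul]
  have := norm_inv_two_I_le n
  rw [pow_zero, mul_one] at this
  exact mul_le_mul_of_nonneg_right this (norm_nonneg _))

theorem invE_norm {T : ℝ} (f : ES T) : ‖invE f‖ ≤ ‖f‖ := by
  have := norm_mapE_le (C := 1) (fun n (f : CI T) => (2 * Complex.I * n : ℂ)⁻¹ • f) (by
    intro n f
    rw [norm_smul]
    have := norm_inv_two_I_le n
    rw [pow_zero, mul_one] at this
    exact mul_le_mul_of_nonneg_right this (norm_nonneg _)) f
  exact this.trans (one_mul _).le

theorem invE_sub {T : ℝ} (f g : ES T) : invE (f - g) = invE f - invE g :=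
  mapE_sub _ _ (fun _ f g => smul_sub _ f g) f g

theorem fn_invE {T : ℝ} (hT : 0 ≤ T) (f : ES T) (n : ℤ) (τ : ℝ) :
    fn hT (invE f) n τ = (2 * Complex.I * n : ℂ)⁻¹ * fn hT f n τ := rfl

def aE {T : ℝ} (k : ES T) : ES T := invE (cv k k + k)
def nE {T : ℝ} (k : ES T) : ES T := aE k + cv (aE k) k

theorem aE_norm {T R : ℝ} {k : ES T} (hk : ‖k‖ ≤ R) : ‖aE k‖ ≤ R * R + R := by
  refine (invE_norm _).trans ((norm_add_le _ _).trans (add_le_add ((norm_cv_le k k).trans ?_) hk))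
  exact mul_le_mul hk hk (norm_nonneg _) ((norm_nonneg _).trans hk)

theorem nE_norm {T R : ℝ} {k : ES T} (hk : ‖k‖ ≤ R) : ‖nE k‖ ≤ (R * R + R) + (R * R + R) * R := by
  have hR : 0 ≤ R := (norm_nonneg _).trans hk
  refine (norm_add_le _ _).trans (add_le_add (aE_norm hk) ((norm_cv_le _ k).trans ?_))
  exact mul_le_mul (aE_norm hk) hk (norm_nonneg _) (by positivity)

theorem aE_lip {T R : ℝ} {k l : ES T} (hk : ‖k‖ ≤ R) (hl : ‖l‖ ≤ R) :
    ‖aE k - aE l‖ ≤ (2 * R + 1) * ‖k - l‖ := by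
  have hR : 0 ≤ R := (norm_nonneg _).trans hk
  unfold aE
  rw [← invE_sub]
  refine (invE_norm _).trans ?_
  have : cv k k + k - (cv l l + l) = cv (k - l) k + cv l (k - l) + (k - l) := by
    rw [cv_sub_left, cv_sub_right]; abel
  rw [this]
  refine (norm_add₃_le).trans ?_
  have h1 := norm_cv_le (k - l) k
  have h2 := norm_cv_le l (k - l)
  have h3 := norm_nonneg (k - l)
  nlinarith [mul_le_mul_of_nonneg_left hk h3, mul_le_mul_of_nonneg_right hl h3]

theorem nE_lip {T R : ℝ} {k l : ES T} (hk : ‖k‖ ≤ R) (hl : ‖l‖ ≤ R) :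
    ‖nE k - nE l‖ ≤ ((2 * R + 1) + (2 * R + 1) * R + (R * R + R)) * ‖k - l‖ := by
  have hR : 0 ≤ R := (norm_nonneg _).trans hk
  have : nE k - nE l = (aE k - aE l) + cv (aE k - aE l) k + cv (aE l) (k - l) := by
    unfold nE; rw [cv_sub_left, cv_sub_right]; abel
  rw [this]
  refine (norm_add₃_le).trans ?_
  have h0 := aE_lip hk hl
  have h1 := norm_cv_le (aE k - aE l) k
  have h2 := norm_cv_le (aE l) (k - l)
  have h3 := norm_nonneg (k - l)
  have h4 := mul_le_mul h0 hk (norm_nonneg _) (by positivity)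
  have h5 := mul_le_mul_of_nonneg_right (aE_norm hl) h3
  nlinarith

theorem fn_add {T : ℝ} (hT : 0 ≤ T) (f g : ES T) (n : ℤ) (τ : ℝ) :
    fn hT (f + g) n τ = fn hT f n τ + fn hT g n τ := by
  unfold fn
  rw [lp.coeFn_add, Pi.add_apply, ContinuousMap.add_apply]

/-- Duhamel on continuous functions -/
def duh {T : ℝ} (hT : 0 ≤ T) (n : ℤ) (g : CI T) : CI T :=
  ⟨fun t => (2 * Complex.I * n : ℂ) * duhf n (fun s => g (projIcc 0 T hT s)) t, by
    have : Continuous (duhf n (fun s => g (projIcc 0 T hT s))) :=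
      continuous_iff_continuousAt.2 fun s =>
        (duhf_hasDerivAt n (g.continuous.comp continuous_projIcc) s).continuousAt
    exact continuous_const.mul (this.comp continuous_subtype_val)⟩

theorem duh_norm {T : ℝ} (hT : 0 ≤ T) (n : ℤ) (g : CI T) : ‖duh hT n g‖ ≤ Real.sqrt T * ‖g‖ := by
  rw [ContinuousMap.norm_le _ (by positivity)]
  intro t
  exact duhf_bound n t.2 (fun s => g.norm_coe_le_norm _)

theorem duh_sub {T : ℝ} (hT : 0 ≤ T) (n : ℤ) (f g : CI T) :
    duh hT n (f - g) = duh hT n f - duh hT n g := by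
  ext t
  have hf : Continuous (fun s => f (projIcc 0 T hT s)) := f.continuous.comp continuous_projIcc
  have hg : Continuous (fun s => g (projIcc 0 T hT s)) := g.continuous.comp continuous_projIcc
  simp only [duh, ContinuousMap.coe_mk, ContinuousMap.sub_apply, duhf, mul_sub]
  rw [intervalIntegral.integral_sub]
  · ring
  · exact Continuous.intervalIntegrable (by fun_prop) _ _
  · exact Continuous.intervalIntegrable (by fun_prop) _ _

def dE {T : ℝ} (hT : 0 ≤ T) : ES T → ES T := mapE (duh hT) (duh_norm hT)

/-- heat evolution of the initial datum -/
def hI {T : ℝ} (c : ℂ) (n : ℤ) : CI T :=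
  ⟨fun t => (Real.exp (-(4 * (n:ℝ)^2 * (t:ℝ))) : ℂ) * c, by fun_prop⟩

theorem hI_norm {T : ℝ} (c : ℂ) (n : ℤ) : ‖(hI c n : CI T)‖ ≤ ‖c‖ := by
  rw [ContinuousMap.norm_le _ (norm_nonneg _)]
  intro t
  simp only [hI, ContinuousMap.coe_mk]
  rw [norm_mul, Complex.norm_real, Real.norm_of_nonneg (Real.exp_pos _).le]
  have : Real.exp (-(4 * (n:ℝ)^2 * (t:ℝ))) ≤ 1 := Real.exp_le_one_iff.2 (by
    have := t.2.1
    have : 0 ≤ 4 * (n:ℝ)^2 * (t:ℝ) := by positivity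
    linarith)
  exact mul_le_of_le_one_left (norm_nonneg _) this

def iE {T : ℝ} (k0 : ℤ → ℂ) (h : Summable (fun n => ‖k0 n‖)) : ES T :=
  mkE (fun n => hI (k0 n) n) (h.of_nonneg_of_le (fun _ => norm_nonneg _) (fun n => hI_norm _ n))

theorem iE_norm {T : ℝ} (k0 : ℤ → ℂ) (h : Summable (fun n => ‖k0 n‖)) :
    ‖(iE k0 h : ES T)‖ ≤ ∑' n, ‖k0 n‖ := norm_mkE_le _ _ h (fun n => hI_norm _ n)

def phiE {T : ℝ} (hT : 0 ≤ T) (k0 : ℤ → ℂ) (h : Summable (fun n => ‖k0 n‖)) (k : ES T) : ES T :=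
  iE k0 h + dE hT (nE k)

theorem fn_phiE {T : ℝ} (hT : 0 ≤ T) (k0 : ℤ → ℂ) (h : Summable (fun n => ‖k0 n‖)) (k : ES T)
    (n : ℤ) {τ : ℝ} (hτ : τ ∈ Icc 0 T) :
    fn hT (phiE hT k0 h k) n τ = (Real.exp (-(4 * (n:ℝ)^2 * τ)) : ℂ) * k0 n
      + (2 * Complex.I * n : ℂ) * duhf n (fn hT (nE k) n) τ := by
  unfold phiE
  rw [fn_add]
  unfold fn
  rw [projIcc_of_mem hT hτ]
  rfl

theorem fn_nE_cs {T : ℝ} (hT : 0 ≤ T) {k : ES T} (h : CS T (fn hT k)) : CS T (fn hT (nE k)) := by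
  have h1 : CS T (fn hT (cv k k + k)) := by
    intro n τ hτ
    rw [fn_add, fn_add, fn_cv, map_add, h n τ hτ, CS.cnv h h n τ hτ]
  have h2 : CS T (fn hT (aE k)) := by
    intro n τ hτ
    unfold aE
    rw [fn_invE, fn_invE, h1 n τ hτ]
    simp [Complex.conj_ofNat]
  intro n τ hτ
  unfold nE
  rw [fn_add, fn_add, fn_cv, map_add, h2 n τ hτ, CS.cnv h2 h n τ hτ]

theorem fn_phiE_cs {T : ℝ} (hT : 0 ≤ T) {k0 : ℤ → ℂ} (h : Summable (fun n => ‖k0 n‖))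
    (hk0 : ∀ n, k0 (-n) = conj (k0 n)) {k : ES T} (hk : CS T (fn hT k)) :
    CS T (fn hT (phiE hT k0 h k)) := by
  intro n τ hτ
  rw [fn_phiE hT k0 h k _ hτ, fn_phiE hT k0 h k _ hτ, hk0]
  have := duhf_conj (fn_nE_cs hT hk) n τ hτ
  simp only at this
  rw [this]
  have h2 : (((-n : ℤ) : ℝ)) ^ 2 = (n:ℝ) ^ 2 := by push_cast; ring
  rw [h2]
  simp only [map_add, map_mul, Complex.conj_ofReal, Complex.conj_I, Complex.conj_ofNat,
    map_intCast]
  push_cast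
  ring

theorem exists_fix (R0 : ℝ) : ∃ T > 0, ∃ hT : 0 ≤ T, ∀ (k0 : ℤ → ℂ)
    (h : Summable (fun n => ‖k0 n‖)), (∀ n, k0 (-n) = conj (k0 n)) → ∑' n, ‖k0 n‖ ≤ R0 →
    ∃ k : ES T, phiE hT k0 h k = k ∧ CS T (fn hT k) := by
  set R := |R0| + 1 with hR
  have hR0 : 0 < R := by positivity
  set B := (R * R + R) + (R * R + R) * R with hB
  set Lp := (2 * R + 1) + (2 * R + 1) * R + (R * R + R) with hL
  have hBL : 0 < B + 2 * Lp := by positivity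
  set T := (1 / (B + 2 * Lp)) ^ 2 with hTd
  have hTp : 0 < T := by positivity
  have hsq : Real.sqrt T = 1 / (B + 2 * Lp) := Real.sqrt_sq (by positivity)
  have hB1 : Real.sqrt T * B ≤ 1 := by
    rw [hsq, div_mul_eq_mul_div, one_mul, div_le_one hBL]
    have : 0 ≤ Lp := by positivity
    linarith
  have hL1 : Real.sqrt T * Lp ≤ 1 / 2 := by
    rw [hsq, div_mul_eq_mul_div, one_mul, div_le_iff₀ hBL]
    have : 0 ≤ B := by positivity
    linarith
  refine ⟨T, hTp, hTp.le, fun k0 h hk0 hk0R => ?_⟩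
  set s : Set (ES T) := Metric.closedBall 0 R ∩ {k | CS T (fn hTp.le k)} with hs
  have hclosed : IsClosed s := by
    refine Metric.isClosed_closedBall.inter ?_
    have hev : ∀ (n : ℤ) (τ : ℝ), Continuous (fun k : ES T => fn hTp.le k n τ) := by
      intro n τ
      have h1 : Continuous (fun k : ES T => k n) :=
        (continuous_apply n).comp (lp.uniformContinuous_coe (p := 1)
          (E := fun _ : ℤ => CI T)).continuous
      exact (continuous_eval_const (F := CI T) (projIcc 0 T hTp.le τ)).comp h1
    have : {k : ES T | CS T (fn hTp.le k)} = ⋂ (n : ℤ) (τ : ℝ) (_ : τ ∈ Icc 0 T),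
        {k | fn hTp.le k (-n) τ = conj (fn hTp.le k n τ)} := by
      ext k; simp only [mem_setOf_eq, mem_iInter]; rfl
    rw [this]
    refine isClosed_iInter fun n => isClosed_iInter fun τ => isClosed_iInter fun _ => ?_
    exact isClosed_eq (hev _ _) (Complex.continuous_conj.comp (hev _ _))
  have hmaps : MapsTo (phiE hTp.le k0 h) s s := by
    intro k hk
    have hkn : ‖k‖ ≤ R := by simpa using hk.1
    refine ⟨?_, fn_phiE_cs hTp.le h hk0 hk.2⟩
    rw [mem_closedBall_zero_iff]
    refine (norm_add_le _ _).trans ?_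
    have h1 := (iE_norm (T := T) k0 h).trans (hk0R.trans (le_abs_self R0))
    have h2 : ‖dE hTp.le (nE k)‖ ≤ Real.sqrt T * ‖nE k‖ := norm_mapE_le _ _ _
    have h3 : Real.sqrt T * ‖nE k‖ ≤ Real.sqrt T * B :=
      mul_le_mul_of_nonneg_left (nE_norm hkn) (Real.sqrt_nonneg _)
    linarith
  have hcon : ContractingWith (1/2) (hmaps.restrict (phiE hTp.le k0 h) s s) := by
    refine ⟨by norm_num, LipschitzWith.of_dist_le_mul (fun x y => ?_)⟩
    have hx : ‖(x : ES T)‖ ≤ R := by simpa using x.2.1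
    have hy : ‖(y : ES T)‖ ≤ R := by simpa using y.2.1
    rw [Subtype.dist_eq, Subtype.dist_eq, dist_eq_norm, dist_eq_norm]
    simp only [MapsTo.val_restrict_apply]
    have : phiE hTp.le k0 h x - phiE hTp.le k0 h y = dE hTp.le (nE x - nE y) := by
      unfold phiE
      rw [add_sub_add_left_eq_sub]
      exact (mapE_sub _ _ (duh_sub hTp.le) _ _).symm
    rw [this]
    have h2 : ‖dE hTp.le (nE (x : ES T) - nE y)‖ ≤ Real.sqrt T * ‖nE (x : ES T) - nE y‖ :=
      norm_mapE_le _ _ _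
    have h3 := mul_le_mul_of_nonneg_left (nE_lip hx hy) (Real.sqrt_nonneg T)
    have h4 := mul_le_mul_of_nonneg_right hL1 (norm_nonneg ((x : ES T) - y))
    have h5 : (((1/2 : ℝ≥0)) : ℝ) = 1/2 := by norm_num
    rw [h5]
    rw [← hL] at h3
    calc _ ≤ _ := h2
      _ ≤ _ := h3
      _ = Real.sqrt T * Lp * ‖(x : ES T) - y‖ := by ring
      _ ≤ _ := h4
  have hz : (0 : ES T) ∈ s := by
    refine ⟨by simpa using hR0.le, ?_⟩
    intro n τ _
    simp [fn]
  obtain ⟨k, hks, hfix, -⟩ := hcon.exists_fixedPoint' hclosed.isComplete hmaps hz (edist_ne_top _ _)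
  exact ⟨k, hfix, hks.2⟩

theorem local_exists (R0 : ℝ) : ∃ T > 0, ∀ d0 : ℤ → ℂ, (∀ n, d0 (-n) = conj (d0 n)) →
    Summable (fun n : ℤ => ‖(2 * Complex.I * n : ℂ) * d0 n‖) →
    ∑' n : ℤ, ‖(2 * Complex.I * n : ℂ) * d0 n‖ ≤ R0 →
    ∃ d : ℤ → ℝ → ℂ, Sol T d ∧ ∀ n, d n 0 = d0 n := by
  obtain ⟨T, hTp, hT, H⟩ := exists_fix R0
  refine ⟨T, hTp, fun d0 hcs hsum hle => ?_⟩
  obtain ⟨k, hk, hkcs⟩ := H (fun n : ℤ => (2 * Complex.I * n : ℂ) * d0 n) hsum (fun n => by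
    rw [hcs]; simp [Complex.conj_ofNat]) hle
  set d : ℤ → ℝ → ℂ := fun n τ => (Real.exp (-(4 * (n:ℝ)^2 * τ)) : ℂ) * d0 n
    + duhf n (fn hT (nE k) n) τ with hd
  have hds : ∀ n, ∀ τ ∈ Icc 0 T, ds d n τ = fn hT k n τ := by
    intro n τ hτ
    rw [← hk, fn_phiE hT _ hsum k n hτ]
    simp only [ds, hd]; ring
  have hNL : ∀ n, ∀ τ ∈ Icc 0 T, NL d n τ = fn hT (nE k) n τ := by
    intro n τ hτ
    have hA : ∀ j, As d j τ = fn hT (aE k) j τ := by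
      intro j
      unfold As Qs aE
      rw [fn_invE, fn_add, fn_cv, hds j τ hτ]
      congr 2
      unfold cnv
      exact tsum_congr (fun i => by rw [hds _ τ hτ, hds _ τ hτ])
    unfold NL nE
    rw [fn_add, fn_cv, hA]
    congr 1
    unfold cnv
    exact tsum_congr (fun i => by rw [hA, hds _ τ hτ])
  have hder : ∀ n, ∀ τ ∈ Icc 0 T,
      HasDerivWithinAt (d n) (-(4 * (n:ℝ) ^ 2 : ℝ) * d n τ + NL d n τ) (Icc 0 T) τ := by
    intro n τ hτ
    have h2 : HasDerivAt (fun t : ℝ => Real.exp (-(4 * (n:ℝ)^2 * t)))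
        (Real.exp (-(4 * (n:ℝ)^2 * τ)) * -(4 * (n:ℝ)^2)) τ := by
      have := ((hasDerivAt_id τ).const_mul (4 * (n:ℝ)^2)).neg.exp
      simpa using this
    have h3 := (h2.ofReal_comp.mul_const (d0 n)).add
      (duhf_hasDerivAt n (fn_continuous hT (nE k) n) τ)
    refine (h3.congr_deriv ?_).hasDerivWithinAt
    rw [hNL n τ hτ]
    simp only [hd]
    push_cast; ring
  have hcsd : CS T d := by
    intro n τ hτ
    simp only [hd]
    have := duhf_conj (fn_nE_cs hT hkcs) n τ hτ
    simp only at this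
    rw [this, hcs]
    have h2 : (((-n : ℤ) : ℝ)) ^ 2 = (n:ℝ) ^ 2 := by push_cast; ring
    rw [h2]
    simp only [map_add, map_mul, Complex.conj_ofReal]
  refine ⟨d, ⟨?_, hcsd, hder⟩, fun n => by simp [hd, duhf_zero]⟩
  obtain ⟨C, hC⟩ := (isCompact_Icc (a := (0:ℝ)) (b := T)).exists_bound_of_continuousOn
    (f := d 0) (fun τ hτ => (hder 0 τ hτ).continuousWithinAt)
  refine ⟨fun n => ‖k n‖ / wt n + (if n = 0 then |C| else 0), fun n => ?_, ?_, ?_⟩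
  · have := wt_pos n
    dsimp only
    split_ifs <;> positivity
  · refine ((ES.summable k).add (summable_single |C| 1)).congr (fun n => ?_)
    have := (wt_pos n).ne'
    rw [mul_add]
    congr 1
    field_simp
  · intro n τ hτ
    rcases eq_or_ne n 0 with hn | hn
    · subst hn
      have h1 := hC τ hτ
      have h2 : 0 ≤ ‖k 0‖ / wt 0 := div_nonneg (norm_nonneg _) (wt_pos 0).le
      simp only [if_true]
      linarith [le_abs_self C]
    · simp only [hn, if_false, add_zero]
      have h1 : (1:ℝ) ≤ |(n:ℝ)| := by exact_mod_cast Int.one_le_abs hn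
      have h2 := hds n τ hτ
      have h3 := fn_le hT k n τ
      rw [← h2, ds, norm_mul, norm_two_I] at h3
      rw [le_div_iff₀ (wt_pos n)]
      refine le_trans ?_ h3
      unfold wt
      nlinarith [norm_nonneg (d n τ)]

end GF

open scoped Topology ComplexConjugate

namespace GF

/-- The analytic package of a normalised solution. -/
structure Flow (T : ℝ) (ψ k k1 k2 k3 a : ℝ → ℝ → ℝ) (μ : ℝ → ℝ) : Prop where
  pos : 0 < T
  ψs : ∀ τ ∈ Icc 0 T, ∀ σ, HasDerivAt (ψ τ) (k τ σ) σ
  ks : ∀ τ ∈ Icc 0 T, ∀ σ, HasDerivAt (k τ) (k1 τ σ) σ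
  k1s : ∀ τ ∈ Icc 0 T, ∀ σ, HasDerivAt (k1 τ) (k2 τ σ) σ
  k2s : ∀ τ ∈ Icc 0 T, ∀ σ, HasDerivAt (k2 τ) (k3 τ σ) σ
  as : ∀ τ ∈ Icc 0 T, ∀ σ, HasDerivAt (a τ) (k τ σ ^ 2 + k τ σ - μ τ) σ
  ψt : ∀ τ ∈ Icc 0 T, ∀ σ, HasDerivWithinAt (fun s => ψ s σ)
    (k1 τ σ + a τ σ * (1 + k τ σ)) (Icc 0 T) τ
  kt : ∀ τ ∈ Icc 0 T, ∀ σ, HasDerivWithinAt (fun s => k s σ)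
    (k2 τ σ + a τ σ * k1 τ σ + (1 + k τ σ) * (k τ σ ^ 2 + k τ σ - μ τ)) (Icc 0 T) τ
  k1t : ∀ τ ∈ Icc 0 T, ∀ σ, HasDerivWithinAt (fun s => k1 s σ)
    (k3 τ σ + a τ σ * k2 τ σ + k1 τ σ * (2 * (k τ σ ^ 2 + k τ σ - μ τ)
      + (1 + k τ σ) * (2 * k τ σ + 1))) (Icc 0 T) τ
  cψ : ContinuousOn (fun q : ℝ × ℝ => ψ q.1 q.2) (Icc 0 T ×ˢ univ)
  ck : ContinuousOn (fun q : ℝ × ℝ => k q.1 q.2) (Icc 0 T ×ˢ univ)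
  ck1 : ContinuousOn (fun q : ℝ × ℝ => k1 q.1 q.2) (Icc 0 T ×ˢ univ)
  ck2 : ContinuousOn (fun q : ℝ × ℝ => k2 q.1 q.2) (Icc 0 T ×ˢ univ)
  ck3 : ContinuousOn (fun q : ℝ × ℝ => k3 q.1 q.2) (Icc 0 T ×ˢ univ)
  ca : ContinuousOn (fun q : ℝ × ℝ => a q.1 q.2) (Icc 0 T ×ˢ univ)
  cμ : ContinuousOn μ (Icc 0 T)
  pψ : ∀ τ σ, ψ τ (σ + π) = ψ τ σ
  pk : ∀ τ σ, k τ (σ + π) = k τ σ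
  pk1 : ∀ τ σ, k1 τ (σ + π) = k1 τ σ
  pk2 : ∀ τ σ, k2 τ (σ + π) = k2 τ σ
  pa : ∀ τ σ, a τ (σ + π) = a τ σ
  hμ : ∀ τ ∈ Icc 0 T, ∫ σ in (0:ℝ)..π, k τ σ ^ 2 = π * μ τ

def fr (f : ℤ → ℝ → ℂ) (τ σ : ℝ) : ℝ := (ev f τ σ).re
def fmu (d : ℤ → ℝ → ℂ) (τ : ℝ) : ℝ := (cnv (ds d) (ds d) 0 τ).re

/-- coefficients of the time derivative -/
def dt (d : ℤ → ℝ → ℂ) : ℤ → ℝ → ℂ := fun n τ => ds (ds d) n τ + NL d n τ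

theorem Sol.ode' {T : ℝ} {d : ℤ → ℝ → ℂ} (h : Sol T d) : ∀ n, ∀ τ ∈ Icc 0 T,
    HasDerivWithinAt (d n) (dt d n τ) (Icc 0 T) τ := by
  intro n τ hτ
  refine (h.ode n τ hτ).congr_deriv ?_
  unfold dt ds
  push_cast
  ring_nf
  simp only [Complex.I_sq]
  ring

theorem ds_hasDeriv {T : ℝ} {f f' : ℤ → ℝ → ℂ}
    (h : ∀ n, ∀ τ ∈ Icc 0 T, HasDerivWithinAt (f n) (f' n τ) (Icc 0 T) τ) :
    ∀ n, ∀ τ ∈ Icc 0 T, HasDerivWithinAt (ds f n) (ds f' n τ) (Icc 0 T) τ := by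
  intro n τ hτ
  exact (h n τ hτ).const_mul _

theorem fr_hasDerivAt {T : ℝ} {f : ℤ → ℝ → ℂ} (h : WS T 1 f) {τ : ℝ} (hτ : τ ∈ Icc 0 T)
    (σ : ℝ) : HasDerivAt (fr f τ) (fr (ds f) τ σ) σ :=
  (Complex.reCLM.hasFDerivAt.comp_hasDerivAt σ (ev_hasDerivAt h hτ σ))

theorem fr_hasDerivWithinAt {T : ℝ} (hT : 0 ≤ T) {m l : ℕ} {f f' : ℤ → ℝ → ℂ} (h : WS T m f)
    (h' : WS T l f') (hc : ∀ n, ContinuousOn (f' n) (Icc 0 T))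
    (hd : ∀ n, ∀ τ ∈ Icc 0 T, HasDerivWithinAt (f n) (f' n τ) (Icc 0 T) τ) {τ : ℝ}
    (hτ : τ ∈ Icc 0 T) (σ : ℝ) :
    HasDerivWithinAt (fun s => fr f s σ) (fr f' τ σ) (Icc 0 T) τ :=
  (Complex.reCLM.hasFDerivAt.comp_hasDerivWithinAt τ (ev_hasDerivWithinAt hT h h' hc hd hτ σ))

theorem fr_cont {T : ℝ} {j : ℕ} {f : ℤ → ℝ → ℂ} (h : SM T j f) :
    ContinuousOn (fun q : ℝ × ℝ => fr f q.1 q.2) (Icc 0 T ×ˢ univ) :=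
  Complex.continuous_re.comp_continuousOn (ev_continuousOn (h.zero.2 0) h.zero.1)

theorem fr_add {T : ℝ} {m l : ℕ} {f g : ℤ → ℝ → ℂ} (hf : WS T m f) (hg : WS T l g) {τ : ℝ}
    (hτ : τ ∈ Icc 0 T) (σ : ℝ) :
    fr (fun n τ => f n τ + g n τ) τ σ = fr f τ σ + fr g τ σ := by
  unfold fr; rw [ev_add hf hg hτ]; rfl

theorem fr_cnv {T : ℝ} {m l : ℕ} {f g : ℤ → ℝ → ℂ} (hf : WS T m f) (hg : WS T l g)
    (cf : CS T f) {τ : ℝ} (hτ : τ ∈ Icc 0 T) (σ : ℝ) :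
    fr (cnv f g) τ σ = fr f τ σ * fr g τ σ := by
  unfold fr
  rw [ev_cnv hf hg hτ, ← cf.ev_re hτ, Complex.re_ofReal_mul, Complex.ofReal_re]

theorem fr_periodic (f : ℤ → ℝ → ℂ) (τ σ : ℝ) : fr f τ (σ + π) = fr f τ σ := by
  unfold fr; rw [ev_periodic]

theorem fr_ds_As {T : ℝ} {d : ℤ → ℝ → ℂ} (h : WS T 2 d) (hcs : CS T d) {τ : ℝ}
    (hτ : τ ∈ Icc 0 T) (σ : ℝ) :
    fr (ds (As d)) τ σ = fr (ds d) τ σ ^ 2 + fr (ds d) τ σ - fmu d τ := by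
  have hK : WS T 1 (ds d) := h.ds
  have h1 : fr (Qs d) τ σ = fr (ds d) τ σ ^ 2 + fr (ds d) τ σ := by
    unfold Qs
    rw [fr_add (hK.cnv hK) hK hτ, fr_cnv hK hK hcs.ds hτ, sq]
  rw [← h1]
  have hQ : WS T 1 (Qs d) := h.Qs
  have h2 : ev (ds (As d)) τ σ = ev (Qs d) τ σ - cnv (ds d) (ds d) 0 τ := by
    unfold ev
    have hs := (ev_summable hQ hτ σ).of_norm
    rw [hs.tsum_eq_add_tsum_ite 0]
    rw [em_zero]
    have : Qs d 0 τ = cnv (ds d) (ds d) 0 τ := by simp [Qs, ds]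
    rw [this]
    ring_nf
    refine tsum_congr fun n => ?_
    split_ifs with hn
    · simp [hn, ds]
    · unfold As ds
      have : (2 * Complex.I * n : ℂ) ≠ 0 := by simp [hn]
      field_simp
  unfold fr fmu
  rw [h2, Complex.sub_re]

theorem int_sq {T : ℝ} {f : ℤ → ℝ → ℂ} (hK : WS T 1 f) (hcs : CS T f) {τ : ℝ}
    (hτ : τ ∈ Icc 0 T) : ∫ σ in (0:ℝ)..π, fr f τ σ ^ 2 = π * (cnv f f 0 τ).re := by
  have h1 := integral_ev (hK.cnv hK) hτ
  have h2 : ∀ σ, ev (cnv f f) τ σ = ((fr f τ σ ^ 2 : ℝ) : ℂ) := by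
    intro σ
    rw [← (hcs.cnv hcs).ev_re hτ]
    have := fr_cnv hK hK hcs hτ σ
    unfold fr at this ⊢
    rw [this, sq]
  simp only [h2] at h1
  rw [intervalIntegral.integral_ofReal] at h1
  have := congrArg Complex.re h1
  rw [Complex.ofReal_re, Complex.re_ofReal_mul] at this
  exact this

theorem Sol.flow {T : ℝ} (hT : 0 < T) {d : ℤ → ℝ → ℂ} (h : Sol T d)
    (hi : ∀ m : ℕ, Summable (fun n => wt n ^ m * ‖d n 0‖)) :
    Flow T (fr d) (fr (ds d)) (fr (ds (ds d))) (fr (ds (ds (ds d)))) (fr (ds (ds (ds (ds d)))))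
      (fr (As d)) (fmu d) := by
  have sm : ∀ j, SM T j d := h.sm hT.le hi
  have s0 := sm 0
  have s1 := s0.ds
  have s2 := s1.ds
  have s3 := s2.ds
  have s4 := s3.ds
  have sA := SM.As hT.le s0
  have sN := SM.NL hT.le s0
  have sD : SM T 0 (dt d) := s2.add sN
  have hDt : ∀ τ ∈ Icc 0 T, ∀ σ, fr (dt d) τ σ
      = fr (ds (ds d)) τ σ + fr (As d) τ σ * (1 + fr (ds d) τ σ) := by
    intro τ hτ σ
    unfold dt
    rw [fr_add (s2.zero.2 0) (sN.zero.2 0) hτ]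
    unfold NL
    rw [fr_add (sA.zero.2 0) ((sA.zero.2 0).cnv (s1.zero.2 0)) hτ,
      fr_cnv (sA.zero.2 0) (s1.zero.2 0) h.cs.As hτ]
    ring
  have has : ∀ τ ∈ Icc 0 T, ∀ σ, HasDerivAt (fr (As d) τ)
      (fr (ds d) τ σ ^ 2 + fr (ds d) τ σ - fmu d τ) σ := by
    intro τ hτ σ
    rw [← fr_ds_As (s0.zero.2 2) h.cs hτ]
    exact fr_hasDerivAt (sA.zero.2 1) hτ σ
  have hD1 : ∀ τ ∈ Icc 0 T, ∀ σ, fr (ds (dt d)) τ σ = fr (ds (ds (ds d))) τ σ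
      + fr (As d) τ σ * fr (ds (ds d)) τ σ
      + (1 + fr (ds d) τ σ) * (fr (ds d) τ σ ^ 2 + fr (ds d) τ σ - fmu d τ) := by
    intro τ hτ σ
    have e1 := fr_hasDerivAt (sD.zero.2 1) hτ σ
    have e2 := (fr_hasDerivAt (s2.zero.2 1) hτ σ).add
      ((has τ hτ σ).mul ((fr_hasDerivAt (s1.zero.2 1) hτ σ).const_add 1))
    have e3 : fr (dt d) τ = fr (ds (ds d)) τ + fr (As d) τ * (fun s => 1 + fr (ds d) τ s) := by
      funext s; exact hDt τ hτ s
    rw [e3] at e1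
    rw [e1.unique e2]
    ring
  have hD2 : ∀ τ ∈ Icc 0 T, ∀ σ, fr (ds (ds (dt d))) τ σ = fr (ds (ds (ds (ds d)))) τ σ
      + fr (As d) τ σ * fr (ds (ds (ds d))) τ σ
      + fr (ds (ds d)) τ σ * (2 * (fr (ds d) τ σ ^ 2 + fr (ds d) τ σ - fmu d τ)
      + (1 + fr (ds d) τ σ) * (2 * fr (ds d) τ σ + 1)) := by
    intro τ hτ σ
    have e1 := fr_hasDerivAt (sD.ds.zero.2 1) hτ σ
    have hk := fr_hasDerivAt (s1.zero.2 1) hτ σ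
    have e2 := ((fr_hasDerivAt (s3.zero.2 1) hτ σ).add
      ((has τ hτ σ).mul (fr_hasDerivAt (s2.zero.2 1) hτ σ))).add
      ((hk.const_add 1).mul (((hk.pow 2).add hk).sub_const (fmu d τ)))
    have e3 : fr (ds (dt d)) τ = fun s => fr (ds (ds (ds d))) τ s
        + fr (As d) τ s * fr (ds (ds d)) τ s
        + (1 + fr (ds d) τ s) * (fr (ds d) τ s ^ 2 + fr (ds d) τ s - fmu d τ) := by
      funext s; exact hD1 τ hτ s
    rw [e3] at e1
    rw [e1.unique e2]
    simp
    ring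
  refine ⟨hT, fun τ hτ σ => fr_hasDerivAt (s0.zero.2 1) hτ σ,
    fun τ hτ σ => fr_hasDerivAt (s1.zero.2 1) hτ σ, fun τ hτ σ => fr_hasDerivAt (s2.zero.2 1) hτ σ,
    fun τ hτ σ => fr_hasDerivAt (s3.zero.2 1) hτ σ, has, fun τ hτ σ => ?_, fun τ hτ σ => ?_,
    fun τ hτ σ => ?_, fr_cont s0, fr_cont s1, fr_cont s2, fr_cont s3, fr_cont s4, fr_cont sA, ?_,
    fr_periodic _, fr_periodic _, fr_periodic _, fr_periodic _, fr_periodic _,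
    fun τ hτ => int_sq (s1.zero.2 1) h.cs.ds hτ⟩
  · rw [← hDt τ hτ]
    exact fr_hasDerivWithinAt hT.le (s0.zero.2 0) (sD.zero.2 0) sD.zero.1 h.ode' hτ σ
  · rw [← hD1 τ hτ]
    exact fr_hasDerivWithinAt hT.le (s1.zero.2 0) (sD.ds.zero.2 0) sD.ds.zero.1
      (ds_hasDeriv h.ode') hτ σ
  · rw [← hD2 τ hτ]
    exact fr_hasDerivWithinAt hT.le (s2.zero.2 0) (sD.ds.ds.zero.2 0) sD.ds.ds.zero.1
      (ds_hasDeriv (ds_hasDeriv h.ode')) hτ σ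
  · exact Complex.continuous_re.comp_continuousOn ((SM.cnv hT.le s1 s1).zero.1 0)

end GF

open scoped Topology ComplexConjugate

namespace GF

def gx (ψ : ℝ → ℝ → ℝ) (c τ σ : ℝ) : ℝ := -(1/2) * ∫ s in σ..(σ+π), Real.cos (s + ψ τ s + c)
def gp (ψ : ℝ → ℝ → ℝ) (τ σ : ℝ) : ℝ :=
  gx ψ 0 τ σ * Real.sin (σ + ψ τ σ) - gx ψ (-(π/2)) τ σ * Real.cos (σ + ψ τ σ)
def gq (ψ : ℝ → ℝ → ℝ) (τ σ : ℝ) : ℝ :=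
  gx ψ 0 τ σ * Real.cos (σ + ψ τ σ) + gx ψ (-(π/2)) τ σ * Real.sin (σ + ψ τ σ)
def gP (ψ : ℝ → ℝ → ℝ) (τ σ : ℝ) : ℝ := (1/2) * ∫ s in (0:ℝ)..σ, gp ψ τ s
def gθ (ψ : ℝ → ℝ → ℝ) (τ σ : ℝ) : ℝ :=
  Real.arctan (gq ψ τ σ / gp ψ τ σ) + σ + ψ τ σ

section
variable {ψ : ℝ → ℝ → ℝ} {τ : ℝ}

theorem gx_s (hψ : Continuous (ψ τ)) (hp : ∀ σ, ψ τ (σ + π) = ψ τ σ) (c σ : ℝ) :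
    HasDerivAt (gx ψ c τ) (Real.cos (σ + ψ τ σ + c)) σ := by
  have hc : Continuous (fun s => Real.cos (s + ψ τ s + c)) := by fun_prop
  have h1 : ∀ y, HasDerivAt (fun y => ∫ s in (0:ℝ)..y, Real.cos (s + ψ τ s + c))
      (Real.cos (y + ψ τ y + c)) y := fun y => intervalIntegral.integral_hasDerivAt_right
        (hc.intervalIntegrable _ _) (hc.stronglyMeasurableAtFilter _ _) hc.continuousAt
  have h2 := ((h1 (σ + π)).comp_add_const σ π).sub (h1 σ)
  have h3 := h2.const_mul (-(1/2) : ℝ)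
  have h4 : gx ψ c τ = fun y => -(1/2) * ((∫ s in (0:ℝ)..(y+π), Real.cos (s + ψ τ s + c))
      - ∫ s in (0:ℝ)..y, Real.cos (s + ψ τ s + c)) := by
    funext y
    unfold gx
    rw [intervalIntegral.integral_interval_sub_left (hc.intervalIntegrable _ _)
      (hc.intervalIntegrable _ _)]
  rw [h4]
  refine h3.congr_deriv ?_
  rw [hp, show σ + π + ψ τ σ + c = (σ + ψ τ σ + c) + π by ring, Real.cos_add_pi]
  ring

theorem gx_anti (hp : ∀ σ, ψ τ (σ + π) = ψ τ σ) (c σ : ℝ) :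
    gx ψ c τ (σ + π) = - gx ψ c τ σ := by
  unfold gx
  rw [← intervalIntegral.integral_comp_add_right (fun s => Real.cos (s + ψ τ s + c)) π]
  have : ∀ s, Real.cos (s + π + ψ τ (s + π) + c) = - Real.cos (s + ψ τ s + c) := by
    intro s
    rw [hp, show s + π + ψ τ s + c = (s + ψ τ s + c) + π by ring, Real.cos_add_pi]
  simp only [this, intervalIntegral.integral_neg]
  ring

theorem gp_per (hp : ∀ σ, ψ τ (σ + π) = ψ τ σ) (σ : ℝ) : gp ψ τ (σ + π) = gp ψ τ σ := by
  unfold gp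
  rw [gx_anti hp, gx_anti hp, hp, show σ + π + ψ τ σ = (σ + ψ τ σ) + π by ring,
    Real.cos_add_pi, Real.sin_add_pi]
  ring

theorem gq_per (hp : ∀ σ, ψ τ (σ + π) = ψ τ σ) (σ : ℝ) : gq ψ τ (σ + π) = gq ψ τ σ := by
  unfold gq
  rw [gx_anti hp, gx_anti hp, hp, show σ + π + ψ τ σ = (σ + ψ τ σ) + π by ring,
    Real.cos_add_pi, Real.sin_add_pi]
  ring

theorem gx_sq (σ : ℝ) : gx ψ 0 τ σ ^ 2 + gx ψ (-(π/2)) τ σ ^ 2 = gp ψ τ σ ^ 2 + gq ψ τ σ ^ 2 := by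
  unfold gp gq
  have := Real.sin_sq_add_cos_sq (σ + ψ τ σ)
  linear_combination -(gx ψ 0 τ σ ^ 2 + gx ψ (-(π/2)) τ σ ^ 2) * this

theorem gθ_add (hp : ∀ σ, ψ τ (σ + π) = ψ τ σ) (σ : ℝ) : gθ ψ τ (σ + π) = gθ ψ τ σ + π := by
  unfold gθ
  rw [gp_per hp, gq_per hp, hp]; ring

theorem gr_le (hψ : Continuous (ψ τ)) (σ : ℝ) :
    gp ψ τ σ ^ 2 + gq ψ τ σ ^ 2 ≤ (π/2) ^ 2 := by
  rw [← gx_sq]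
  set x := gx ψ 0 τ σ with hx
  set y := gx ψ (-(π/2)) τ σ with hy
  set r := Real.sqrt (x^2+y^2) with hr
  have hr2 : r ^ 2 = x^2 + y^2 := Real.sq_sqrt (by positivity)
  have hr0 : 0 ≤ r := Real.sqrt_nonneg _
  have h1 : x^2 + y^2 = ∫ s in σ..(σ+π), -(1/2) * (x * Real.cos (s + ψ τ s) + y * Real.sin (s + ψ τ s)) := by
    rw [intervalIntegral.integral_const_mul, intervalIntegral.integral_add
      (by apply Continuous.intervalIntegrable; fun_prop)
      (by apply Continuous.intervalIntegrable; fun_prop),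
      intervalIntegral.integral_const_mul, intervalIntegral.integral_const_mul]
    have hx' : x = -(1/2) * ∫ s in σ..(σ+π), Real.cos (s + ψ τ s) := by
      rw [hx]; simp [gx]
    have hy' : y = -(1/2) * ∫ s in σ..(σ+π), Real.sin (s + ψ τ s) := by
      rw [hy]; simp only [gx]; congr 2; funext s
      rw [← sub_eq_add_neg, Real.cos_sub_pi_div_two]
    rw [sq, sq]
    linear_combination x * hx' + y * hy'
  have h2 : x^2 + y^2 ≤ ∫ s in σ..(σ+π), (1/2) * r := by
    conv_lhs => rw [h1]
    refine intervalIntegral.integral_mono_on (by linarith [Real.pi_pos])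
      (by apply Continuous.intervalIntegrable; fun_prop)
      (by apply Continuous.intervalIntegrable; fun_prop) (fun s _ => ?_)
    have : |x * Real.cos (s + ψ τ s) + y * Real.sin (s + ψ τ s)| ≤ r := by
      apply Real.abs_le_sqrt
      have := Real.sin_sq_add_cos_sq (s + ψ τ s)
      nlinarith [sq_nonneg (x * Real.sin (s + ψ τ s) - y * Real.cos (s + ψ τ s))]
    have := abs_le.1 this
    linarith [this.1]
  rw [intervalIntegral.integral_const] at h2
  simp only [add_sub_cancel_left, smul_eq_mul] at h2
  rw [← hr2] at h2 ⊢
  rcases hr0.eq_or_lt with h | h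
  · rw [← h]; nlinarith [sq_nonneg (π/2)]
  · have : r ≤ π / 2 := by
      have : r * r ≤ (π/2) * r := by linarith
      exact le_of_mul_le_mul_right this h
    gcongr

end

namespace Flow
variable {T : ℝ} {ψ k k1 k2 k3 a : ℝ → ℝ → ℝ} {μ : ℝ → ℝ}

theorem contψ (F : Flow T ψ k k1 k2 k3 a μ) {τ : ℝ} (hτ : τ ∈ Icc 0 T) : Continuous (ψ τ) :=
  continuous_iff_continuousAt.2 fun σ => (F.ψs τ hτ σ).continuousAt
theorem contk (F : Flow T ψ k k1 k2 k3 a μ) {τ : ℝ} (hτ : τ ∈ Icc 0 T) : Continuous (k τ) :=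
  continuous_iff_continuousAt.2 fun σ => (F.ks τ hτ σ).continuousAt
theorem contk1 (F : Flow T ψ k k1 k2 k3 a μ) {τ : ℝ} (hτ : τ ∈ Icc 0 T) : Continuous (k1 τ) :=
  continuous_iff_continuousAt.2 fun σ => (F.k1s τ hτ σ).continuousAt
theorem conta (F : Flow T ψ k k1 k2 k3 a μ) {τ : ℝ} (hτ : τ ∈ Icc 0 T) : Continuous (a τ) :=
  continuous_iff_continuousAt.2 fun σ => (F.as τ hτ σ).continuousAt

theorem xs (F : Flow T ψ k k1 k2 k3 a μ) (c : ℝ) : ∀ τ ∈ Icc 0 T, ∀ σ,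
    HasDerivAt (gx ψ c τ) (Real.cos (σ + ψ τ σ + c)) σ :=
  fun _ hτ σ => gx_s (F.contψ hτ) (F.pψ _) c σ

theorem xt (F : Flow T ψ k k1 k2 k3 a μ) (c : ℝ) : ∀ τ ∈ Icc 0 T, ∀ σ,
    HasDerivWithinAt (fun s => gx ψ c s σ) (-(k τ σ * Real.sin (σ + ψ τ σ + c))
      + a τ σ * Real.cos (σ + ψ τ σ + c) + μ τ * gx ψ c τ σ) (Icc 0 T) τ := by
  intro τ hτ σ
  have h1 := hasDerivWithinAt_integral F.pos.le (G := fun τ s => Real.cos (s + ψ τ s + c))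
    (G' := fun τ s => -Real.sin (s + ψ τ s + c) * (k1 τ s + a τ s * (1 + k τ s))) σ (σ + π)
    (fun τ hτ s => (((F.ψt τ hτ s).const_add s).add_const c).cos)
    (fun τ hτ => by have := F.contψ hτ; fun_prop) (by
      have := F.cψ; have := F.ck; have := F.ck1; have := F.ca
      fun_prop) τ hτ
  have h2 := h1.const_mul (-(1/2) : ℝ)
  refine h2.congr_deriv ?_
  have hψ := F.contψ hτ
  have hk := F.contk hτ
  have hk1 := F.contk1 hτ
  have ha := F.conta hτ
  set Z : ℝ → ℝ := fun s => -(k τ s * Real.sin (s + ψ τ s + c)) + a τ s * Real.cos (s + ψ τ s + c)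
    with hZ
  have hZd : ∀ s, HasDerivAt Z (-Real.sin (s + ψ τ s + c) * (k1 τ s + a τ s * (1 + k τ s))
      - μ τ * Real.cos (s + ψ τ s + c)) s := by
    intro s
    have hang : HasDerivAt (fun s => s + ψ τ s + c) (1 + k τ s) s :=
      ((hasDerivAt_id' s).add (F.ψs τ hτ s)).add_const c
    have := (((F.ks τ hτ s).mul hang.sin).neg).add ((F.as τ hτ s).mul hang.cos)
    refine this.congr_deriv ?_
    ring
  have h3 := intervalIntegral.integral_eq_sub_of_hasDerivAt (a := σ) (b := σ + π)
    (fun s _ => hZd s) (by apply Continuous.intervalIntegrable; fun_prop)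
  rw [intervalIntegral.integral_sub (by apply Continuous.intervalIntegrable; fun_prop)
    (by apply Continuous.intervalIntegrable; fun_prop), intervalIntegral.integral_const_mul] at h3
  have h4 : Z (σ + π) = - Z σ := by
    simp only [hZ]
    rw [F.pψ, F.pk, F.pa, show σ + π + ψ τ σ + c = (σ + ψ τ σ + c) + π by ring, Real.cos_add_pi,
      Real.sin_add_pi]
    ring
  rw [h4] at h3
  have h5 : gx ψ c τ σ = -(1/2) * ∫ s in σ..(σ+π), Real.cos (s + ψ τ s + c) := rfl
  have h6 : Z σ = -(k τ σ * Real.sin (σ + ψ τ σ + c)) + a τ σ * Real.cos (σ + ψ τ σ + c) := rfl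
  rw [← h6, h5]
  linear_combination -(1/2) * h3

theorem cx (F : Flow T ψ k k1 k2 k3 a μ) (c : ℝ) :
    ContinuousOn (fun q : ℝ × ℝ => gx ψ c q.1 q.2) (Icc 0 T ×ˢ univ) := fun q hq =>
  (hasFDerivWithinAt_of_partials (F.xt c) (F.xs c) (by have := F.cψ; fun_prop) q hq).continuousWithinAt

theorem cp (F : Flow T ψ k k1 k2 k3 a μ) :
    ContinuousOn (fun q : ℝ × ℝ => gp ψ q.1 q.2) (Icc 0 T ×ˢ univ) := by
  have := F.cψ; have := F.cx 0; have := F.cx (-(π/2))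
  unfold gp; fun_prop

theorem cq (F : Flow T ψ k k1 k2 k3 a μ) :
    ContinuousOn (fun q : ℝ × ℝ => gq ψ q.1 q.2) (Icc 0 T ×ˢ univ) := by
  have := F.cψ; have := F.cx 0; have := F.cx (-(π/2))
  unfold gq; fun_prop

theorem ang_s (F : Flow T ψ k k1 k2 k3 a μ) {τ : ℝ} (hτ : τ ∈ Icc 0 T) (s : ℝ) :
    HasDerivAt (fun s => s + ψ τ s) (1 + k τ s) s := (hasDerivAt_id' s).add (F.ψs τ hτ s)

theorem ps (F : Flow T ψ k k1 k2 k3 a μ) : ∀ τ ∈ Icc 0 T, ∀ σ,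
    HasDerivAt (gp ψ τ) ((1 + k τ σ) * gq ψ τ σ) σ := by
  intro τ hτ σ
  have := ((F.xs 0 τ hτ σ).mul (F.ang_s hτ σ).sin).sub
    ((F.xs (-(π/2)) τ hτ σ).mul (F.ang_s hτ σ).cos)
  refine this.congr_deriv ?_
  unfold gq
  rw [add_zero, ← sub_eq_add_neg, Real.cos_sub_pi_div_two]
  ring

theorem qs (F : Flow T ψ k k1 k2 k3 a μ) : ∀ τ ∈ Icc 0 T, ∀ σ,
    HasDerivAt (gq ψ τ) (1 - (1 + k τ σ) * gp ψ τ σ) σ := by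
  intro τ hτ σ
  have := ((F.xs 0 τ hτ σ).mul (F.ang_s hτ σ).cos).add
    ((F.xs (-(π/2)) τ hτ σ).mul (F.ang_s hτ σ).sin)
  refine this.congr_deriv ?_
  unfold gp
  rw [add_zero, ← sub_eq_add_neg, Real.cos_sub_pi_div_two]
  linear_combination Real.sin_sq_add_cos_sq (σ + ψ τ σ)

theorem pt (F : Flow T ψ k k1 k2 k3 a μ) : ∀ τ ∈ Icc 0 T, ∀ σ,
    HasDerivWithinAt (fun s => gp ψ s σ) (-k τ σ + μ τ * gp ψ τ σ
      + (k1 τ σ + a τ σ * (1 + k τ σ)) * gq ψ τ σ) (Icc 0 T) τ := by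
  intro τ hτ σ
  have hang := (F.ψt τ hτ σ).const_add σ
  have := ((F.xt 0 τ hτ σ).mul hang.sin).sub ((F.xt (-(π/2)) τ hτ σ).mul hang.cos)
  refine this.congr_deriv ?_
  unfold gp gq
  rw [add_zero, ← sub_eq_add_neg, Real.cos_sub_pi_div_two, Real.sin_sub_pi_div_two]
  linear_combination -k τ σ * Real.sin_sq_add_cos_sq (σ + ψ τ σ)

theorem qt (F : Flow T ψ k k1 k2 k3 a μ) : ∀ τ ∈ Icc 0 T, ∀ σ,
    HasDerivWithinAt (fun s => gq ψ s σ) (a τ σ + μ τ * gq ψ τ σ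
      - (k1 τ σ + a τ σ * (1 + k τ σ)) * gp ψ τ σ) (Icc 0 T) τ := by
  intro τ hτ σ
  have hang := (F.ψt τ hτ σ).const_add σ
  have := ((F.xt 0 τ hτ σ).mul hang.cos).add ((F.xt (-(π/2)) τ hτ σ).mul hang.sin)
  refine this.congr_deriv ?_
  unfold gp gq
  rw [add_zero, ← sub_eq_add_neg, Real.cos_sub_pi_div_two, Real.sin_sub_pi_div_two]
  linear_combination a τ σ * Real.sin_sq_add_cos_sq (σ + ψ τ σ)

theorem contp (F : Flow T ψ k k1 k2 k3 a μ) {τ : ℝ} (hτ : τ ∈ Icc 0 T) : Continuous (gp ψ τ) :=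
  continuous_iff_continuousAt.2 fun σ => (F.ps τ hτ σ).continuousAt
theorem contq (F : Flow T ψ k k1 k2 k3 a μ) {τ : ℝ} (hτ : τ ∈ Icc 0 T) : Continuous (gq ψ τ) :=
  continuous_iff_continuousAt.2 fun σ => (F.qs τ hτ σ).continuousAt

theorem Ps (F : Flow T ψ k k1 k2 k3 a μ) : ∀ τ ∈ Icc 0 T, ∀ σ,
    HasDerivAt (gP ψ τ) ((1/2) * gp ψ τ σ) σ := by
  intro τ hτ σ
  have hc := F.contp hτ
  exact (intervalIntegral.integral_hasDerivAt_right
        (hc.intervalIntegrable _ _) (hc.stronglyMeasurableAtFilter _ _) hc.continuousAt).const_mul _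

theorem Pt (F : Flow T ψ k k1 k2 k3 a μ) : ∀ τ ∈ Icc 0 T, ∀ σ,
    HasDerivWithinAt (fun s => gP ψ s σ) (-(ψ τ σ - ψ τ 0) + 2 * μ τ * gP ψ τ σ
      + (1/2) * ((k τ σ * gq ψ τ σ + a τ σ * gp ψ τ σ) - (k τ 0 * gq ψ τ 0 + a τ 0 * gp ψ τ 0)))
      (Icc 0 T) τ := by
  intro τ hτ σ
  have h1 := hasDerivWithinAt_integral F.pos.le (G := gp ψ) (G' := fun τ σ =>
    -k τ σ + μ τ * gp ψ τ σ + (k1 τ σ + a τ σ * (1 + k τ σ)) * gq ψ τ σ) 0 σ F.pt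
    (fun τ hτ => F.contp hτ) (by
      have := F.cp; have := F.cq; have := F.ck; have := F.ck1; have := F.ca
      have hμ : ContinuousOn (fun q : ℝ × ℝ => μ q.1) (Icc 0 T ×ˢ univ) :=
        F.cμ.comp continuousOn_fst (fun q hq => hq.1)
      exact ((F.ck.neg.add (hμ.mul F.cp)).add
        ((F.ck1.add (F.ca.mul (continuousOn_const.add F.ck))).mul F.cq))) τ hτ
  refine (h1.const_mul (1/2 : ℝ)).congr_deriv ?_
  have hp := F.contp hτ
  have hq := F.contq hτ
  have hk := F.contk hτ
  have hk1 := F.contk1 hτ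
  have ha := F.conta hτ
  have h2 : ∀ s, HasDerivAt (fun s => -ψ τ s + 2 * μ τ * gP ψ τ s
      + (1/2) * (k τ s * gq ψ τ s + a τ s * gp ψ τ s))
      ((1/2) * (-k τ s + μ τ * gp ψ τ s + (k1 τ s + a τ s * (1 + k τ s)) * gq ψ τ s)) s := by
    intro s
    have := ((F.ψs τ hτ s).neg.add ((F.Ps τ hτ s).const_mul (2 * μ τ))).add
      ((((F.ks τ hτ s).mul (F.qs τ hτ s)).add ((F.as τ hτ s).mul (F.ps τ hτ s))).const_mul (1/2 : ℝ))
    refine this.congr_deriv ?_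
    ring
  have h3 := intervalIntegral.integral_eq_sub_of_hasDerivAt (a := 0) (b := σ)
    (fun s _ => h2 s) (by apply Continuous.intervalIntegrable; fun_prop)
  rw [intervalIntegral.integral_const_mul] at h3
  rw [h3]
  have : gP ψ τ 0 = 0 := by simp [gP]
  rw [this]
  ring

theorem P_add (F : Flow T ψ k k1 k2 k3 a μ) {τ : ℝ} (hτ : τ ∈ Icc 0 T) (σ : ℝ) :
    gP ψ τ (σ + π) = gP ψ τ σ + gP ψ τ π := by
  have hc := F.contp hτ
  unfold gP
  have h1 := intervalIntegral.integral_add_adjacent_intervals (μ := volume)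
    (hc.intervalIntegrable 0 π) (hc.intervalIntegrable π (σ + π))
  have h2 := intervalIntegral.integral_comp_add_right (a := 0) (b := σ) (gp ψ τ) π
  simp only [gp_per (F.pψ τ)] at h2
  rw [zero_add] at h2
  rw [h2, ← h1]
  ring

theorem Ht (F : Flow T ψ k k1 k2 k3 a μ) : ∀ τ ∈ Icc 0 T,
    HasDerivWithinAt (fun s => gP ψ s π) (2 * μ τ * gP ψ τ π) (Icc 0 T) τ := by
  intro τ hτ
  refine (F.Pt τ hτ π).congr_deriv ?_
  have h1 := F.pψ τ 0
  have h2 := F.pk τ 0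
  have h3 := F.pa τ 0
  have h4 := gp_per (F.pψ τ) 0
  have h5 := gq_per (F.pψ τ) 0
  rw [zero_add] at h1 h2 h3 h4 h5
  rw [h1, h2, h3, h4, h5]
  ring

theorem μ_nonneg (F : Flow T ψ k k1 k2 k3 a μ) {τ : ℝ} (hτ : τ ∈ Icc 0 T) : 0 ≤ μ τ := by
  have h := F.hμ τ hτ
  have h1 : 0 ≤ ∫ σ in (0:ℝ)..π, k τ σ ^ 2 :=
    intervalIntegral.integral_nonneg Real.pi_pos.le (fun _ _ => sq_nonneg _)
  rw [h] at h1
  exact nonneg_of_mul_nonneg_right h1 Real.pi_pos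

theorem cP (F : Flow T ψ k k1 k2 k3 a μ) :
    ContinuousOn (fun q : ℝ × ℝ => gP ψ q.1 q.2) (Icc 0 T ×ˢ univ) := fun q hq =>
  (hasFDerivWithinAt_of_partials F.Pt F.Ps (by have := F.cp; fun_prop) q hq).continuousWithinAt

theorem θs (F : Flow T ψ k k1 k2 k3 a μ) {τ : ℝ} (hτ : τ ∈ Icc 0 T) (σ : ℝ)
    (hp : 0 < gp ψ τ σ) :
    HasDerivAt (gθ ψ τ) (gp ψ τ σ / (gp ψ τ σ ^ 2 + gq ψ τ σ ^ 2)) σ := by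
  have h := ((((F.qs τ hτ σ).div (F.ps τ hτ σ) hp.ne').arctan).add (hasDerivAt_id' σ)).add
    (F.ψs τ hτ σ)
  refine h.congr_deriv ?_
  have : gp ψ τ σ ^ 2 + gq ψ τ σ ^ 2 ≠ 0 := by positivity
  simp only [Pi.div_apply]
  field_simp
  ring

theorem θt (F : Flow T ψ k k1 k2 k3 a μ) {τ : ℝ} (hτ : τ ∈ Icc 0 T) (σ : ℝ)
    (hp : 0 < gp ψ τ σ) :
    HasDerivWithinAt (fun s => gθ ψ s σ) ((a τ σ * gp ψ τ σ + k τ σ * gq ψ τ σ)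
      / (gp ψ τ σ ^ 2 + gq ψ τ σ ^ 2)) (Icc 0 T) τ := by
  have h := ((((F.qt τ hτ σ).div (F.pt τ hτ σ) hp.ne').arctan).add_const σ).add (F.ψt τ hτ σ)
  refine h.congr_deriv ?_
  have : gp ψ τ σ ^ 2 + gq ψ τ σ ^ 2 ≠ 0 := by positivity
  simp only [Pi.div_apply]
  field_simp
  ring

end Flow
end GF

open scoped Topology ComplexConjugate

namespace GF

theorem per_min {f : ℝ → ℝ} {v : ℝ} (hf : ∀ σ, f (σ + π) = f σ) (h : ∀ y ∈ Icc 0 π, v ≤ f y)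
    (y : ℝ) : v ≤ f y := by
  obtain ⟨z, hz, hz2⟩ := Function.Periodic.exists_mem_Ico₀ (f := f) hf Real.pi_pos y
  rw [hz2]
  exact h z ⟨hz.1, hz.2.le⟩

theorem second_min {g g1 : ℝ → ℝ} {g2 x : ℝ} (h1 : ∀ y, HasDerivAt g (g1 y) y)
    (h2 : HasDerivAt g1 g2 x) (hmin : IsLocalMin g x) : g1 x = 0 ∧ 0 ≤ g2 := by
  have hg : deriv g = g1 := funext fun y => (h1 y).deriv
  have h0 : g1 x = 0 := hmin.hasDerivAt_eq_zero (h1 x)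
  refine ⟨h0, ?_⟩
  by_contra hlt
  push Not at hlt
  have hmax : IsLocalMax g x := by
    apply isLocalMax_of_deriv_deriv_neg
    · rw [hg, h2.deriv]; exact hlt
    · rw [hg]; exact h0
    · exact (h1 x).continuousAt
  have hconst : g =ᶠ[𝓝 x] fun _ => g x := by
    filter_upwards [hmin, hmax] with y hy1 hy2
    exact le_antisymm hy2 hy1
  have hd : deriv g =ᶠ[𝓝 x] fun _ => 0 := by
    have := hconst.deriv
    simpa using this
  rw [hg] at hd
  have h3 : HasDerivAt g1 0 x := (hasDerivAt_const x (0:ℝ)).congr_of_eventuallyEq hd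
  have := h2.unique h3
  linarith

theorem deriv_nonneg_of_right {g : ℝ → ℝ} {g1 x b : ℝ} (hb : x < b) (h : HasDerivAt g g1 x)
    (h0 : g x = 0) (hg : ∀ y ∈ Icc x b, 0 ≤ g y) : 0 ≤ g1 := by
  have h1 := h.hasDerivWithinAt (s := Ioi x)
  rw [hasDerivWithinAt_iff_tendsto_slope' (by simp)] at h1
  refine ge_of_tendsto h1 ?_
  filter_upwards [Ioo_mem_nhdsGT hb] with y hy
  rw [slope_def_field, h0, sub_zero]
  exact div_nonneg (hg y ⟨hy.1.le, hy.2.le⟩) (by linarith [hy.1])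

namespace Flow
variable {T : ℝ} {ψ k k1 k2 k3 a : ℝ → ℝ → ℝ} {μ : ℝ → ℝ}

theorem restrict (F : Flow T ψ k k1 k2 k3 a μ) {T' : ℝ} (h0 : 0 < T') (h : T' ≤ T) :
    Flow T' ψ k k1 k2 k3 a μ := by
  have hs : Icc 0 T' ⊆ Icc 0 T := Icc_subset_Icc_right h
  have hs2 : Icc 0 T' ×ˢ (univ : Set ℝ) ⊆ Icc 0 T ×ˢ univ := prod_mono hs le_rfl
  exact ⟨h0, fun τ hτ => F.ψs τ (hs hτ), fun τ hτ => F.ks τ (hs hτ), fun τ hτ => F.k1s τ (hs hτ),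
    fun τ hτ => F.k2s τ (hs hτ), fun τ hτ => F.as τ (hs hτ),
    fun τ hτ σ => (F.ψt τ (hs hτ) σ).mono hs, fun τ hτ σ => (F.kt τ (hs hτ) σ).mono hs,
    fun τ hτ σ => (F.k1t τ (hs hτ) σ).mono hs, F.cψ.mono hs2, F.ck.mono hs2, F.ck1.mono hs2,
    F.ck2.mono hs2, F.ck3.mono hs2, F.ca.mono hs2, F.cμ.mono hs, F.pψ, F.pk, F.pk1, F.pk2, F.pa,
    fun τ hτ => F.hμ τ (hs hτ)⟩

theorem cθ (F : Flow T ψ k k1 k2 k3 a μ) (hp : ∀ τ ∈ Icc 0 T, ∀ σ, 0 < gp ψ τ σ) :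
    ContinuousOn (fun q : ℝ × ℝ => gθ ψ q.1 q.2) (Icc 0 T ×ˢ univ) := by
  unfold gθ
  refine ((Real.continuous_arctan.comp_continuousOn
    (F.cq.div F.cp (fun q hq => (hp q.1 hq.1 q.2).ne'))).add continuousOn_snd).add F.cψ

theorem θ_mono (F : Flow T ψ k k1 k2 k3 a μ) {τ : ℝ} (hτ : τ ∈ Icc 0 T)
    (hp : ∀ σ, 0 < gp ψ τ σ) : StrictMono (gθ ψ τ) := by
  apply strictMono_of_deriv_pos
  intro σ
  rw [(F.θs hτ σ (hp σ)).deriv]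
  have := hp σ
  positivity

/-- area of a sector is at most `π²/8` times its angle -/
theorem P_le (F : Flow T ψ k k1 k2 k3 a μ) {τ : ℝ} (hτ : τ ∈ Icc 0 T)
    (hp : ∀ σ, 0 < gp ψ τ σ) {s1 s2 : ℝ} (h : s1 ≤ s2) :
    gP ψ τ s2 - gP ψ τ s1 ≤ (π ^ 2 / 8) * (gθ ψ τ s2 - gθ ψ τ s1) := by
  have hm : Monotone (fun s => (π ^ 2 / 8) * gθ ψ τ s - gP ψ τ s) := by
    have hd : ∀ s, HasDerivAt (fun s => (π ^ 2 / 8) * gθ ψ τ s - gP ψ τ s)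
        ((π ^ 2 / 8) * (gp ψ τ s / (gp ψ τ s ^ 2 + gq ψ τ s ^ 2)) - (1/2) * gp ψ τ s) s :=
      fun s => ((F.θs hτ s (hp s)).const_mul _).sub (F.Ps τ hτ s)
    apply monotone_of_deriv_nonneg (fun s => (hd s).differentiableAt)
    intro s
    rw [(hd s).deriv]
    have h1 := gr_le (F.contψ hτ) s
    have h2 := hp s
    have h3 : 0 < gp ψ τ s ^ 2 + gq ψ τ s ^ 2 := by positivity
    have : (π ^ 2 / 8) * (gp ψ τ s / (gp ψ τ s ^ 2 + gq ψ τ s ^ 2)) - (1/2) * gp ψ τ s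
      = (gp ψ τ s / (2 * (gp ψ τ s ^ 2 + gq ψ τ s ^ 2))) * ((π/2)^2 - (gp ψ τ s ^ 2 + gq ψ τ s ^ 2)) := by
      field_simp
      ring
    rw [this]
    apply mul_nonneg (by positivity) (by linarith)
  have := hm h
  simp only at this
  linarith

theorem le_P (F : Flow T ψ k k1 k2 k3 a μ) {τ b : ℝ} (hb : 0 < b) (hτ : τ ∈ Icc 0 T)
    (hp : ∀ σ, b ≤ gp ψ τ σ) {s1 s2 : ℝ} (h : s1 ≤ s2) :
    (b ^ 2 / 2) * (gθ ψ τ s2 - gθ ψ τ s1) ≤ gP ψ τ s2 - gP ψ τ s1 := by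
  have hm : Monotone (fun s => gP ψ τ s - (b ^ 2 / 2) * gθ ψ τ s) := by
    have hd : ∀ s, HasDerivAt (fun s => gP ψ τ s - (b ^ 2 / 2) * gθ ψ τ s)
        ((1/2) * gp ψ τ s - (b ^ 2 / 2) * (gp ψ τ s / (gp ψ τ s ^ 2 + gq ψ τ s ^ 2))) s :=
      fun s => (F.Ps τ hτ s).sub ((F.θs hτ s (hb.trans_le (hp s))).const_mul _)
    apply monotone_of_deriv_nonneg (fun s => (hd s).differentiableAt)
    intro s
    rw [(hd s).deriv]
    have h2 := hb.trans_le (hp s)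
    have h3 : 0 < gp ψ τ s ^ 2 + gq ψ τ s ^ 2 := by positivity
    have : (1/2) * gp ψ τ s - (b ^ 2 / 2) * (gp ψ τ s / (gp ψ τ s ^ 2 + gq ψ τ s ^ 2))
      = (gp ψ τ s / (2 * (gp ψ τ s ^ 2 + gq ψ τ s ^ 2))) * ((gp ψ τ s ^ 2 + gq ψ τ s ^ 2) - b ^ 2) := by
      field_simp
    rw [this]
    apply mul_nonneg (by positivity)
    nlinarith [hp s, sq_nonneg (gq ψ τ s)]
  have := hm h
  simp only at this
  linarith

theorem P_pos (F : Flow T ψ k k1 k2 k3 a μ) {τ : ℝ} (hτ : τ ∈ Icc 0 T)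
    (hp : ∀ σ, 0 < gp ψ τ σ) : StrictMono (gP ψ τ) := by
  apply strictMono_of_deriv_pos
  intro σ
  rw [(F.Ps τ hτ σ).deriv]
  have := hp σ
  positivity

theorem H_mono (F : Flow T ψ k k1 k2 k3 a μ) (hp : ∀ τ ∈ Icc 0 T, ∀ σ, 0 < gp ψ τ σ) :
    MonotoneOn (fun s => gP ψ s π) (Icc 0 T) := by
  apply monotoneOn_of_deriv_nonneg (convex_Icc 0 T)
  · exact fun τ hτ => (F.Ht τ hτ).continuousWithinAt
  · rw [interior_Icc]
    exact fun τ hτ => ((F.Ht τ (Ioo_subset_Icc_self hτ)).hasDerivAt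
      (Icc_mem_nhds hτ.1 hτ.2)).differentiableAt.differentiableWithinAt
  · rw [interior_Icc]
    intro τ hτ
    have hτ' := Ioo_subset_Icc_self hτ
    rw [((F.Ht τ hτ').hasDerivAt (Icc_mem_nhds hτ.1 hτ.2)).deriv]
    have h1 := F.P_pos hτ' (hp τ hτ') Real.pi_pos
    have h0 : gP ψ τ 0 = 0 := by simp [gP]
    rw [h0] at h1
    have := F.μ_nonneg hτ'
    positivity

end Flow
end GF

open scoped Topology ComplexConjugate

namespace GF
namespace Flow
variable {T : ℝ} {ψ k k1 k2 k3 a : ℝ → ℝ → ℝ} {μ : ℝ → ℝ}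

/-- the two-point comparison function -/
def ff (c M x : ℝ) : ℝ := c * (Real.exp (2 * M * x) - 1)

theorem ff_deriv (c M x : ℝ) : HasDerivAt (ff c M) (2 * M * c * Real.exp (2 * M * x)) x := by
  have := ((((hasDerivAt_id' x).const_mul (2 * M)).exp).sub_const 1).const_mul c
  refine this.congr_deriv ?_
  ring

theorem rs (F : Flow T ψ k k1 k2 k3 a μ) {τ : ℝ} (hτ : τ ∈ Icc 0 T) (σ : ℝ) :
    HasDerivAt (fun s => gp ψ τ s ^ 2 + gq ψ τ s ^ 2) (2 * gq ψ τ σ) σ := by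
  have := ((F.ps τ hτ σ).pow 2).add ((F.qs τ hτ σ).pow 2)
  refine this.congr_deriv ?_
  simp only [Nat.cast_ofNat, Nat.add_one_sub_one, pow_one]
  ring

theorem two_point (F : Flow T ψ k k1 k2 k3 a μ) (hp : ∀ τ ∈ Icc 0 T, ∀ σ, 0 < gp ψ τ σ)
    {b δ c M : ℝ} (hb : 0 < b) (hb0 : ∀ σ, b ≤ gp ψ 0 σ) (hδ : 0 < δ)
    (hM : 0 < M) (hMδ : 2 * Real.arctan M = π - δ) (hc : 0 < c)
    (h1 : 2 * M * c * Real.exp (2 * M * π) ≤ b ^ 2 / 2)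
    (h2 : ff c M π < gP ψ 0 π - π ^ 2 / 8 * δ) {ε : ℝ} (hε : 0 < ε) :
    ∀ τ ∈ Icc 0 T, ∀ z ∈ Icc (0:ℝ) π ×ˢ Icc (0:ℝ) π,
      0 < (gP ψ τ (z.1 + z.2) - gP ψ τ z.1) - ff c M (gθ ψ τ (z.1 + z.2) - gθ ψ τ z.1) + ε := by
  have hffm : ∀ x y, x ≤ y → ff c M x ≤ ff c M y := by
    intro x y hxy
    unfold ff
    gcongr
  have h0mem : (0:ℝ) ∈ Icc 0 T := ⟨le_rfl, F.pos.le⟩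
  set U : ℝ → ℝ → ℝ → ℝ := fun τ s1 s2 =>
    (gP ψ τ s2 - gP ψ τ s1) - ff c M (gθ ψ τ s2 - gθ ψ τ s1) + ε with hU
  have hff_le : ∀ x ∈ Icc 0 π, ff c M x ≤ 2 * M * c * Real.exp (2 * M * π) * x := by
    intro x hx
    have hm : Monotone (fun y => 2 * M * c * Real.exp (2 * M * π) * min y π - ff c M (min y π)) := by
      have hanti : MonotoneOn (fun y => 2 * M * c * Real.exp (2 * M * π) * y - ff c M y) (Iic π) := by
        have hd : ∀ y, HasDerivAt (fun y => 2 * M * c * Real.exp (2 * M * π) * y - ff c M y)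
            (2 * M * c * Real.exp (2 * M * π) * 1 - 2 * M * c * Real.exp (2 * M * y)) y :=
          fun y => ((hasDerivAt_id' y).const_mul _).sub (ff_deriv c M y)
        apply monotoneOn_of_deriv_nonneg (convex_Iic π)
          (fun y _ => (hd y).continuousAt.continuousWithinAt)
          (fun y _ => (hd y).differentiableAt.differentiableWithinAt)
        intro y hy
        rw [interior_Iic] at hy
        rw [(hd y).deriv, mul_one, sub_nonneg]
        have : y ≤ π := le_of_lt hy
        gcongr
      intro y z hyz
      exact hanti (mem_Iic.2 (min_le_right _ _)) (mem_Iic.2 (min_le_right _ _)) (min_le_min_right _ hyz)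
    have := hm hx.1
    simp only [min_eq_left hx.2, min_eq_left Real.pi_pos.le] at this
    have h3 : ff c M 0 = 0 := by simp [ff]
    rw [h3] at this
    linarith
  apply max_principle (isCompact_Icc.prod isCompact_Icc) (fun τ (z : ℝ × ℝ) => U τ z.1 (z.1 + z.2))
  · have e1 : ContinuousOn (fun q : ℝ × ℝ × ℝ => gP ψ q.1 (q.2.1 + q.2.2))
        (Icc 0 T ×ˢ (Icc 0 π ×ˢ Icc 0 π)) :=
      F.cP.comp (f := fun q : ℝ × ℝ × ℝ => (q.1, q.2.1 + q.2.2)) (by fun_prop)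
        (fun q hq => ⟨hq.1, mem_univ _⟩)
    have e2 : ContinuousOn (fun q : ℝ × ℝ × ℝ => gP ψ q.1 q.2.1)
        (Icc 0 T ×ˢ (Icc 0 π ×ˢ Icc 0 π)) :=
      F.cP.comp (f := fun q : ℝ × ℝ × ℝ => (q.1, q.2.1)) (by fun_prop)
        (fun q hq => ⟨hq.1, mem_univ _⟩)
    have e3 : ContinuousOn (fun q : ℝ × ℝ × ℝ => gθ ψ q.1 (q.2.1 + q.2.2))
        (Icc 0 T ×ˢ (Icc 0 π ×ˢ Icc 0 π)) :=
      (F.cθ hp).comp (f := fun q : ℝ × ℝ × ℝ => (q.1, q.2.1 + q.2.2)) (by fun_prop)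
        (fun q hq => ⟨hq.1, mem_univ _⟩)
    have e4 : ContinuousOn (fun q : ℝ × ℝ × ℝ => gθ ψ q.1 q.2.1)
        (Icc 0 T ×ˢ (Icc 0 π ×ˢ Icc 0 π)) :=
      (F.cθ hp).comp (f := fun q : ℝ × ℝ × ℝ => (q.1, q.2.1)) (by fun_prop)
        (fun q hq => ⟨hq.1, mem_univ _⟩)
    have hffc : Continuous (ff c M) := by unfold ff; fun_prop
    exact ((e1.sub e2).sub (hffc.comp_continuousOn (e3.sub e4))).add continuousOn_const
  · rintro ⟨s, h⟩ ⟨hs, hh⟩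
    simp only at hs hh ⊢
    have hle : s ≤ s + h := by linarith [hh.1]
    have e1 := F.le_P hb h0mem hb0 hle
    have hmono := F.θ_mono h0mem (fun σ => hb.trans_le (hb0 σ))
    have e2 := hmono.monotone hle
    have e3 := hmono.monotone (show s + h ≤ s + π by linarith [hh.2])
    rw [gθ_add (F.pψ 0)] at e3
    have e4 := hff_le (gθ ψ 0 (s + h) - gθ ψ 0 s) ⟨by linarith, by linarith⟩
    have e5 := mul_le_mul_of_nonneg_right h1 (sub_nonneg.2 e2)
    simp only [hU]
    linarith
  · rintro τ hτ ⟨s1, h⟩ ⟨hs, hh⟩ hzero hmin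
    simp only at hs hh hzero
    have hτ' : τ ∈ Icc 0 T := ⟨hτ.1.le, hτ.2⟩
    have hpτ := hp τ hτ'
    set s2 := s1 + h with hs2
    -- nonnegativity on all admissible pairs
    have hnn : ∀ x y, x ≤ y → y ≤ x + π → 0 ≤ U τ x y := by
      intro x y hxy hyx
      have := per_min (f := fun x' => U τ x' (x' + (y - x))) (v := 0) (fun σ => by
        simp only [hU]
        rw [show σ + π + (y - x) = σ + (y - x) + π by ring, F.P_add hτ', F.P_add hτ',
          gθ_add (F.pψ τ), gθ_add (F.pψ τ)]
        ring_nf) (fun x' hx' => by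
          exact hmin τ ⟨hτ'.1, le_rfl⟩ (x', y - x) ⟨hx', by linarith, by linarith⟩) x
      simpa using this
    have hθm := F.θ_mono hτ' hpτ
    have hPm := F.P_pos hτ' hpτ
    set Θ := gθ ψ τ s2 - gθ ψ τ s1 with hΘ
    have hΘπ : Θ ≤ π := by
      have := hθm.monotone (show s2 ≤ s1 + π by linarith [hh.2])
      rw [gθ_add (F.pψ τ)] at this
      linarith
    have hΘδ : Θ < π - δ := by
      by_contra hcon
      push Not at hcon
      have e1 := F.P_le hτ' hpτ (show s2 ≤ s1 + π by linarith [hh.2])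
      rw [gθ_add (F.pψ τ), F.P_add hτ'] at e1
      have e2 := F.H_mono hp h0mem hτ' hτ'.1
      simp only at e2
      have e3 := hffm Θ π hΘπ
      have e4 : (π ^ 2 / 8) * (π - Θ) ≤ π ^ 2 / 8 * δ := by
        apply mul_le_mul_of_nonneg_left _ (by positivity)
        linarith
      have e5 : gθ ψ τ s1 + π - gθ ψ τ s2 = π - Θ := by rw [hΘ]; ring
      rw [e5] at e1
      simp only [hU] at hzero
      linarith
    have hlt1 : s1 < s2 := by
      rcases hh.1.eq_or_lt with h' | h'
      · exfalso
        simp only [hU] at hzero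
        rw [hs2, ← h', add_zero, sub_self, sub_self] at hzero
        simp [ff] at hzero
        linarith
      · linarith
    have hlt2 : s2 < s1 + π := by
      rcases hh.2.eq_or_lt with h' | h'
      · exfalso
        have : Θ = π := by rw [hΘ, hs2, h', gθ_add (F.pψ τ)]; ring
        linarith
      · linarith
    set fp := 2 * M * c * Real.exp (2 * M * Θ) with hfp
    have hfp0 : 0 < fp := by positivity
    have hfpd : ∀ x, HasDerivAt (fun x => 2 * M * c * Real.exp (2 * M * x))
        (2 * M * (2 * M * c * Real.exp (2 * M * x))) x := by
      intro x
      have := (((hasDerivAt_id' x).const_mul (2 * M)).exp).const_mul (2 * M * c)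
      refine this.congr_deriv ?_
      ring
    -- right end point
    have R2 : gp ψ τ s2 ^ 2 + gq ψ τ s2 ^ 2 = 2 * fp ∧ M ≤ gq ψ τ s2 / gp ψ τ s2 := by
      have hd1 : ∀ y, HasDerivAt (fun y => U τ s1 y) ((1/2) * gp ψ τ y
          - 2 * M * c * Real.exp (2 * M * (gθ ψ τ y - gθ ψ τ s1))
            * (gp ψ τ y / (gp ψ τ y ^ 2 + gq ψ τ y ^ 2))) y := by
        intro y
        exact (((F.Ps τ hτ' y).sub_const _).sub
          ((ff_deriv c M _).comp y ((F.θs hτ' y (hpτ y)).sub_const _))).add_const ε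
      have hr0 : gp ψ τ s2 ^ 2 + gq ψ τ s2 ^ 2 ≠ 0 := by have := hpτ s2; positivity
      have hd2 := ((F.ps τ hτ' s2).const_mul (1/2 : ℝ)).sub
        (((hfpd _).comp s2 ((F.θs hτ' s2 (hpτ s2)).sub_const (gθ ψ τ s1))).mul
          ((F.ps τ hτ' s2).div (F.rs hτ' s2) hr0))
      have hloc : IsLocalMin (fun y => U τ s1 y) s2 := by
        filter_upwards [Ioo_mem_nhds hlt1 hlt2] with y hy
        rw [hzero]
        exact hnn s1 y hy.1.le hy.2.le
      obtain ⟨f1, f2⟩ := second_min hd1 hd2 hloc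
      simp only [Function.comp_apply, Pi.neg_apply, Pi.div_apply] at f1 f2
      rw [← hΘ, ← hfp] at f1 f2
      have hp2 := hpτ s2
      set p2 := gp ψ τ s2
      set q2 := gq ψ τ s2
      have hr : p2 ^ 2 + q2 ^ 2 = 2 * fp := by
        field_simp at f1
        have : p2 * (p2 ^ 2 + q2 ^ 2 - 2 * fp) = 0 := by linarith
        rcases mul_eq_zero.1 this with h' | h'
        · exact absurd h' hp2.ne'
        · linarith
      refine ⟨hr, ?_⟩
      rw [hr] at f2
      rw [le_div_iff₀ hp2]
      have key : 1 / 2 * ((1 + k τ s2) * q2) - (2 * M * fp * (p2 / (2 * fp)) * (p2 / (2 * fp)) +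
        fp * (((1 + k τ s2) * q2 * (2 * fp) - p2 * (2 * q2)) / (2 * fp) ^ 2))
        = (p2 / (2 * fp)) * (q2 - M * p2) := by
        field_simp
        ring
      rw [key] at f2
      have := nonneg_of_mul_nonneg_right f2 (by positivity : 0 < p2 / (2 * fp))
      linarith
    -- left end point
    have R1 : gp ψ τ s1 ^ 2 + gq ψ τ s1 ^ 2 = 2 * fp ∧ M ≤ -(gq ψ τ s1 / gp ψ τ s1) := by
      have hd1 : ∀ y, HasDerivAt (fun y => U τ y s2) (-((1/2) * gp ψ τ y)
          - 2 * M * c * Real.exp (2 * M * (gθ ψ τ s2 - gθ ψ τ y))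
            * (-(gp ψ τ y / (gp ψ τ y ^ 2 + gq ψ τ y ^ 2)))) y := by
        intro y
        exact (((F.Ps τ hτ' y).const_sub _).sub
          ((ff_deriv c M _).comp y ((F.θs hτ' y (hpτ y)).const_sub _))).add_const ε
      have hr0 : gp ψ τ s1 ^ 2 + gq ψ τ s1 ^ 2 ≠ 0 := by have := hpτ s1; positivity
      have hd2 := ((F.ps τ hτ' s1).const_mul (1/2 : ℝ)).neg.sub
        (((hfpd _).comp s1 ((F.θs hτ' s1 (hpτ s1)).const_sub (gθ ψ τ s2))).mul
          ((F.ps τ hτ' s1).div (F.rs hτ' s1) hr0).neg)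
      have hloc : IsLocalMin (fun y => U τ y s2) s1 := by
        filter_upwards [Ioo_mem_nhds (show s2 - π < s1 by linarith) hlt1] with y hy
        rw [hzero]
        exact hnn y s2 hy.2.le (by linarith [hy.1])
      obtain ⟨f1, f2⟩ := second_min hd1 hd2 hloc
      simp only [Function.comp_apply, Pi.neg_apply, Pi.div_apply] at f1 f2
      rw [← hΘ, ← hfp] at f1 f2
      have hp2 := hpτ s1
      set p2 := gp ψ τ s1
      set q2 := gq ψ τ s1
      have hr : p2 ^ 2 + q2 ^ 2 = 2 * fp := by
        field_simp at f1
        have : p2 * (p2 ^ 2 + q2 ^ 2 - 2 * fp) = 0 := by linarith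
        rcases mul_eq_zero.1 this with h' | h'
        · exact absurd h' hp2.ne'
        · linarith
      refine ⟨hr, ?_⟩
      rw [hr] at f2
      rw [← neg_div, le_div_iff₀ hp2]
      have key : -(1 / 2 * ((1 + k τ s1) * q2)) - (2 * M * fp * (-(p2 / (2 * fp))) * (-(p2 / (2 * fp))) +
        fp * (-(((1 + k τ s1) * q2 * (2 * fp) - p2 * (2 * q2)) / (2 * fp) ^ 2)))
        = (p2 / (2 * fp)) * (-q2 - M * p2) := by
        field_simp
        ring
      rw [key] at f2
      have := nonneg_of_mul_nonneg_right f2 (by positivity : 0 < p2 / (2 * fp))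
      linarith
    -- time derivative
    have hdt := (((F.Pt τ hτ' s2).sub (F.Pt τ hτ' s1)).sub
      ((ff_deriv c M _).comp_hasDerivWithinAt τ ((F.θt hτ' s2 (hpτ s2)).sub
        (F.θt hτ' s1 (hpτ s1))))).add_const ε
    refine ⟨_, ?_, hdt⟩
    simp only [Pi.sub_apply]
    rw [← hΘ, ← hfp, R1.1, R2.1]
    have key : ∀ A B : ℝ, fp * (A / (2 * fp) - B / (2 * fp)) = (1/2) * (A - B) := by
      intro A B
      field_simp
    rw [key]
    have hS : 0 ≤ gP ψ τ s2 - gP ψ τ s1 := sub_nonneg.2 (hPm.monotone hlt1.le)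
    have hμS := mul_nonneg (F.μ_nonneg hτ') hS
    have hA2 := Real.arctan_mono R2.2
    have hA1 := Real.arctan_mono R1.2
    rw [Real.arctan_neg] at hA1
    have hΘe : Θ = Real.arctan (gq ψ τ s2 / gp ψ τ s2) - Real.arctan (gq ψ τ s1 / gp ψ τ s1)
        + (s2 - s1) + (ψ τ s2 - ψ τ s1) := by
      rw [hΘ]; unfold gθ; ring
    linarith

end Flow
end GF

open scoped Topology ComplexConjugate

namespace GF
namespace Flow

theorem r_lower {T : ℝ} {ψ k k1 k2 k3 a : ℝ → ℝ → ℝ} {μ : ℝ → ℝ}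
    (F : Flow T ψ k k1 k2 k3 a μ) (hp : ∀ τ ∈ Icc 0 T, ∀ σ, 0 < gp ψ τ σ)
    {b δ c M : ℝ} (hb : 0 < b) (hb0 : ∀ σ, b ≤ gp ψ 0 σ) (hδ : 0 < δ)
    (hM : 0 < M) (hMδ : 2 * Real.arctan M = π - δ) (hc : 0 < c)
    (h1 : 2 * M * c * Real.exp (2 * M * π) ≤ b ^ 2 / 2)
    (h2 : ff c M π < gP ψ 0 π - π ^ 2 / 8 * δ) :
    ∀ τ ∈ Icc 0 T, ∀ σ, 4 * M * c ≤ gp ψ τ σ ^ 2 + gq ψ τ σ ^ 2 := by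
  intro τ hτ
  apply per_min (fun σ => by rw [gp_per (F.pψ τ), gq_per (F.pψ τ)])
  intro σ hσ
  have hpσ := hp τ hτ σ
  have hd : HasDerivAt (fun s => (gP ψ τ s - gP ψ τ σ) - 2 * M * c * (gθ ψ τ s - gθ ψ τ σ))
      ((1/2) * gp ψ τ σ - 2 * M * c * (gp ψ τ σ / (gp ψ τ σ ^ 2 + gq ψ τ σ ^ 2))) σ :=
    ((F.Ps τ hτ σ).sub_const _).sub (((F.θs hτ σ hpσ).sub_const _).const_mul _)
  have hnn := deriv_nonneg_of_right (show σ < σ + π by linarith [Real.pi_pos]) hd (by simp) (by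
    intro y hy
    have e1 : ff c M (gθ ψ τ y - gθ ψ τ σ) ≤ gP ψ τ y - gP ψ τ σ := by
      apply le_of_forall_pos_le_add
      intro ε hε
      have := F.two_point hp hb hb0 hδ hM hMδ hc h1 h2 hε τ hτ (σ, y - σ)
        ⟨hσ, by linarith [hy.1], by linarith [hy.2]⟩
      simp only [add_sub_cancel] at this
      linarith
    have e2 : 2 * M * c * (gθ ψ τ y - gθ ψ τ σ) ≤ ff c M (gθ ψ τ y - gθ ψ τ σ) := by
      unfold ff
      have := mul_le_mul_of_nonneg_left (Real.add_one_le_exp (2 * M * (gθ ψ τ y - gθ ψ τ σ))) hc.le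
      linarith
    linarith)
  have hr : 0 < gp ψ τ σ ^ 2 + gq ψ τ σ ^ 2 := by positivity
  have : (1/2) * gp ψ τ σ - 2 * M * c * (gp ψ τ σ / (gp ψ τ σ ^ 2 + gq ψ τ σ ^ 2))
    = (gp ψ τ σ / (2 * (gp ψ τ σ ^ 2 + gq ψ τ σ ^ 2))) * ((gp ψ τ σ ^ 2 + gq ψ τ σ ^ 2) - 4 * M * c) := by
    field_simp
    ring
  rw [this] at hnn
  have := nonneg_of_mul_nonneg_right hnn (by positivity)
  linarith

theorem exists_m {b : ℝ} (hb : 0 < b) : ∃ m > 0, m ≤ 1 ∧ ∀ {T : ℝ} {ψ k k1 k2 k3 a : ℝ → ℝ → ℝ}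
    {μ : ℝ → ℝ}, Flow T ψ k k1 k2 k3 a μ → (∀ σ, b ≤ gp ψ 0 σ) →
    ∀ τ ∈ Icc 0 T, ∀ σ, m < gp ψ τ σ := by
  have hπ := Real.pi_pos
  set δ := min (π/2) (2 * b / π) with hδd
  have hδ : 0 < δ := by positivity
  have hδ1 : δ ≤ π / 2 := min_le_left _ _
  have hδ2 : δ ≤ 2 * b / π := min_le_right _ _
  set M := Real.tan ((π - δ)/2) with hMd
  have hM : 0 < M := Real.tan_pos_of_pos_of_lt_pi_div_two (by linarith) (by linarith)
  have hMδ : 2 * Real.arctan M = π - δ := by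
    rw [hMd, Real.arctan_tan (by linarith) (by linarith)]; ring
  set E := Real.exp (2 * M * π) with hE
  have hE0 : 0 < E := Real.exp_pos _
  set c := min (b ^ 2 / (4 * M * E)) (π * b / 8 / E) with hcd
  have hc : 0 < c := by positivity
  have hc1 : c * (4 * M * E) ≤ b ^ 2 := by
    rw [← le_div_iff₀ (by positivity)]; exact min_le_left _ _
  have hc2 : c * E ≤ π * b / 8 := by
    rw [← le_div_iff₀ (by positivity)]; exact min_le_right _ _
  have h4 : 0 < Real.sqrt (4 * M * c) := Real.sqrt_pos.2 (by positivity)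
  set m := min (min (b/2) 1) (Real.sqrt (4 * M * c) / 2) with hmd
  have hm : 0 < m := by positivity
  have hm1 : m ≤ 1 := (min_le_left _ _).trans (min_le_right _ _)
  have hmb : m < b := lt_of_le_of_lt ((min_le_left _ _).trans (min_le_left _ _)) (by linarith)
  have hm4 : m ^ 2 < 4 * M * c := by
    have : m < Real.sqrt (4 * M * c) := lt_of_le_of_lt (min_le_right _ _) (by linarith)
    exact (Real.lt_sqrt hm.le).1 this
  refine ⟨m, hm, hm1, ?_⟩
  intro T ψ k k1 k2 k3 a μ F hb0
  have h0mem : (0:ℝ) ∈ Icc 0 T := ⟨le_rfl, F.pos.le⟩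
  have hH0 : π * b / 2 ≤ gP ψ 0 π := by
    have e1 : ∫ s in (0:ℝ)..π, b ≤ ∫ s in (0:ℝ)..π, gp ψ 0 s :=
      intervalIntegral.integral_mono_on hπ.le (by simp) ((F.contp h0mem).intervalIntegrable _ _)
        (fun s _ => hb0 s)
    rw [intervalIntegral.integral_const, smul_eq_mul, sub_zero] at e1
    unfold gP
    linarith
  have h1 : 2 * M * c * Real.exp (2 * M * π) ≤ b ^ 2 / 2 := by
    rw [← hE]; linarith
  have h2 : ff c M π < gP ψ 0 π - π ^ 2 / 8 * δ := by
    unfold ff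
    rw [← hE]
    have : π ^ 2 / 8 * δ ≤ π * b / 4 := by
      calc π ^ 2 / 8 * δ ≤ π ^ 2 / 8 * (2 * b / π) := by gcongr
        _ = π * b / 4 := by field_simp; ring
    have : 0 < π * b := by positivity
    linarith
  have key : ∀ τ ∈ Icc 0 T, ∀ z ∈ Icc 0 π, 0 < gp ψ τ z - m := by
    apply max_principle isCompact_Icc (fun τ σ => gp ψ τ σ - m)
    · exact (F.cp.sub continuousOn_const).mono (prod_mono le_rfl (subset_univ _))
    · intro z _
      have := hb0 z
      linarith
    · intro τ hτ σ hσ hzero hmin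
      have hτ' : τ ∈ Icc 0 T := ⟨hτ.1.le, hτ.2⟩
      have F' := F.restrict hτ.1 hτ.2
      have hge : ∀ s ∈ Icc 0 τ, ∀ y, m ≤ gp ψ s y := by
        intro s hs
        apply per_min (gp_per (F.pψ s))
        intro y hy
        have := hmin s hs y hy
        linarith
      have hr := F'.r_lower (fun s hs y => hm.trans_le (hge s hs y)) hb hb0 hδ hM hMδ hc h1 h2 τ
        ⟨hτ.1.le, le_rfl⟩ σ
      have hloc : IsLocalMin (gp ψ τ) σ := by
        refine Filter.Eventually.of_forall fun y => ?_
        have := hge τ ⟨hτ.1.le, le_rfl⟩ y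
        linarith
      obtain ⟨f1, f2⟩ := second_min (F.ps τ hτ')
        (((F.ks τ hτ' σ).const_add 1).mul (F.qs τ hτ' σ)) hloc
      refine ⟨_, ?_, (F.pt τ hτ' σ).sub_const m⟩
      have hpm : gp ψ τ σ = m := by linarith
      rcases mul_eq_zero.1 f1 with hκ | hq
      · rw [hκ, zero_mul, add_zero] at f2
        have hk : k τ σ = -1 := by linarith
        have := mul_nonneg (F.μ_nonneg hτ') hm.le
        rw [hκ, hk, hpm]
        linarith
      · exfalso
        rw [hq, hpm] at hr
        linarith
  intro τ hτ σ
  obtain ⟨z, hz, hz2⟩ := Function.Periodic.exists_mem_Ico₀ (f := gp ψ τ) (gp_per (F.pψ τ))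
    Real.pi_pos σ
  rw [hz2]
  have := key τ hτ z ⟨hz.1, hz.2.le⟩
  linarith

theorem pos_per {f : ℝ → ℝ} (hf : ∀ σ, f (σ + π) = f σ) (h : ∀ y ∈ Icc 0 π, 0 < f y)
    (y : ℝ) : 0 < f y := by
  obtain ⟨z, hz, hz2⟩ := Function.Periodic.exists_mem_Ico₀ (f := f) hf Real.pi_pos y
  rw [hz2]
  exact h z ⟨hz.1, hz.2.le⟩

/-- bound for the curvature -/
theorem kap_bound {T : ℝ} {ψ k k1 k2 k3 a : ℝ → ℝ → ℝ} {μ : ℝ → ℝ}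
    (F : Flow T ψ k k1 k2 k3 a μ) {c K : ℝ} (hc : 0 < c) (hc1 : c ≤ 1 / 2)
    (hp : ∀ τ ∈ Icc 0 T, ∀ σ, 2 * c < gp ψ τ σ) (hK : 2 < K * c ^ 2)
    (h0 : ∀ σ, |1 + k 0 σ| < K * c) :
    ∀ τ ∈ Icc 0 T, ∀ σ, |1 + k τ σ| ≤ K * (π / 2) := by
  have hK0 : 0 < K := by
    by_contra h
    push Not at h
    have : K * c ^ 2 ≤ 0 := mul_nonpos_of_nonpos_of_nonneg h (sq_nonneg c)
    linarith
  have hKc : 2 ≤ K * c := by nlinarith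
  have h0mem : (0:ℝ) ∈ Icc 0 T := ⟨le_rfl, F.pos.le⟩
  have up : ∀ τ ∈ Icc 0 T, ∀ z ∈ Icc 0 π, 0 < K * (gp ψ τ z - c) - (1 + k τ z) := by
    apply max_principle isCompact_Icc (fun τ z => K * (gp ψ τ z - c) - (1 + k τ z))
    · exact ((continuousOn_const.mul (F.cp.sub continuousOn_const)).sub
        (continuousOn_const.add F.ck)).mono (prod_mono le_rfl (subset_univ _))
    · intro z _
      have e1 := hp 0 h0mem z
      have e2 := (abs_lt.1 (h0 z)).2
      have : K * c < K * (gp ψ 0 z - c) := by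
        apply mul_lt_mul_of_pos_left _ hK0
        linarith
      linarith
    · intro τ hτ σ hσ hzero hmin
      have hτ' : τ ∈ Icc 0 T := ⟨hτ.1.le, hτ.2⟩
      have hloc : IsLocalMin (fun z => K * (gp ψ τ z - c) - (1 + k τ z)) σ := by
        refine Filter.Eventually.of_forall fun y => ?_
        beta_reduce; rw [hzero]
        exact per_min (fun σ => by rw [gp_per (F.pψ τ), F.pk]) (fun y hy =>
          hmin τ ⟨hτ.1.le, le_rfl⟩ y hy) y
      have hd1 : ∀ z, HasDerivAt (fun z => K * (gp ψ τ z - c) - (1 + k τ z))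
          (K * ((1 + k τ z) * gq ψ τ z) - k1 τ z) z := fun z =>
        (((F.ps τ hτ' z).sub_const c).const_mul K).sub ((F.ks τ hτ' z).const_add 1)
      obtain ⟨f1, f2⟩ := second_min hd1 ((((((F.ks τ hτ' σ).const_add 1).mul
        (F.qs τ hτ' σ)).const_mul K)).sub (F.k1s τ hτ' σ)) hloc
      refine ⟨_, ?_, (((F.pt τ hτ' σ).sub_const c).const_mul K).sub ((F.kt τ hτ' σ).const_add 1)⟩
      have hμ := F.μ_nonneg hτ'
      have hpσ := hp τ hτ' σ
      set p := gp ψ τ σ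
      set q := gq ψ τ σ
      set κ := 1 + k τ σ with hκ
      have hk : k τ σ = κ - 1 := by rw [hκ]; ring
      rw [hk]
      have hκe : κ = K * (p - c) := by linarith
      have hκ1 : K * c ≤ κ := by rw [hκe]; gcongr; linarith
      have hκ0 : 0 < κ := by linarith
      have e1 : 0 ≤ μ τ * (K * p + κ) := mul_nonneg hμ (by have : 0 < p := by linarith
                                                           positivity)
      have e2 : 0 < K * κ * (c * κ - 2) := by
        apply mul_pos (mul_pos hK0 hκ0)
        nlinarith
      have e3 : k1 τ σ = K * (κ * q) := by linarith
      have e4 : κ ^ 2 * (K * p - κ) = κ ^ 2 * (K * c) := by rw [hκe]; ring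
      have e5 : 0 ≤ κ ^ 2 := sq_nonneg _
      have e6 : a τ σ * k1 τ σ = a τ σ * (K * (κ * q)) := by rw [e3]
      nlinarith
  have dn : ∀ τ ∈ Icc 0 T, ∀ z ∈ Icc 0 π, 0 < K * (gp ψ τ z - c) + (1 + k τ z) := by
    apply max_principle isCompact_Icc (fun τ z => K * (gp ψ τ z - c) + (1 + k τ z))
    · exact ((continuousOn_const.mul (F.cp.sub continuousOn_const)).add
        (continuousOn_const.add F.ck)).mono (prod_mono le_rfl (subset_univ _))
    · intro z _
      have e1 := hp 0 h0mem z
      have e2 := (abs_lt.1 (h0 z)).1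
      have : K * c < K * (gp ψ 0 z - c) := by
        apply mul_lt_mul_of_pos_left _ hK0
        linarith
      linarith
    · intro τ hτ σ hσ hzero hmin
      have hτ' : τ ∈ Icc 0 T := ⟨hτ.1.le, hτ.2⟩
      have hloc : IsLocalMin (fun z => K * (gp ψ τ z - c) + (1 + k τ z)) σ := by
        refine Filter.Eventually.of_forall fun y => ?_
        beta_reduce; rw [hzero]
        exact per_min (fun σ => by rw [gp_per (F.pψ τ), F.pk]) (fun y hy =>
          hmin τ ⟨hτ.1.le, le_rfl⟩ y hy) y
      have hd1 : ∀ z, HasDerivAt (fun z => K * (gp ψ τ z - c) + (1 + k τ z))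
          (K * ((1 + k τ z) * gq ψ τ z) + k1 τ z) z := fun z =>
        (((F.ps τ hτ' z).sub_const c).const_mul K).add ((F.ks τ hτ' z).const_add 1)
      obtain ⟨f1, f2⟩ := second_min hd1 ((((((F.ks τ hτ' σ).const_add 1).mul
        (F.qs τ hτ' σ)).const_mul K)).add (F.k1s τ hτ' σ)) hloc
      refine ⟨_, ?_, (((F.pt τ hτ' σ).sub_const c).const_mul K).add ((F.kt τ hτ' σ).const_add 1)⟩
      have hμ := F.μ_nonneg hτ'
      have hpσ := hp τ hτ' σ
      set p := gp ψ τ σ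
      set q := gq ψ τ σ
      set κ := 1 + k τ σ with hκ
      have hk : k τ σ = κ - 1 := by rw [hκ]; ring
      rw [hk]
      have hκe : κ = - (K * (p - c)) := by linarith
      have hκ1 : κ ≤ - (K * c) := by rw [hκe]; gcongr; linarith
      have hκ0 : κ < 0 := by linarith
      have e1 : 0 ≤ μ τ * (K * p - κ) := mul_nonneg hμ (by
        have : 0 < p := by linarith
        have : 0 < K * p := by positivity
        linarith)
      have e3 : k1 τ σ = - (K * (κ * q)) := by linarith
      have e4 : κ ^ 2 * (K * p + κ) = κ ^ 2 * (K * c) := by rw [hκe]; ring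
      have e5 : 0 ≤ κ ^ 2 * (K * c - 1) := mul_nonneg (sq_nonneg _) (by linarith)
      have e6 : a τ σ * k1 τ σ = a τ σ * (-(K * (κ * q))) := by rw [e3]
      have e7 : 0 < K * (-κ) := mul_pos hK0 (by linarith)
      nlinarith
  intro τ hτ σ
  have hup := pos_per (f := fun z => K * (gp ψ τ z - c) - (1 + k τ z))
    (fun σ => by rw [gp_per (F.pψ τ), F.pk]) (up τ hτ) σ
  have hdn := pos_per (f := fun z => K * (gp ψ τ z - c) + (1 + k τ z))
    (fun σ => by rw [gp_per (F.pψ τ), F.pk]) (dn τ hτ) σ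
  have hr := gr_le (F.contψ hτ) σ
  have hple : gp ψ τ σ ≤ π / 2 := by
    apply abs_le_of_sq_le_sq' _ (by positivity) |>.2
    nlinarith [sq_nonneg (gq ψ τ σ)]
  have : K * (gp ψ τ σ - c) ≤ K * (π / 2) := by
    apply mul_le_mul_of_nonneg_left _ hK0.le
    linarith
  rw [abs_le]
  constructor <;> linarith

theorem μ_le {T : ℝ} {ψ k k1 k2 k3 a : ℝ → ℝ → ℝ} {μ : ℝ → ℝ}
    (F : Flow T ψ k k1 k2 k3 a μ) {τ B : ℝ} (hτ : τ ∈ Icc 0 T) (hB : ∀ σ, |k τ σ| ≤ B) :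
    μ τ ≤ B ^ 2 := by
  have h := F.hμ τ hτ
  have hc := F.contk hτ
  have h1 : ∫ σ in (0:ℝ)..π, k τ σ ^ 2 ≤ ∫ σ in (0:ℝ)..π, B ^ 2 :=
    intervalIntegral.integral_mono_on Real.pi_pos.le (by apply Continuous.intervalIntegrable; fun_prop)
      (by simp) (fun s _ => sq_le_sq' (abs_le.1 (hB s)).1 (abs_le.1 (hB s)).2)
  rw [h, intervalIntegral.integral_const, smul_eq_mul, sub_zero] at h1
  exact le_of_mul_le_mul_left h1 Real.pi_pos

/-- bound for the derivative of the curvature -/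
theorem k1_bound {T : ℝ} {ψ k k1 k2 k3 a : ℝ → ℝ → ℝ} {μ : ℝ → ℝ}
    (F : Flow T ψ k k1 k2 k3 a μ) {B D : ℝ} (hB0 : 1 ≤ B) (hB : ∀ τ ∈ Icc 0 T, ∀ σ, |k τ σ| ≤ B)
    (hD : ∀ σ, k1 0 σ ^ 2 < D) :
    ∀ τ ∈ Icc 0 T, ∀ σ, k1 τ σ ^ 2 ≤ D + 1000 * B ^ 6 := by
  set M := 20 * B ^ 2 with hM
  set L := D + 1000 * B ^ 6 with hL
  have h0mem : (0:ℝ) ∈ Icc 0 T := ⟨le_rfl, F.pos.le⟩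
  have hB2 : 1 ≤ B ^ 2 := one_le_pow₀ hB0
  have hBB : B ≤ B ^ 2 := by nlinarith
  have hB4 : 1 ≤ B ^ 4 := one_le_pow₀ hB0
  have hB46 : B ^ 4 ≤ B ^ 6 := pow_le_pow_right₀ hB0 (by norm_num)
  have hD0 : 0 < D := lt_of_le_of_lt (sq_nonneg _) (hD 0)
  have hκ2 : ∀ τ ∈ Icc 0 T, ∀ σ, (1 + k τ σ) ^ 2 ≤ 4 * B ^ 2 := by
    intro τ hτ σ
    have := abs_le.1 (hB τ hτ σ)
    have : (1 + k τ σ) ^ 2 ≤ (2 * B) ^ 2 := sq_le_sq' (by linarith) (by linarith)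
    linarith
  have key : ∀ τ ∈ Icc 0 T, ∀ z ∈ Icc 0 π, 0 < L - (k1 τ z ^ 2 + M * (1 + k τ z) ^ 2) := by
    apply max_principle isCompact_Icc (fun τ z => L - (k1 τ z ^ 2 + M * (1 + k τ z) ^ 2))
    · exact (continuousOn_const.sub ((F.ck1.pow 2).add (continuousOn_const.mul
        ((continuousOn_const.add F.ck).pow 2)))).mono (prod_mono le_rfl (subset_univ _))
    · intro z _
      have e1 := hD z
      have e2 := mul_le_mul_of_nonneg_left (hκ2 0 h0mem z) (by positivity : 0 ≤ M)
      have e3 : M * (4 * B ^ 2) = 80 * B ^ 4 := by rw [hM]; ring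
      simp only [hL]
      linarith
    · intro τ hτ σ hσ hzero hmin
      have hτ' : τ ∈ Icc 0 T := ⟨hτ.1.le, hτ.2⟩
      have hloc : IsLocalMin (fun z => L - (k1 τ z ^ 2 + M * (1 + k τ z) ^ 2)) σ := by
        refine Filter.Eventually.of_forall fun y => ?_
        beta_reduce; rw [hzero]
        exact per_min (fun σ => by rw [F.pk1, F.pk]) (fun y hy =>
          hmin τ ⟨hτ.1.le, le_rfl⟩ y hy) y
      have hd1 : ∀ z, HasDerivAt (fun z => L - (k1 τ z ^ 2 + M * (1 + k τ z) ^ 2))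
          (-(2 * k1 τ z * k2 τ z + M * (2 * (1 + k τ z) * k1 τ z))) z := by
        intro z
        have := ((((F.k1s τ hτ' z).pow 2).add ((((F.ks τ hτ' z).const_add 1).pow 2).const_mul M)).const_sub L)
        refine this.congr_deriv ?_
        simp
      obtain ⟨f1, f2⟩ := second_min hd1 (((((F.k1s τ hτ' σ).const_mul 2).mul (F.k2s τ hτ' σ)).add
        (((((F.ks τ hτ' σ).const_add 1).const_mul 2).mul (F.k1s τ hτ' σ)).const_mul M)).neg) hloc
      refine ⟨_, ?_, (((F.k1t τ hτ' σ).pow 2).add ((((F.kt τ hτ' σ).const_add 1).pow 2).const_mul M)).const_sub L⟩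
      have hμ := F.μ_nonneg hτ'
      have hμB := F.μ_le hτ' (hB τ hτ')
      have hkB := abs_le.1 (hB τ hτ' σ)
      have hκB := hκ2 τ hτ' σ
      simp only [Nat.cast_ofNat, Nat.add_one_sub_one, pow_one]
      set κ := 1 + k τ σ with hκ
      set x := k τ σ
      set w := k1 τ σ
      set F2 := x ^ 2 + x - μ τ with hF2
      set F1 := 2 * F2 + κ * (2 * x + 1) with hF1
      have hx2 : x ^ 2 ≤ B ^ 2 := sq_le_sq' hkB.1 hkB.2
      have hF2B : F2 ≤ 2 * B ^ 2 := by linarith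
      have hF1B : F1 ≤ 10 * B ^ 2 := by
        have : κ * (2 * x + 1) = 2 * x ^ 2 + 3 * x + 1 := by rw [hκ]; ring
        linarith
      have e1 : w ^ 2 * F1 ≤ w ^ 2 * (10 * B ^ 2) := mul_le_mul_of_nonneg_left hF1B (sq_nonneg _)
      have e2 : κ ^ 2 * F2 ≤ κ ^ 2 * (2 * B ^ 2) := mul_le_mul_of_nonneg_left hF2B (sq_nonneg _)
      have e3 : κ ^ 2 * (2 * B ^ 2) ≤ 8 * B ^ 4 := by
        calc κ ^ 2 * (2 * B ^ 2) ≤ (4 * B ^ 2) * (2 * B ^ 2) := by gcongr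
          _ = 8 * B ^ 4 := by ring
      have e4 : M * (κ ^ 2 * F2) ≤ M * (8 * B ^ 4) := mul_le_mul_of_nonneg_left (e2.trans e3) (by rw [hM]; positivity)
      have e5 : w ^ 2 = L - M * κ ^ 2 := by linarith
      have e6 : M * κ ^ 2 ≤ M * (4 * B ^ 2) := by gcongr
      have e7 : M * (4 * B ^ 2) = 80 * B ^ 4 := by rw [hM]; ring
      have e8 : M * (8 * B ^ 4) = 160 * B ^ 6 := by rw [hM]; ring
      have e9 : 920 * B ^ 6 ≤ w ^ 2 := by rw [e5, hL]; linarith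
      have e10 : 920 * B ^ 6 ≤ w ^ 2 * B ^ 2 := by nlinarith [sq_nonneg w]
      have e11 : M * w ^ 2 = 20 * (w ^ 2 * B ^ 2) := by rw [hM]; ring
      have e12 : 0 ≤ k2 τ σ ^ 2 := sq_nonneg _
      have e13 : 0 < B ^ 6 := by positivity
      have f3 : a τ σ * (2 * w * k2 τ σ + M * (2 * κ * w)) = 0 := by
        have : 2 * w * k2 τ σ + M * (2 * κ * w) = 0 := by linarith
        rw [this, mul_zero]
      have id1 : -(2 * w * (k3 τ σ + a τ σ * k2 τ σ + w * F1) + M * (2 * κ * (k2 τ σ + a τ σ * w + κ * F2)))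
        = -(2 * k2 τ σ * k2 τ σ + 2 * w * k3 τ σ + M * (2 * w * w + 2 * κ * k2 τ σ))
          - a τ σ * (2 * w * k2 τ σ + M * (2 * κ * w)) + 2 * k2 τ σ ^ 2 + 2 * (M * w ^ 2)
          - 2 * (w ^ 2 * F1) - 2 * (M * (κ ^ 2 * F2)) := by ring
      rw [id1, f3]
      linarith
  intro τ hτ σ
  have := pos_per (f := fun z => L - (k1 τ z ^ 2 + M * (1 + k τ z) ^ 2))
    (fun σ => by rw [F.pk1, F.pk]) (key τ hτ) σ
  have h2 : 0 ≤ M * (1 + k τ σ) ^ 2 := by positivity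
  linarith

end Flow
end GF

open scoped Topology ComplexConjugate

namespace GF

theorem apriori {b B : ℝ} (hb : 0 < b) (hB : 0 ≤ B) : ∃ m > 0, ∃ C ≥ 1, ∀ {T : ℝ} {ψ k k1 k2 k3 a : ℝ → ℝ → ℝ}
    {μ : ℝ → ℝ}, Flow T ψ k k1 k2 k3 a μ → (∀ σ, b ≤ gp ψ 0 σ) → (∀ σ, |k 0 σ| ≤ B) →
    (∀ σ, k1 0 σ ^ 2 ≤ B) →
    ∀ τ ∈ Icc 0 T, ∀ σ, m < gp ψ τ σ ∧ |k τ σ| ≤ C ∧ k1 τ σ ^ 2 ≤ C := by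
  obtain ⟨m, hm, hm1, h⟩ := Flow.exists_m hb
  set c := m / 2 with hc
  have hc0 : 0 < c := by positivity
  set K := (B + 2) / c + 3 / c ^ 2 with hK
  have hK0 : 0 < K := by positivity
  set B1 := 1 + K * (π / 2) with hB1
  have hB11 : 1 ≤ B1 := by have := Real.pi_pos; rw [hB1]; have : 0 ≤ K * (π / 2) := by positivity
                           linarith
  refine ⟨m, hm, B1 + (B + 1 + 1000 * B1 ^ 6), ?_, ?_⟩
  · have : 0 ≤ B1 ^ 6 := by positivity
    linarith
  intro T ψ k k1 k2 k3 a μ F h0 hk0 hk10 τ hτ σ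
  have hp := h F h0
  have e1 := F.kap_bound (c := c) (K := K) hc0 (by linarith) (fun τ hτ σ => by
    have := hp τ hτ σ; linarith) (by
    have : K * c ^ 2 = (B + 2) * c + 3 := by rw [hK]; field_simp
    have h2 : 0 ≤ (B + 2) * c := by positivity
    linarith) (fun σ => by
    have : K * c = (B + 2) + 3 / c := by rw [hK]; field_simp
    have h2 : 0 ≤ 3 / c := by positivity
    have h3 := abs_le.1 (hk0 σ)
    rw [abs_lt]; constructor <;> linarith)
  have e2 : ∀ τ ∈ Icc 0 T, ∀ σ, |k τ σ| ≤ B1 := fun τ hτ σ => by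
    have := abs_le.1 (e1 τ hτ σ)
    rw [abs_le]; constructor <;> linarith
  have e3 := F.k1_bound (B := B1) (D := B + 1) hB11 e2 (fun σ => by linarith [hk10 σ]) τ hτ σ
  have : 0 ≤ B1 ^ 6 := by positivity
  exact ⟨hp τ hτ σ, by linarith [e2 τ hτ σ], by linarith⟩

theorem wiener {T C : ℝ} {d : ℤ → ℝ → ℂ} (h : WS T 3 d) (hcs : CS T d) {τ : ℝ} (hτ : τ ∈ Icc 0 T)
    (hb : ∀ σ, fr (ds (ds d)) τ σ ^ 2 ≤ C) :
    Summable (fun n : ℤ => ‖(2 * Complex.I * n) * d n τ‖) ∧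
    ∑' n : ℤ, ‖(2 * Complex.I * n) * d n τ‖ ≤ C + ∑' n : ℤ, 1 / (n : ℝ) ^ 2 := by
  have hL : WS T 1 (ds (ds d)) := (WS.ds (WS.ds h))
  have hLc : CS T (ds (ds d)) := hcs.ds.ds
  have hi := int_sq hL hLc hτ
  have hcont : Continuous (fun σ => fr (ds (ds d)) τ σ ^ 2) :=
    (continuous_iff_continuousAt.2 fun σ => (fr_hasDerivAt hL hτ σ).continuousAt).pow 2
  have h1 : ∫ σ in (0:ℝ)..π, fr (ds (ds d)) τ σ ^ 2 ≤ ∫ σ in (0:ℝ)..π, C :=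
    intervalIntegral.integral_mono_on Real.pi_pos.le (hcont.intervalIntegrable _ _)
      (by simp) (fun σ _ => hb σ)
  rw [hi, intervalIntegral.integral_const, sub_zero, smul_eq_mul] at h1
  have h2 : (cnv (ds (ds d)) (ds (ds d)) 0 τ).re ≤ C := le_of_mul_le_mul_left h1 Real.pi_pos
  have hterm : ∀ n, ds (ds d) n τ * ds (ds d) (0 - n) τ = ((‖ds (ds d) n τ‖ ^ 2 : ℝ) : ℂ) := by
    intro n
    rw [zero_sub, hLc n τ hτ, Complex.mul_conj, Complex.normSq_eq_norm_sq]
  have hsq : Summable (fun n => ‖ds (ds d) n τ‖ ^ 2) := by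
    have := summable_cnv hL hL 0 hτ
    simp only [hterm, Complex.norm_real, norm_pow, norm_norm] at this
    exact this
  have h3 : ∑' n, ‖ds (ds d) n τ‖ ^ 2 ≤ C := by
    have : cnv (ds (ds d)) (ds (ds d)) 0 τ = ((∑' n, ‖ds (ds d) n τ‖ ^ 2 : ℝ) : ℂ) := by
      unfold cnv
      rw [Complex.ofReal_tsum]
      exact tsum_congr hterm
    rw [this, Complex.ofReal_re] at h2
    exact h2
  have hs2 : Summable (fun n : ℤ => 1 / (n : ℝ) ^ 2) :=
    Real.summable_one_div_int_pow.2 (by norm_num)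
  have hs1 : Summable (fun n : ℤ => ‖(2 * Complex.I * n) * d n τ‖) := by
    have : WS T 0 (ds d) := (WS.ds (h.mono (by norm_num)))
    exact this.summable hτ
  refine ⟨hs1, ?_⟩
  calc _ ≤ ∑' n : ℤ, (‖ds (ds d) n τ‖ ^ 2 + 1 / (n : ℝ) ^ 2) := by
        refine hs1.tsum_le_tsum (fun n => ?_) (hsq.add hs2)
        rcases eq_or_ne n 0 with rfl | hn
        · simp
        have hn' : (0:ℝ) < |(n:ℝ)| := abs_pos.2 (by exact_mod_cast hn)
        set y := ‖(2 * Complex.I * n) * d n τ‖ with hy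
        have : ‖ds (ds d) n τ‖ = 2 * |(n:ℝ)| * y := by
          unfold ds
          rw [norm_mul, norm_two_I]
        rw [this, ← sq_abs (n:ℝ)]
        set x := |(n:ℝ)|
        have h4 : 1 / x ^ 2 = (1/x)^2 := by rw [div_pow, one_pow]
        have h5 : y = (x * y) * (1 / x) := by field_simp
        have h6 : 0 ≤ (x*y - 1/x)^2 := sq_nonneg _
        have h7 : 0 ≤ (x*y)^2 := sq_nonneg _
        have h8 : 0 ≤ (1/x)^2 := sq_nonneg _
        rw [h4, mul_assoc, mul_pow]
        nlinarith
    _ ≤ _ := by rw [hsq.tsum_add hs2]; linarith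

end GF

open scoped Topology ComplexConjugate

namespace GF

theorem NL_congr {d e : ℤ → ℝ → ℂ} {τ τ' : ℝ} (h : ∀ n, d n τ = e n τ') (n : ℤ) :
    NL d n τ = NL e n τ' := by
  simp only [NL, As, Qs, cnv, ds, h]

theorem Sol.congr {T : ℝ} {d e : ℤ → ℝ → ℂ} (h : Sol T d) (he : ∀ n, ∀ τ ∈ Icc 0 T, e n τ = d n τ) :
    Sol T e := by
  obtain ⟨M, h0, hs, hb⟩ := h.ws
  refine ⟨⟨M, h0, hs, fun n τ hτ => by rw [he n τ hτ]; exact hb n τ hτ⟩, fun n τ hτ => by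
    rw [he _ τ hτ, he _ τ hτ]; exact h.cs n τ hτ, fun n τ hτ => ?_⟩
  rw [NL_congr (fun n => he n τ hτ), he n τ hτ]
  exact (h.ode n τ hτ).congr (fun s hs => he n s hs) (he n τ hτ)

theorem Sol.restrict {T T' : ℝ} {d : ℤ → ℝ → ℂ} (h : Sol T d) (hT : T' ≤ T) : Sol T' d := by
  have hs : Icc 0 T' ⊆ Icc 0 T := Icc_subset_Icc_right hT
  exact ⟨h.ws.restrict hT, fun n τ hτ => h.cs n τ (hs hτ), fun n τ hτ => (h.ode n τ (hs hτ)).mono hs⟩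

def cat (T : ℝ) (d e : ℤ → ℝ → ℂ) (n : ℤ) (τ : ℝ) : ℂ := if τ ≤ T then d n τ else e n (τ - T)

theorem cat_left {T : ℝ} {d e : ℤ → ℝ → ℂ} {τ : ℝ} (h : τ ≤ T) (n : ℤ) : cat T d e n τ = d n τ := by
  simp [cat, h]

theorem cat_right {T : ℝ} {d e : ℤ → ℝ → ℂ} (he : ∀ n, e n 0 = d n T) {τ : ℝ} (h : T ≤ τ) (n : ℤ) :
    cat T d e n τ = e n (τ - T) := by
  rcases h.eq_or_lt with rfl | h
  · simp [cat, he]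
  · simp [cat, h.not_ge]

theorem Sol.cat {T h : ℝ} (hT : 0 ≤ T) (hh : 0 ≤ h) {d e : ℤ → ℝ → ℂ} (hd : Sol T d) (he : Sol h e)
    (hde : ∀ n, e n 0 = d n T) : Sol (T + h) (cat T d e) := by
  have mem : ∀ {τ}, T ≤ τ → τ ≤ T + h → τ - T ∈ Icc 0 h := fun h1 h2 => ⟨by linarith, by linarith⟩
  have hU : Icc 0 (T + h) = Icc 0 T ∪ Icc T (T + h) :=
    (Icc_union_Icc_eq_Icc hT (by linarith)).symm
  refine ⟨?_, ?_, ?_⟩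
  · obtain ⟨M, h0, hs, hb⟩ := hd.ws
    obtain ⟨M', h0', hs', hb'⟩ := he.ws
    refine ⟨fun n => M n + M' n, fun n => add_nonneg (h0 n) (h0' n), ?_, fun n τ hτ => ?_⟩
    · simpa only [mul_add] using hs.add hs'
    · rcases le_total τ T with h1 | h1
      · rw [cat_left h1]; linarith [hb n τ ⟨hτ.1, h1⟩, h0' n]
      · rw [cat_right hde h1]; linarith [hb' n _ (mem h1 hτ.2), h0 n]
  · intro n τ hτ
    rcases le_total τ T with h1 | h1
    · rw [cat_left h1, cat_left h1]; exact hd.cs n τ ⟨hτ.1, h1⟩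
    · rw [cat_right hde h1, cat_right hde h1]; exact he.cs n _ (mem h1 hτ.2)
  · intro n τ hτ
    rw [hU]
    apply HasDerivWithinAt.union
    · by_cases h1 : τ ≤ T
      · rw [cat_left h1, NL_congr (fun n => cat_left h1 n)]
        exact (hd.ode n τ ⟨hτ.1, h1⟩).congr (fun s hs => cat_left hs.2 n) (cat_left h1 n)
      · refine HasFDerivWithinAt.of_notMem_closure ?_
        rw [closure_Icc]; exact fun h => h1 h.2
    · by_cases h1 : T ≤ τ
      · rw [cat_right hde h1, NL_congr (fun n => cat_right hde h1 n)]
        have h2 := he.ode n (τ - T) (mem h1 hτ.2)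
        have h3 : HasDerivWithinAt (fun s => e n (s - T)) _ (Icc T (T + h)) τ :=
          (HasDerivWithinAt.scomp τ h2 ((hasDerivAt_id' τ).sub_const T).hasDerivWithinAt
            (fun s hs => mem hs.1 hs.2))
        rw [one_smul] at h3
        exact h3.congr (fun s hs => cat_right hde hs.1 n) (cat_right hde h1 n)
      · refine HasFDerivWithinAt.of_notMem_closure ?_
        rw [closure_Icc]; exact fun h => h1 h.1

theorem fr_congr {f g : ℤ → ℝ → ℂ} {τ τ' : ℝ} (h : ∀ n, f n τ = g n τ') (σ : ℝ) :
    fr f τ σ = fr g τ' σ := by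
  simp only [fr, ev, h]

theorem gp_congr {ψ ψ' : ℝ → ℝ → ℝ} {τ τ' : ℝ} (h : ∀ σ, ψ τ σ = ψ' τ' σ) (σ : ℝ) :
    gp ψ τ σ = gp ψ' τ' σ := by
  simp only [gp, gx, h]

theorem abs_fr_le {f : ℤ → ℝ → ℂ} {τ σ : ℝ} (h : Summable (fun n => ‖f n τ‖)) :
    |fr f τ σ| ≤ ∑' n, ‖f n τ‖ := by
  unfold fr
  refine (Complex.abs_re_le_norm _).trans ?_
  unfold ev
  have : ∀ n, ‖f n τ * em n σ‖ = ‖f n τ‖ := fun n => by rw [norm_mul, norm_em, mul_one]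
  refine (norm_tsum_le_tsum_norm (by simpa only [this] using h)).trans ?_
  simp only [this]; exact le_rfl

theorem global_exists (d0 : ℤ → ℂ) (hcs : ∀ n, d0 (-n) = conj (d0 n))
    (hi : ∀ m : ℕ, Summable (fun n => wt n ^ m * ‖d0 n‖)) {b : ℝ} (hb : 0 < b)
    (hp : ∀ σ, b ≤ gp (fr (fun n _ => d0 n)) 0 σ) :
    ∃ d : ℤ → ℝ → ℂ, (∀ n, d n 0 = d0 n) ∧ (∀ T, 0 < T → Sol T d) ∧
      ∃ m > 0, ∃ C ≥ 1, ∀ τ ≥ 0, ∀ σ, m < gp (fr d) τ σ ∧ |fr (ds d) τ σ| ≤ C ∧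
        fr (ds (ds d)) τ σ ^ 2 ≤ C := by
  set f0 : ℤ → ℝ → ℂ := fun n _ => d0 n with hf0
  have hW : ∀ m, WS 1 m f0 := fun m => ⟨fun n => ‖d0 n‖, fun n => norm_nonneg _, hi m,
    fun n τ _ => le_rfl⟩
  have h01 : (0:ℝ) ∈ Icc (0:ℝ) 1 := ⟨le_rfl, zero_le_one⟩
  have hW1 : WS 1 1 (ds f0) := (hW 2).ds
  have hW2 : WS 1 0 (ds (ds f0)) := hW1.ds
  set S1 := ∑' n, ‖ds f0 n 0‖ with hS1
  set S2 := ∑' n, ‖ds (ds f0) n 0‖ with hS2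
  have hS10 : 0 ≤ S1 := tsum_nonneg fun _ => norm_nonneg _
  have hS20 : 0 ≤ S2 := tsum_nonneg fun _ => norm_nonneg _
  obtain ⟨m, hm, C, hC, hap⟩ := apriori (B := S1 + S2 ^ 2) hb (by positivity)
  have bnd : ∀ {T : ℝ} {d : ℤ → ℝ → ℂ}, 0 < T → Sol T d → (∀ n, d n 0 = d0 n) →
      ∀ τ ∈ Icc 0 T, ∀ σ, m < gp (fr d) τ σ ∧ |fr (ds d) τ σ| ≤ C ∧
        fr (ds (ds d)) τ σ ^ 2 ≤ C := by
    intro T d hT h h0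
    have hi' : ∀ m : ℕ, Summable (fun n => wt n ^ m * ‖d n 0‖) := by simpa only [h0] using hi
    refine hap (h.flow hT hi') ?_ ?_ ?_
    · intro σ
      rw [gp_congr (ψ' := fr f0) (τ' := 0) (fun σ => fr_congr h0 σ)]
      exact hp σ
    · intro σ
      rw [fr_congr (g := ds f0) (τ' := 0) (fun n => by simp [ds, h0, hf0])]
      have := abs_fr_le (σ := σ) (hW1.summable h01)
      nlinarith
    · intro σ
      rw [fr_congr (g := ds (ds f0)) (τ' := 0) (fun n => by simp [ds, h0, hf0])]
      have := abs_fr_le (σ := σ) (hW2.summable h01)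
      have h2 := sq_le_sq' (abs_le.1 this).1 (abs_le.1 this).2
      linarith
  obtain ⟨h, hh, hloc⟩ := local_exists (max S1 (C + ∑' n : ℤ, 1 / (n : ℝ) ^ 2))
  let A : ℕ → Type := fun N => {d : ℤ → ℝ → ℂ // Sol ((N + 1 : ℕ) * h) d ∧ ∀ n, d n 0 = d0 n}
  have start : Nonempty (A 0) := by
    obtain ⟨d, h1, h2⟩ := hloc d0 hcs (by simpa [ds, hf0] using hW1.summable h01)
      (le_max_of_le_left (by simp [hS1, ds, hf0]))
    exact ⟨⟨d, by simpa using h1, h2⟩⟩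
  have step : ∀ N (d : A N), ∃ e : A (N + 1), ∀ n, ∀ τ ≤ (N + 1 : ℕ) * h, e.1 n τ = d.1 n τ := by
    intro N d
    have hT : 0 < ((N + 1 : ℕ) : ℝ) * h := by positivity
    have hTm : ((N + 1 : ℕ) : ℝ) * h ∈ Icc 0 (((N + 1 : ℕ) : ℝ) * h) := ⟨hT.le, le_rfl⟩
    have hi' : ∀ m : ℕ, Summable (fun n => wt n ^ m * ‖d.1 n 0‖) := by simpa only [d.2.2] using hi
    have hb := bnd hT d.2.1 d.2.2 _ hTm
    obtain ⟨w1, w2⟩ := wiener (d.2.1.ws_all hi' 3) d.2.1.cs hTm (fun σ => (hb σ).2.2)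
    obtain ⟨e, h1, h2⟩ := hloc (fun n => d.1 n (((N + 1 : ℕ) : ℝ) * h))
      (fun n => d.2.1.cs n _ hTm) w1 (le_max_of_le_right w2)
    refine ⟨⟨cat (((N + 1 : ℕ) : ℝ) * h) d.1 e, ?_, ?_⟩, ?_⟩
    · have := d.2.1.cat hT.le hh.le h1 h2
      convert this using 1
      push_cast; ring
    · intro n
      rw [cat_left hT.le]; exact d.2.2 n
    · intro n τ hτ
      exact cat_left hτ n
  choose nx hnx using step
  let sq : (N : ℕ) → A N := fun N => Nat.rec start.some (fun N d => nx N d) N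
  have hsq : ∀ N, ∀ n, ∀ τ ≤ (N + 1 : ℕ) * h, (sq (N + 1)).1 n τ = (sq N).1 n τ :=
    fun N => hnx N (sq N)
  have hsq2 : ∀ N M, N ≤ M → ∀ n, ∀ τ ≤ (N + 1 : ℕ) * h, (sq M).1 n τ = (sq N).1 n τ := by
    intro N M hNM
    induction M, hNM using Nat.le_induction with
    | base => intro n τ _; rfl
    | succ M hM ih =>
      intro n τ hτ
      rw [hsq M n τ (hτ.trans (by gcongr)), ih n τ hτ]
  let dg : ℤ → ℝ → ℂ := fun n τ => (sq ⌈τ / h⌉₊).1 n τ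
  have hdg : ∀ N, ∀ n, ∀ τ ≤ (N + 1 : ℕ) * h, dg n τ = (sq N).1 n τ := by
    intro N n τ hτ
    have h1 : τ ≤ ((⌈τ / h⌉₊ + 1 : ℕ) : ℝ) * h := by
      have := Nat.le_ceil (τ / h)
      rw [div_le_iff₀ hh] at this
      push_cast; nlinarith
    rcases le_total N ⌈τ / h⌉₊ with h2 | h2
    · exact hsq2 _ _ h2 n τ hτ
    · exact (hsq2 _ _ h2 n τ h1).symm
  have hdg0 : ∀ n, dg n 0 = d0 n := fun n => (sq _).2.2 n
  have hsol : ∀ T, 0 < T → Sol T dg := by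
    intro T hT
    have h1 : T ≤ ((⌈T / h⌉₊ + 1 : ℕ) : ℝ) * h := by
      have := Nat.le_ceil (T / h)
      rw [div_le_iff₀ hh] at this
      push_cast; nlinarith
    exact ((sq ⌈T / h⌉₊).2.1.restrict h1).congr (fun n τ hτ => hdg _ n τ (hτ.2.trans h1))
  refine ⟨dg, hdg0, hsol, m, hm, C, hC, fun τ hτ σ => ?_⟩
  exact bnd (T := τ + 1) (by positivity) (hsol _ (by positivity)) hdg0 τ ⟨hτ, by linarith⟩ σ

end GF

open scoped Topology ComplexConjugate

namespace GF

theorem barbalat {h w μ μ' : ℝ → ℝ} {c C B : ℝ} (hc : 0 < c) (hC : 0 < C)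
    (hh : ∀ τ > 0, HasDerivAt h (w τ) τ) (hw : ∀ τ > 0, c * μ τ ≤ w τ) (h0 : ∀ τ > 0, 0 ≤ μ τ)
    (hμ : ∀ τ > 0, HasDerivAt μ (μ' τ) τ) (hC' : ∀ τ > 0, μ' τ ≤ C) (hB : ∀ τ > 0, h τ ≤ B) :
    Tendsto μ atTop (𝓝 0) := by
  have hmono : MonotoneOn h (Ioi 0) := by
    apply monotoneOn_of_deriv_nonneg (convex_Ioi 0)
    · exact fun τ hτ => (hh τ hτ).continuousAt.continuousWithinAt
    · rw [interior_Ioi]; exact fun τ hτ => (hh τ hτ).differentiableAt.differentiableWithinAt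
    · rw [interior_Ioi]; intro τ hτ
      rw [(hh τ hτ).deriv]
      exact le_trans (mul_nonneg hc.le (h0 τ hτ)) (hw τ hτ)
  have hbdd : BddAbove (h '' Ioi 0) := ⟨B, by rintro _ ⟨τ, hτ, rfl⟩; exact hB τ hτ⟩
  have hne : (h '' Ioi 0).Nonempty := ⟨h 1, 1, by simp, rfl⟩
  rw [Metric.tendsto_atTop]
  intro ε hε
  set δ := ε / (2 * C) with hδ
  have hδ0 : 0 < δ := by positivity
  have hη : 0 < c * (ε / 2) * δ := by positivity
  obtain ⟨_, ⟨τ0, hτ0, rfl⟩, hlt⟩ := exists_lt_of_lt_csSup hne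
    (show sSup (h '' Ioi 0) - c * (ε / 2) * δ < sSup (h '' Ioi 0) by linarith)
  have hτ0' : (0:ℝ) < τ0 := hτ0
  refine ⟨τ0 + δ, fun τ hτ => ?_⟩
  have hτp : 0 < τ := by linarith
  rw [Real.dist_eq, sub_zero, abs_of_nonneg (h0 τ hτp)]
  by_contra hcon
  push Not at hcon
  have hsub : Icc (τ - δ) τ ⊆ Ioi 0 := fun s hs => by
    have := hs.1; simp only [mem_Ioi]; linarith
  have h1 : ∀ s ∈ Icc (τ - δ) τ, ε / 2 ≤ μ s := by
    intro s hs
    have := Convex.image_sub_le_mul_sub_of_deriv_le (convex_Icc (τ - δ) τ) (f := μ)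
      (fun s hs => (hμ s (hsub hs)).continuousAt.continuousWithinAt)
      (fun s hs => (hμ s (hsub (interior_subset hs))).differentiableAt.differentiableWithinAt)
      (C := C) (fun s hs => by
        rw [(hμ s (hsub (interior_subset hs))).deriv]; exact hC' s (hsub (interior_subset hs)))
      s hs τ ⟨by linarith, le_rfl⟩ hs.2
    have h2 : C * (τ - s) ≤ C * δ := by
      apply mul_le_mul_of_nonneg_left _ hC.le; linarith [hs.1]
    have h3 : C * δ = ε / 2 := by rw [hδ]; field_simp
    linarith
  have h2 := Convex.mul_sub_le_image_sub_of_le_deriv (convex_Icc (τ - δ) τ) (f := h)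
      (fun s hs => (hh s (hsub hs)).continuousAt.continuousWithinAt)
      (fun s hs => (hh s (hsub (interior_subset hs))).differentiableAt.differentiableWithinAt)
      (C := c * (ε / 2)) (fun s hs => by
        have hs' := interior_subset hs
        rw [(hh s (hsub hs')).deriv]
        exact le_trans (mul_le_mul_of_nonneg_left (h1 s hs') hc.le) (hw s (hsub hs')))
      (τ - δ) ⟨le_rfl, by linarith⟩ τ ⟨by linarith, le_rfl⟩ (by linarith)
  have h3 : h τ0 ≤ h (τ - δ) := hmono hτ0 (hsub ⟨le_rfl, by linarith⟩) (by linarith)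
  have h4 : h τ ≤ sSup (h '' Ioi 0) := le_csSup hbdd ⟨τ, hτp, rfl⟩
  have h5 : c * (ε / 2) * (τ - (τ - δ)) = c * (ε / 2) * δ := by ring
  linarith

namespace Flow
variable {T : ℝ} {ψ k k1 k2 k3 a : ℝ → ℝ → ℝ} {μ : ℝ → ℝ}

theorem μt (F : Flow T ψ k k1 k2 k3 a μ) {τ : ℝ} (hτ : τ ∈ Icc 0 T) {C : ℝ} (hC : 1 ≤ C)
    (hk : ∀ σ, |k τ σ| ≤ C) : ∃ v, v ≤ 15 * C ^ 4 ∧ HasDerivWithinAt μ v (Icc 0 T) τ := by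
  have h1 := hasDerivWithinAt_integral F.pos.le (G := fun τ s => k τ s ^ 2) 0 π
    (fun τ hτ σ => (F.kt τ hτ σ).pow 2) (fun τ hτ => (F.contk hτ).pow 2) (by
      have := F.ck; have := F.ck1; have := F.ck2; have := F.ca
      have hμ : ContinuousOn (fun q : ℝ × ℝ => μ q.1) (Icc 0 T ×ˢ univ) :=
        F.cμ.comp continuousOn_fst (fun q hq => hq.1)
      have e1 : ContinuousOn (fun q : ℝ × ℝ => ((2:ℕ):ℝ) * k q.1 q.2 ^ (2 - 1)) (Icc 0 T ×ˢ univ) := by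
        fun_prop
      have e2 : ContinuousOn (fun q : ℝ × ℝ => k2 q.1 q.2 + a q.1 q.2 * k1 q.1 q.2) (Icc 0 T ×ˢ univ) := by
        fun_prop
      have e3 : ContinuousOn (fun q : ℝ × ℝ => 1 + k q.1 q.2) (Icc 0 T ×ˢ univ) := by
        fun_prop
      have e4 : ContinuousOn (fun q : ℝ × ℝ => k q.1 q.2 ^ 2 + k q.1 q.2) (Icc 0 T ×ˢ univ) := by
        fun_prop
      exact e1.mul (e2.add (e3.mul (e4.sub hμ)))) τ hτ
  set J := ∫ σ in (0:ℝ)..π, ((2:ℕ):ℝ) * k τ σ ^ (2 - 1) * (k2 τ σ + a τ σ * k1 τ σ + (1 + k τ σ) * (k τ σ ^ 2 + k τ σ - μ τ)) with hJ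
  have h2 : HasDerivWithinAt μ (π⁻¹ * J) (Icc 0 T) τ := by
    have h3 : HasDerivWithinAt (fun s => π⁻¹ * ∫ σ in (0:ℝ)..π, k s σ ^ 2) (π⁻¹ * J) (Icc 0 T) τ :=
      h1.const_mul _
    have h4 : ∀ s ∈ Icc 0 T, μ s = π⁻¹ * ∫ σ in (0:ℝ)..π, k s σ ^ 2 := by
      intro s hs
      rw [F.hμ s hs]; have := Real.pi_pos; field_simp
    exact h3.congr h4 (h4 τ hτ)
  refine ⟨_, ?_, h2⟩
  have hμ0 := F.μ_nonneg hτ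
  have hμC := F.μ_le hτ hk
  have ck := F.contk hτ
  have ck1 := F.contk1 hτ
  have cac := F.conta hτ
  have ck2 : Continuous (k2 τ) := continuous_iff_continuousAt.2 fun σ => (F.k2s τ hτ σ).continuousAt
  have hd : ∀ σ, HasDerivAt (fun σ => 2 * (k τ σ * k1 τ σ) + a τ σ * k τ σ ^ 2)
      (2 * (k1 τ σ * k1 τ σ + k τ σ * k2 τ σ) + ((k τ σ ^ 2 + k τ σ - μ τ) * k τ σ ^ 2
        + a τ σ * (2 * k τ σ * k1 τ σ))) σ := by
    intro σ
    have := (((F.ks τ hτ σ).mul (F.k1s τ hτ σ)).const_mul 2).add ((F.as τ hτ σ).mul ((F.ks τ hτ σ).pow 2))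
    refine this.congr_deriv ?_
    simp
  have hI : ∫ σ in (0:ℝ)..π, (2 * (k1 τ σ * k1 τ σ + k τ σ * k2 τ σ) + ((k τ σ ^ 2 + k τ σ - μ τ) * k τ σ ^ 2
        + a τ σ * (2 * k τ σ * k1 τ σ))) = 0 := by
    rw [intervalIntegral.integral_eq_sub_of_hasDerivAt (fun σ _ => hd σ)
      (Continuous.intervalIntegrable (by fun_prop) _ _)]
    have e1 := F.pk τ 0
    have e2 := F.pk1 τ 0
    have e3 := F.pa τ 0
    rw [zero_add] at e1 e2 e3
    rw [e1, e2, e3]; ring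
  have h5 : J = ∫ σ in (0:ℝ)..π, (((2:ℕ):ℝ) * k τ σ ^ (2 - 1) * (k2 τ σ + a τ σ * k1 τ σ + (1 + k τ σ) * (k τ σ ^ 2 + k τ σ - μ τ))
      - (2 * (k1 τ σ * k1 τ σ + k τ σ * k2 τ σ) + ((k τ σ ^ 2 + k τ σ - μ τ) * k τ σ ^ 2
        + a τ σ * (2 * k τ σ * k1 τ σ)))) := by
    rw [intervalIntegral.integral_sub (Continuous.intervalIntegrable (by fun_prop) _ _)
      (Continuous.intervalIntegrable (by fun_prop) _ _), hI, sub_zero]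
  have h6 : J ≤ ∫ σ in (0:ℝ)..π, 15 * C ^ 4 := by
    rw [h5]
    apply intervalIntegral.integral_mono_on Real.pi_pos.le
      (Continuous.intervalIntegrable (by fun_prop) _ _) (by simp)
    intro σ _
    have hkC := hk σ
    set x := k τ σ
    set f := x ^ 2 + x - μ τ with hf
    have hx2 : x ^ 2 ≤ C ^ 2 := sq_le_sq' (abs_le.1 hkC).1 (abs_le.1 hkC).2
    have hCC : C ≤ C ^ 2 := by nlinarith
    have hfa : |f| ≤ 3 * C ^ 2 := by
      have := abs_le.1 hkC
      rw [abs_le]; constructor <;> nlinarith [sq_nonneg x]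
    have hga : |2 * x + x ^ 2| ≤ 3 * C ^ 2 := by
      have := abs_le.1 hkC
      rw [abs_le]; constructor <;> nlinarith [sq_nonneg x]
    have hfg : f * (2 * x + x ^ 2) ≤ 9 * C ^ 4 := by
      calc f * (2 * x + x ^ 2) ≤ |f * (2 * x + x ^ 2)| := le_abs_self _
        _ = |f| * |2 * x + x ^ 2| := abs_mul _ _
        _ ≤ (3 * C ^ 2) * (3 * C ^ 2) := mul_le_mul hfa hga (abs_nonneg _) (by positivity)
        _ = 9 * C ^ 4 := by ring
    have : 0 ≤ k1 τ σ ^ 2 := sq_nonneg _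
    have h7 : 0 ≤ C ^ 4 := by positivity
    have : ((2:ℕ):ℝ) * x ^ (2 - 1) * (k2 τ σ + a τ σ * k1 τ σ + (1 + x) * f)
      - (2 * (k1 τ σ * k1 τ σ + x * k2 τ σ) + (f * x ^ 2 + a τ σ * (2 * x * k1 τ σ)))
      = f * (2 * x + x ^ 2) - 2 * k1 τ σ ^ 2 := by push_cast; simp; ring
    rw [this]; linarith
  rw [intervalIntegral.integral_const, sub_zero, smul_eq_mul] at h6
  calc π⁻¹ * J ≤ π⁻¹ * (π * (15 * C ^ 4)) := mul_le_mul_of_nonneg_left h6 (by have := Real.pi_pos; positivity)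
    _ = 15 * C ^ 4 := by have := Real.pi_pos; field_simp

theorem k_cube (F : Flow T ψ k k1 k2 k3 a μ) {τ : ℝ} (hτ : τ ∈ Icc 0 T) {C : ℝ}
    (hk : ∀ σ, |k1 τ σ| ≤ C) (σ : ℝ) : |k τ σ| ^ 3 ≤ 3 * C * π * μ τ := by
  have ck := F.contk hτ
  have ck1 := F.contk1 hτ
  obtain ⟨σ0, hσ0, hz⟩ := exists_hasDerivAt_eq_zero (f := ψ τ) (f' := k τ) Real.pi_pos
    (F.contψ hτ).continuousOn (by have := F.pψ τ 0; rw [zero_add] at this; exact this.symm)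
    (fun x _ => F.ψs τ hτ x)
  obtain ⟨y, hy, hy2⟩ := Function.Periodic.exists_mem_Ico₀ (f := k τ) (F.pk τ) Real.pi_pos σ
  rw [hy2]
  have hC0 : 0 ≤ C := (abs_nonneg _).trans (hk 0)
  have h1 : ∫ s in σ0..y, 3 * k τ s ^ 2 * k1 τ s = k τ y ^ 3 := by
    rw [intervalIntegral.integral_eq_sub_of_hasDerivAt (f := fun s => k τ s ^ 3)
      (fun s _ => by
        refine ((F.ks τ hτ s).pow 3).congr_deriv ?_
        simp)
      (Continuous.intervalIntegrable (by fun_prop) _ _), hz]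
    ring
  have h2 : |∫ s in σ0..y, 3 * k τ s ^ 2 * k1 τ s| ≤ |∫ s in σ0..y, 3 * C * k τ s ^ 2| := by
    refine intervalIntegral.norm_integral_le_abs_of_norm_le (μ := volume) (f := fun s => 3 * k τ s ^ 2 * k1 τ s) (g := fun s => 3 * C * k τ s ^ 2) ?_ (Continuous.intervalIntegrable (by fun_prop) _ _)
    refine Filter.Eventually.of_forall fun s => ?_
    rw [Real.norm_eq_abs, abs_mul, abs_of_nonneg (by positivity : 0 ≤ 3 * k τ s ^ 2)]
    nlinarith [hk s, sq_nonneg (k τ s), mul_le_mul_of_nonneg_left (hk s) (sq_nonneg (k τ s))]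
  have h3 : |∫ s in σ0..y, 3 * C * k τ s ^ 2| ≤ ∫ s in (0:ℝ)..π, 3 * C * k τ s ^ 2 := by
    have h4 : |∫ s in σ0..y, 3 * C * k τ s ^ 2| ≤ |∫ s in (0:ℝ)..π, 3 * C * k τ s ^ 2| := by
      apply intervalIntegral.abs_integral_mono_interval
      · rw [uIoc_of_le Real.pi_pos.le]
        intro s hs
        rw [mem_uIoc] at hs
        rcases hs with hs | hs
        · exact ⟨hσ0.1.trans hs.1, hs.2.trans hy.2.le⟩
        · exact ⟨lt_of_le_of_lt hy.1 hs.1, hs.2.trans hσ0.2.le⟩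
      · exact Filter.Eventually.of_forall fun s => by positivity
      · exact Continuous.intervalIntegrable (by fun_prop) _ _
    rwa [abs_of_nonneg (a := ∫ s in (0:ℝ)..π, 3 * C * k τ s ^ 2)] at h4
    exact intervalIntegral.integral_nonneg Real.pi_pos.le fun s _ => by positivity
  rw [intervalIntegral.integral_const_mul (a := 0), F.hμ τ hτ] at h3
  rw [← abs_pow, ← h1]
  linarith

theorem x_near (F : Flow T ψ k k1 k2 k3 a μ) {τ : ℝ} (hτ : τ ∈ Icc 0 T) {ε : ℝ}
    (hk : ∀ σ, |k τ σ| ≤ ε) (c σ : ℝ) : |gx ψ c τ σ - Real.sin (σ + ψ τ σ + c)| ≤ π / 2 * ε := by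
  set v := fun σ => gx ψ c τ σ - Real.sin (σ + ψ τ σ + c) with hv
  have hd : ∀ σ, HasDerivAt v (-(k τ σ) * Real.cos (σ + ψ τ σ + c)) σ := by
    intro σ
    refine ((F.xs c τ hτ σ).sub (((F.ang_s hτ σ).add_const c).sin)).congr_deriv ?_
    ring
  have ha : v (σ + π) = - v σ := by
    simp only [hv]
    rw [gx_anti (F.pψ τ), F.pψ, show σ + π + ψ τ σ + c = (σ + ψ τ σ + c) + π by ring, Real.sin_add_pi]
    ring
  have h := Convex.norm_image_sub_le_of_norm_hasDerivWithin_le (s := univ) (C := ε) (f := v)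
    (fun x _ => (hd x).hasDerivWithinAt) (fun x _ => by
      rw [norm_mul, norm_neg, Real.norm_eq_abs, Real.norm_eq_abs]
      have := Real.abs_cos_le_one (x + ψ τ x + c)
      have h0 := abs_nonneg (k τ x)
      nlinarith [hk x]) convex_univ (mem_univ σ) (mem_univ (σ + π))
  rw [ha, Real.norm_eq_abs, Real.norm_eq_abs, show -v σ - v σ = -(2 * v σ) by ring, abs_neg, abs_mul,
    abs_two, add_sub_cancel_left, abs_of_pos Real.pi_pos] at h
  change |v σ| ≤ _
  linarith

theorem pq_near (F : Flow T ψ k k1 k2 k3 a μ) {τ : ℝ} (hτ : τ ∈ Icc 0 T) {ε : ℝ}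
    (hk : ∀ σ, |k τ σ| ≤ ε) (σ : ℝ) : |gp ψ τ σ - 1| ≤ π * ε ∧ |gq ψ τ σ| ≤ π * ε := by
  have h1 := F.x_near hτ hk 0 σ
  have h2 := F.x_near hτ hk (-(π/2)) σ
  have hs := Real.abs_sin_le_one (σ + ψ τ σ)
  have hc := Real.abs_cos_le_one (σ + ψ τ σ)
  have e1 : Real.sin (σ + ψ τ σ + -(π/2)) = - Real.cos (σ + ψ τ σ) := by
    rw [← sub_eq_add_neg, Real.sin_sub_pi_div_two]
  rw [e1] at h2
  rw [add_zero] at h1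
  have hsc := Real.sin_sq_add_cos_sq (σ + ψ τ σ)
  unfold gp gq
  set x := gx ψ 0 τ σ
  set y := gx ψ (-(π/2)) τ σ
  set s := Real.sin (σ + ψ τ σ)
  set c := Real.cos (σ + ψ τ σ)
  have key : ∀ u v w z : ℝ, |u| ≤ π / 2 * ε → |v| ≤ π / 2 * ε → |w| ≤ 1 → |z| ≤ 1 →
      |u * w + v * z| ≤ π * ε := by
    intro u v w z hu hv hw hz
    have h3 : |u * w| ≤ π / 2 * ε := by
      rw [abs_mul]; nlinarith [abs_nonneg u, abs_nonneg w]
    have h4 : |v * z| ≤ π / 2 * ε := by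
      rw [abs_mul]; nlinarith [abs_nonneg v, abs_nonneg z]
    linarith [abs_add_le (u * w) (v * z)]
  constructor
  · have := key _ _ s (-c) h1 h2 hs (by rwa [abs_neg])
    convert this using 2
    linear_combination hsc
  · have := key _ _ c s h1 h2 hc hs
    convert this using 2
    ring

end Flow

theorem flow_conv {ψ k k1 k2 k3 a : ℝ → ℝ → ℝ} {μ : ℝ → ℝ}
    (HF : ∀ T, 0 < T → Flow T ψ k k1 k2 k3 a μ) {m C : ℝ} (hm : 0 < m) (hC : 1 ≤ C)
    (hb : ∀ τ ≥ 0, ∀ σ, m < gp ψ τ σ ∧ |k τ σ| ≤ C ∧ k1 τ σ ^ 2 ≤ C) :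
    (∀ ε > 0, ∃ T0, ∀ τ ≥ T0, ∀ σ, |k τ σ| < ε) ∧
    (∀ ε > 0, ∃ T0, ∀ τ ≥ T0, ∀ σ, |Real.sqrt (gx ψ 0 τ σ ^ 2 + gx ψ (-(π/2)) τ σ ^ 2) - 1| < ε) ∧
    Tendsto (fun τ => gP ψ τ π) atTop (𝓝 (π / 2)) := by
  have hπ := Real.pi_pos
  have mem : ∀ {τ : ℝ}, 0 ≤ τ → τ ∈ Icc 0 (τ + 1) := fun h => ⟨h, by linarith⟩
  have FF : ∀ τ : ℝ, 0 ≤ τ → Flow (τ + 1) ψ k k1 k2 k3 a μ := fun τ h => HF _ (by linarith)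
  have nh : ∀ τ : ℝ, 0 < τ → Icc 0 (τ + 1) ∈ 𝓝 τ := fun τ h => Icc_mem_nhds h (by linarith)
  have hex : ∀ τ : ℝ, ∃ v, 0 < τ → (v ≤ 15 * C ^ 4 ∧ HasDerivAt μ v τ) := by
    intro τ
    by_cases h : 0 < τ
    · obtain ⟨v, h1, h2⟩ := (FF τ h.le).μt (mem h.le) hC (fun σ => (hb τ h.le σ).2.1)
      exact ⟨v, fun _ => ⟨h1, h2.hasDerivAt (nh τ h)⟩⟩
    · exact ⟨0, fun h' => absurd h' h⟩
  choose μ' hμ' using hex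
  have hPlow : ∀ τ ≥ 0, m * π / 2 ≤ gP ψ τ π := by
    intro τ hτ
    have hc := (FF τ hτ).contp (mem hτ)
    have := intervalIntegral.integral_mono_on (a := 0) (b := π) (f := fun _ => m) (g := gp ψ τ) (μ := volume)
      hπ.le (by simp) (hc.intervalIntegrable _ _) (fun σ _ => (hb τ hτ σ).1.le)
    rw [intervalIntegral.integral_const, sub_zero, smul_eq_mul] at this
    unfold gP; linarith
  have hPup : ∀ τ ≥ 0, gP ψ τ π ≤ π * π / 4 := by
    intro τ hτ
    have hc := (FF τ hτ).contp (mem hτ)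
    have := intervalIntegral.integral_mono_on (a := 0) (b := π) (g := fun _ => π / 2) (f := gp ψ τ) (μ := volume)
      hπ.le (hc.intervalIntegrable _ _) (by simp) (fun σ _ => by
        have := gr_le ((FF τ hτ).contψ (mem hτ)) σ
        have h2 : gp ψ τ σ ^ 2 ≤ (π / 2) ^ 2 := by linarith [sq_nonneg (gq ψ τ σ)]
        exact le_of_abs_le (abs_le_of_sq_le_sq h2 (by positivity)))
    rw [intervalIntegral.integral_const, sub_zero, smul_eq_mul] at this
    unfold gP; linarith
  have hμ0 : Tendsto μ atTop (𝓝 0) := by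
    refine barbalat (h := fun τ => gP ψ τ π) (w := fun τ => 2 * μ τ * gP ψ τ π) (c := m * π)
      (C := 15 * C ^ 4) (B := π * π / 4) (by positivity) (by positivity) (μ' := μ') ?_ ?_ ?_ ?_ ?_ ?_
    · exact fun τ hτ => ((FF τ hτ.le).Ht τ (mem hτ.le)).hasDerivAt (nh τ hτ)
    · intro τ hτ
      have := (FF τ hτ.le).μ_nonneg (mem hτ.le)
      nlinarith [hPlow τ hτ.le]
    · exact fun τ hτ => (FF τ hτ.le).μ_nonneg (mem hτ.le)
    · exact fun τ hτ => (hμ' τ hτ).2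
    · exact fun τ hτ => (hμ' τ hτ).1
    · exact fun τ hτ => hPup τ hτ.le
  have hk : ∀ ε > 0, ∃ T0 ≥ 0, ∀ τ ≥ T0, ∀ σ, |k τ σ| < ε := by
    intro ε hε
    have : ∀ᶠ τ in atTop, 3 * C * π * μ τ < ε ^ 3 := by
      have h1 := hμ0.const_mul (3 * C * π)
      rw [mul_zero] at h1
      exact h1.eventually_lt_const (by positivity)
    obtain ⟨T0, hT0⟩ := eventually_atTop.1 this
    refine ⟨max T0 0, le_max_right _ _, fun τ hτ σ => ?_⟩
    have hτ0 : 0 ≤ τ := (le_max_right _ _).trans hτ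
    have h2 := (FF τ hτ0).k_cube (mem hτ0) (C := C) (fun σ => by
      have := (hb τ hτ0 σ).2.2
      exact abs_le_of_sq_le_sq (by nlinarith) (by linarith)) σ
    have h3 := hT0 τ ((le_max_left _ _).trans hτ)
    exact lt_of_pow_lt_pow_left₀ 3 hε.le (lt_of_le_of_lt h2 h3)
  refine ⟨fun ε hε => ?_, fun ε hε => ?_, ?_⟩
  · obtain ⟨T0, _, h⟩ := hk ε hε
    exact ⟨T0, h⟩
  · set δ := min 1 (ε / 5) with hδ
    have hδ0 : 0 < δ := by positivity
    obtain ⟨T0, h0, h⟩ := hk (δ / π) (by positivity)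
    refine ⟨T0, fun τ hτ σ => ?_⟩
    obtain ⟨h1, h2⟩ := (FF τ (h0.trans hτ)).pq_near (mem (h0.trans hτ)) (fun σ => (h τ hτ σ).le) σ
    have h3 : π * (δ / π) = δ := by field_simp
    rw [h3] at h1 h2
    rw [gx_sq]
    set p := gp ψ τ σ
    set q := gq ψ τ σ
    have hδ1 : δ ≤ 1 := min_le_left _ _
    have hδ5 : δ ≤ ε / 5 := min_le_right _ _
    set r := Real.sqrt (p ^ 2 + q ^ 2)
    have hr0 : 0 ≤ r := Real.sqrt_nonneg _
    have hr : r ^ 2 = p ^ 2 + q ^ 2 := Real.sq_sqrt (by positivity)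
    obtain ⟨a1, a2⟩ := abs_le.1 h1
    have h4 : q ^ 2 ≤ δ ^ 2 := sq_le_sq' (abs_le.1 h2).1 (abs_le.1 h2).2
    have h5 : q ^ 2 ≥ 0 := sq_nonneg _
    have h6 : r ^ 2 < (1 + ε) ^ 2 := by rw [hr]; nlinarith
    have h7 : p ≤ r := by
      apply Real.le_sqrt_of_sq_le; linarith
    rw [abs_lt]
    constructor
    · linarith
    · have := lt_of_pow_lt_pow_left₀ 2 (by positivity) h6
      linarith
  · rw [Metric.tendsto_atTop]
    intro ε hε
    obtain ⟨T0, h0, h⟩ := hk (ε / π ^ 2) (by positivity)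
    refine ⟨T0, fun τ hτ => ?_⟩
    have hc := (FF τ (h0.trans hτ)).contp (mem (h0.trans hτ))
    have h1 : |(∫ σ in (0:ℝ)..π, gp ψ τ σ) - ∫ σ in (0:ℝ)..π, (1:ℝ)| ≤ ε / π * π := by
      rw [← intervalIntegral.integral_sub (hc.intervalIntegrable _ _) (by simp)]
      have := intervalIntegral.norm_integral_le_of_norm_le_const (a := 0) (b := π) (C := ε / π)
        (f := fun σ => gp ψ τ σ - 1) (fun σ _ => by
          have := ((FF τ (h0.trans hτ)).pq_near (mem (h0.trans hτ)) (fun σ => (h τ hτ σ).le) σ).1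
          rw [Real.norm_eq_abs]
          convert this using 1
          field_simp)
      rwa [sub_zero, abs_of_pos hπ] at this
    rw [intervalIntegral.integral_const, sub_zero, smul_eq_mul, mul_one] at h1
    have h2 : ε / π * π = ε := by field_simp
    rw [h2] at h1
    rw [Real.dist_eq]
    unfold gP
    rw [show 1 / 2 * (∫ s in (0:ℝ)..π, gp ψ τ s) - π / 2 = 1 / 2 * ((∫ s in (0:ℝ)..π, gp ψ τ s) - π) by ring,
      abs_mul, abs_of_pos (by norm_num : (0:ℝ) < 1 / 2)]
    linarith

end GF

open scoped Topology ComplexConjugate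

namespace GF

/-- inverse of a diffeomorphism of the line -/
theorem exists_inv {f f' : ℝ → ℝ} {c : ℝ} (hc : 0 < c) (hf : ∀ x, HasDerivAt f (f' x) x)
    (hf' : ∀ x, c ≤ f' x) : ∃ g : ℝ → ℝ, (∀ x, g (f x) = x) ∧ (∀ y, f (g y) = y) ∧ StrictMono f ∧
      StrictMono g ∧ ∀ y, HasDerivAt g (f' (g y))⁻¹ y := by
  have hmono : StrictMono f := strictMono_of_deriv_pos fun x => by
    rw [(hf x).deriv]; exact hc.trans_le (hf' x)
  have hcont : Continuous f := continuous_iff_continuousAt.2 fun x => (hf x).continuousAt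
  have hlow : ∀ x y, x ≤ y → c * (y - x) ≤ f y - f x := by
    intro x y hxy
    exact Convex.mul_sub_le_image_sub_of_le_deriv convex_univ hcont.continuousOn
      (fun x _ => (hf x).differentiableAt.differentiableWithinAt)
      (fun x _ => by rw [(hf x).deriv]; exact hf' x) x (mem_univ _) y (mem_univ _) hxy
  have hsurj : Function.Surjective f := by
    apply hcont.surjective
    · refine tendsto_atTop_mono' atTop ?_ (tendsto_atTop_add_const_right _ (f 0)
        (Tendsto.const_mul_atTop hc tendsto_id))
      filter_upwards [eventually_ge_atTop 0] with x hx
      have := hlow 0 x hx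
      simp only [id]; linarith
    · refine tendsto_atBot_mono' atBot ?_ (tendsto_atBot_add_const_right _ (f 0)
        (Tendsto.const_mul_atBot hc tendsto_id))
      filter_upwards [eventually_le_atBot 0] with x hx
      have := hlow x 0 hx
      simp only [id]; linarith
  set e := hmono.orderIsoOfSurjective f hsurj
  have h1 : ∀ x, e.symm (f x) = x := fun x => e.symm_apply_apply x
  have h2 : ∀ y, f (e.symm y) = y := fun y => e.apply_symm_apply y
  refine ⟨e.symm, h1, h2, hmono, e.symm.strictMono, fun y => ?_⟩
  exact HasDerivAt.of_local_left_inverse e.symm.continuous.continuousAt (hf _)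
    (hc.trans_le (hf' _)).ne' (Filter.Eventually.of_forall h2)

theorem contDiffOn_strip_infty {F : Type*} [NormedAddCommGroup F] [NormedSpace ℝ F]
    {f : ℝ × ℝ → F} (h : ∀ T, 0 < T → ∀ n : ℕ, ContDiffOn ℝ n f (Icc 0 T ×ˢ univ)) :
    ContDiffOn ℝ (⊤ : ℕ∞) f (Ici 0 ×ˢ univ) := by
  rw [contDiffOn_infty]
  intro n q hq
  have hq1 : (0:ℝ) ≤ q.1 := hq.1
  have h1 := h (q.1 + 1) (by linarith) n q ⟨⟨hq1, by linarith⟩, mem_univ _⟩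
  refine h1.mono_of_mem_nhdsWithin ?_
  have : Iio (q.1 + 1) ×ˢ (univ : Set ℝ) ∈ 𝓝 q :=
    prod_mem_nhds (Iio_mem_nhds (by linarith)) univ_mem
  filter_upwards [mem_nhdsWithin_of_mem_nhds this, self_mem_nhdsWithin] with p hp hp2
  exact ⟨⟨hp2.1, (show p.1 < _ from hp.1).le⟩, mem_univ _⟩

theorem fr_contDiffOn {T : ℝ} (hT : 0 < T) {f : ℤ → ℝ → ℂ} {n : ℕ} (h : SM T n f) :
    ContDiffOn ℝ n (fun q : ℝ × ℝ => fr f q.1 q.2) (Icc 0 T ×ˢ univ) :=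
  Complex.reCLM.contDiff.comp_contDiffOn (h.contDiffOn hT)

theorem fmu_contDiffOn {T : ℝ} (hT : 0 < T) {d : ℤ → ℝ → ℂ} {n : ℕ} (h : SM T n d) :
    ContDiffOn ℝ n (fun q : ℝ × ℝ => fmu d q.1) (Icc 0 T ×ˢ univ) := by
  have h1 : SM T n (fun m τ => (if m = 0 then (1:ℂ) else 0) * cnv (ds d) (ds d) m τ) :=
    SM.mult (C := 1) (s := 0) (fun m => by split_ifs <;> simp) (SM.cnv hT.le h.ds h.ds)
  refine (fr_contDiffOn hT h1).congr (fun q _ => ?_)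
  unfold fr fmu ev
  rw [tsum_eq_single 0]
  · simp [em_zero]
  · intro m hm; simp [hm]

section
variable {T : ℝ} {d : ℤ → ℝ → ℂ}

theorem gx_contDiffOn (hT : 0 < T) (hs : ∀ j, SM T j d)
    (F : Flow T (fr d) (fr (ds d)) (fr (ds (ds d))) (fr (ds (ds (ds d)))) (fr (ds (ds (ds (ds d)))))
      (fr (As d)) (fmu d)) (c : ℝ) (n : ℕ) :
    ContDiffOn ℝ n (fun q : ℝ × ℝ => gx (fr d) c q.1 q.2) (Icc 0 T ×ˢ univ) := by
  induction n with
  | zero => rw [Nat.cast_zero, contDiffOn_zero]; exact F.cx c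
  | succ n ih =>
    have hψ := fr_contDiffOn hT (hs n)
    have hk := fr_contDiffOn hT (hs n).ds
    have ha := fr_contDiffOn hT ((hs n).As hT.le)
    have hμ := fmu_contDiffOn hT (hs n)
    have hA : ContDiffOn ℝ n (fun q : ℝ × ℝ => q.2 + fr d q.1 q.2 + c) (Icc 0 T ×ˢ univ) :=
      (contDiffOn_snd.add hψ).add contDiffOn_const
    have hcos := hA.cos
    have hsin := hA.sin
    exact contDiffOn_succ_of_partials hT (F.xt c) (F.xs c)
      (((hk.mul hsin).neg.add (ha.mul hcos)).add (hμ.mul ih)) hcos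

theorem gP_contDiffOn (hT : 0 < T) (hs : ∀ j, SM T j d)
    (F : Flow T (fr d) (fr (ds d)) (fr (ds (ds d))) (fr (ds (ds (ds d)))) (fr (ds (ds (ds (ds d)))))
      (fr (As d)) (fmu d)) (n : ℕ) :
    ContDiffOn ℝ n (fun q : ℝ × ℝ => gP (fr d) q.1 π) (Icc 0 T ×ˢ univ) := by
  induction n with
  | zero =>
    rw [Nat.cast_zero, contDiffOn_zero]
    exact ContinuousOn.comp (g := fun τ => gP (fr d) τ π) (t := Icc 0 T)
      (fun τ hτ => (F.Ht τ hτ).continuousWithinAt) continuousOn_fst (fun q hq => hq.1)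
  | succ n ih =>
    have hμ := fmu_contDiffOn hT (hs n)
    exact contDiffOn_succ_of_partials hT (f := fun τ _ => gP (fr d) τ π) (g₂ := fun _ _ => 0)
      (fun τ hτ σ => F.Ht τ hτ) (fun τ hτ σ => hasDerivAt_const _ _)
      ((contDiffOn_const.mul hμ).mul ih) contDiffOn_const
end

/-- smoothness of solutions of autonomous scalar equations on the half line -/
theorem ode_smooth {u g : ℝ → ℝ} (hu : ∀ t ≥ 0, HasDerivWithinAt u (g (u t)) (Ici 0) t)
    (hm : ∀ t ≥ 0, 0 ≤ u t) (hg : ∀ n : ℕ, ContDiffOn ℝ n g (Ici 0)) (n : ℕ) :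
    ContDiffOn ℝ n u (Ici 0) := by
  induction n with
  | zero =>
    rw [Nat.cast_zero, contDiffOn_zero]
    exact fun t ht => (hu t ht).continuousWithinAt
  | succ n ih =>
    rw [show ((n + 1 : ℕ) : WithTop ℕ∞) = (n : WithTop ℕ∞) + 1 by norm_cast,
      contDiffOn_succ_iff_derivWithin (uniqueDiffOn_Ici 0)]
    refine ⟨fun t ht => (hu t ht).differentiableWithinAt, by simp, ?_⟩
    have : ContDiffOn ℝ n (g ∘ u) (Ici 0) := (hg n).comp ih (fun t ht => hm t ht)
    exact this.congr fun t ht => (hu t ht).derivWithin (uniqueDiffOn_Ici 0 t ht)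

end GF

open scoped Topology ComplexConjugate

namespace GF

theorem sqrt_deriv_aux {H : ℝ → ℝ} {A μ τ : ℝ} {s : Set ℝ} (hA : 0 < A) (hH : 0 < H τ)
    (h : HasDerivWithinAt H (2 * μ * H τ) s τ) :
    HasDerivWithinAt (fun r => √(A / (2 * H r))) (-μ * √(A / (2 * H τ))) s τ := by
  have hu : 0 < A / (2 * H τ) := by positivity
  have h1 : HasDerivWithinAt (fun r => A / (2 * H r)) (-2 * μ * (A / (2 * H τ))) s τ := by
    have := (HasDerivWithinAt.const_mul 2 h).inv (by positivity)
    refine (this.const_mul A).congr_deriv ?_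
    field_simp
  refine (h1.sqrt hu.ne').congr_deriv ?_
  have h2 : √(A / (2 * H τ)) * √(A / (2 * H τ)) = A / (2 * H τ) := Real.mul_self_sqrt hu.le
  have h3 : 0 < √(A / (2 * H τ)) := Real.sqrt_pos.2 hu
  rw [div_eq_iff (by positivity)]
  linear_combination (-2 * μ) * (-h2)

theorem core_flow (d0 : ℤ → ℂ) (hcs : ∀ n, d0 (-n) = conj (d0 n))
    (hi : ∀ m, Summable (fun n => wt n ^ m * ‖d0 n‖)) {b : ℝ} (hb : 0 < b)
    (hp : ∀ σ, b ≤ gp (fr (fun n _ => d0 n)) 0 σ) {ℓ0 A0 : ℝ} (hℓ0 : 0 < ℓ0)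
    (hA : A0 = ℓ0 ^ 2 * (2 * gP (fr (fun n _ => d0 n)) 0 π)) :
    ∃ (Y : ℝ → ℝ → ℝ × ℝ) (ℓ : ℝ → ℝ) (Ang κ a : ℝ → ℝ → ℝ), 0 < A0 ∧
      (∀ σ, Y 0 σ = ℓ0 • (gx (fr (fun n _ => d0 n)) 0 0 σ, gx (fr (fun n _ => d0 n)) (-(π/2)) 0 σ)) ∧
      ContDiffOn ℝ (⊤ : ℕ∞) (fun q : ℝ × ℝ => Y q.1 q.2) (Ici 0 ×ˢ univ) ∧
      (∀ t ≥ 0, 0 < ℓ t) ∧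
      (∀ t ≥ 0, ∀ σ, HasDerivAt (Y t) (ℓ t • (Real.cos (Ang t σ), Real.sin (Ang t σ))) σ) ∧
      (∀ t ≥ 0, ∀ σ, HasDerivAt (Ang t) (κ t σ) σ) ∧
      (∀ t ≥ 0, ∀ σ, Y t (σ + π) = - Y t σ) ∧
      (∀ t ≥ 0, ∀ σ, HasDerivWithinAt (fun s => Y s σ) ((1 / ℓ t) •
        ((κ t σ - 1) • (-Real.sin (Ang t σ), Real.cos (Ang t σ))
          + a t σ • (Real.cos (Ang t σ), Real.sin (Ang t σ)))) (Ici 0) t) ∧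
      (∀ ε > 0, ∃ T, ∀ t > T, ∀ σ, |κ t σ - 1| < ε) ∧
      (∀ ε > 0, ∃ T, ∀ t > T, ∀ σ, |vnorm (Y t σ) - √(A0 / π)| < ε) ∧
      Tendsto ℓ atTop (𝓝 √(A0 / π)) := by
  have hπ := Real.pi_pos
  obtain ⟨d, hd0, hsol, m, hm, C, hC, hbd⟩ := global_exists d0 hcs hi hb hp
  have hi' : ∀ m, Summable (fun n => wt n ^ m * ‖d n 0‖) := by
    intro m; simpa only [hd0] using hi m
  have HF : ∀ T, 0 < T → Flow T (fr d) (fr (ds d)) (fr (ds (ds d))) (fr (ds (ds (ds d))))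
      (fr (ds (ds (ds (ds d))))) (fr (As d)) (fmu d) := fun T hT => (hsol T hT).flow hT hi'
  have hSM : ∀ T, 0 < T → ∀ j, SM T j d := fun T hT j => (hsol T hT).sm hT.le hi' j
  obtain ⟨hk0, hr1, hH1⟩ := flow_conv HF hm hC hbd
  have hfr0 : ∀ σ, fr d 0 σ = fr (fun n _ => d0 n) 0 σ := by
    intro σ; unfold fr ev; simp only [hd0]
  have hgx0 : ∀ c σ, gx (fr d) c 0 σ = gx (fr (fun n _ => d0 n)) c 0 σ := by
    intro c σ; unfold gx; simp only [hfr0]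
  have hgP0 : gP (fr d) 0 π = gP (fr (fun n _ => d0 n)) 0 π := by
    unfold gP gp; simp only [hfr0, hgx0]
  rw [← hgP0] at hA
  simp only [← hgx0]
  have mem : ∀ {τ : ℝ}, 0 ≤ τ → τ ∈ Icc 0 (τ + 1) := fun h => ⟨h, by linarith⟩
  have FF := fun (τ : ℝ) (h : 0 ≤ τ) => HF (τ + 1) (by linarith)
  have nh : ∀ τ : ℝ, 0 ≤ τ → Icc 0 (τ + 1) ∈ 𝓝[Ici 0] τ := by
    intro τ h
    filter_upwards [self_mem_nhdsWithin, mem_nhdsWithin_of_mem_nhds (Iio_mem_nhds (lt_add_one τ))]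
      with x hx hx2
    exact ⟨hx, le_of_lt hx2⟩
  set H : ℝ → ℝ := fun τ => gP (fr d) τ π with hHdef
  have hPlow : ∀ τ ≥ 0, m * π / 2 ≤ H τ := by
    intro τ hτ
    have hc := (FF τ hτ).contp (mem hτ)
    have := intervalIntegral.integral_mono_on (a := 0) (b := π) (f := fun _ => m) (g := gp (fr d) τ)
      (μ := volume)
      hπ.le (by simp) (hc.intervalIntegrable _ _) (fun σ _ => (hbd τ hτ σ).1.le)
    rw [intervalIntegral.integral_const, sub_zero, smul_eq_mul] at this
    simp only [hHdef, gP]; linarith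
  have hPup : ∀ τ ≥ 0, H τ ≤ π * π / 4 := by
    intro τ hτ
    have hc := (FF τ hτ).contp (mem hτ)
    have := intervalIntegral.integral_mono_on (a := 0) (b := π) (g := fun _ => π / 2)
      (f := gp (fr d) τ) (μ := volume)
      hπ.le (hc.intervalIntegrable _ _) (by simp) (fun σ _ => by
        have := gr_le ((FF τ hτ).contψ (mem hτ)) σ
        have h2 : gp (fr d) τ σ ^ 2 ≤ (π / 2) ^ 2 := by linarith [sq_nonneg (gq (fr d) τ σ)]
        exact le_of_abs_le (abs_le_of_sq_le_sq h2 (by positivity)))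
    rw [intervalIntegral.integral_const, sub_zero, smul_eq_mul] at this
    simp only [hHdef, gP]; linarith
  have hHpos : ∀ τ ≥ 0, 0 < H τ := fun τ hτ => lt_of_lt_of_le (by positivity) (hPlow τ hτ)
  have hA0 : 0 < A0 := by
    rw [hA]; have : 0 < gP (fr d) 0 π := hHpos 0 le_rfl
    positivity
  have hHt : ∀ τ ≥ 0, HasDerivWithinAt H (2 * fmu d τ * H τ) (Ici 0) τ := fun τ hτ =>
    ((FF τ hτ).Ht τ (mem hτ)).mono_of_mem_nhdsWithin (nh τ hτ)
  have hHsm2 : ContDiffOn ℝ (⊤ : ℕ∞) (fun q : ℝ × ℝ => H q.1) (Ici 0 ×ˢ univ) :=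
    contDiffOn_strip_infty fun T hT n => gP_contDiffOn hT (hSM T hT) (HF T hT) n
  have hHsm : ContDiffOn ℝ (⊤ : ℕ∞) H (Ici 0) :=
    hHsm2.comp (g := fun q : ℝ × ℝ => H q.1) (f := fun τ : ℝ => (τ, (0:ℝ)))
      (by fun_prop) (fun τ hτ => ⟨hτ, mem_univ _⟩)
  have hxsm : ∀ c, ContDiffOn ℝ (⊤ : ℕ∞) (fun q : ℝ × ℝ => gx (fr d) c q.1 q.2) (Ici 0 ×ˢ univ) :=
    fun c => contDiffOn_strip_infty fun T hT n => gx_contDiffOn hT (hSM T hT) (HF T hT) c n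
  -- time change
  set e : ℝ → ℝ := fun s => A0 / (2 * H (max s 0)) with he
  have hemax : ∀ s, 0 < H (max s 0) := fun s => hHpos _ (le_max_right _ _)
  have hec : Continuous e := by
    have : Continuous (fun s => H (max s 0)) :=
      hHsm.continuousOn.comp_continuous (by fun_prop) (fun s => mem_Ici.2 (le_max_right _ _))
    exact continuous_const.div (continuous_const.mul this) (fun s => by have := hemax s; positivity)
  have hel : ∀ s, A0 / (2 * (π * π / 4)) ≤ e s := fun s => by
    have h1 := hemax s
    have h2 := hPup _ (le_max_right s 0)
    simp only [he]
    gcongr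
  obtain ⟨g, hg1, hg2, hfm, hgm, hgd⟩ := exists_inv (f := fun τ => ∫ s in (0:ℝ)..τ, e s) (f' := e)
    (c := A0 / (2 * (π * π / 4))) (by positivity)
    (fun τ => intervalIntegral.integral_hasDerivAt_right (hec.intervalIntegrable _ _)
      (hec.stronglyMeasurableAtFilter _ _) hec.continuousAt) hel
  have hg0 : g 0 = 0 := by
    have := hg1 0; simpa using this
  have hgn : ∀ t ≥ 0, 0 ≤ g t := fun t ht => by rw [← hg0]; exact hgm.monotone ht
  have hgd' : ∀ t ≥ 0, HasDerivWithinAt g (2 / A0 * H (g t)) (Ici 0) t := fun t ht => by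
    refine (hgd t).hasDerivWithinAt.congr_deriv ?_
    simp only [he]
    rw [max_eq_left (hgn t ht), inv_div]; ring
  have hgsm : ContDiffOn ℝ (⊤ : ℕ∞) g (Ici 0) := by
    rw [contDiffOn_infty]
    intro n
    exact ode_smooth (g := fun τ => 2 / A0 * H τ) hgd' hgn (fun n =>
      contDiffOn_const.mul (contDiffOn_infty.1 hHsm n)) n
  have hginf : Tendsto g atTop atTop := by
    refine tendsto_atTop.2 fun M => ?_
    filter_upwards [eventually_ge_atTop (∫ s in (0:ℝ)..M, e s)] with t ht
    have := hgm.monotone ht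
    rwa [hg1] at this
  set l : ℝ → ℝ := fun τ => √(A0 / (2 * H τ)) with hl
  have hlpos : ∀ τ ≥ 0, 0 < l τ := fun τ hτ => Real.sqrt_pos.2 (by have := hHpos τ hτ; positivity)
  have hlsq : ∀ τ ≥ 0, l τ ^ 2 = A0 / (2 * H τ) := fun τ hτ =>
    Real.sq_sqrt (by have := hHpos τ hτ; positivity)
  have hlt : ∀ τ ≥ 0, HasDerivWithinAt l (-fmu d τ * l τ) (Ici 0) τ := fun τ hτ =>
    sqrt_deriv_aux hA0 (hHpos τ hτ) (hHt τ hτ)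
  have hlsm : ContDiffOn ℝ (⊤ : ℕ∞) (fun q : ℝ × ℝ => l q.1) (Ici 0 ×ˢ univ) := by
    refine ContDiffOn.sqrt (contDiffOn_const.div (contDiffOn_const.mul hHsm2) ?_) ?_
    · intro q hq; have := hHpos q.1 hq.1; positivity
    · intro q hq; have := hHpos q.1 hq.1; positivity
  have hl0 : l 0 = ℓ0 := by
    have : A0 / (2 * H 0) = ℓ0 ^ 2 := by
      have := hHpos 0 le_rfl
      rw [div_eq_iff (by positivity), hA]
    simp only [hl, this]; exact Real.sqrt_sq hℓ0.le
  have hcoss : ∀ x, Real.cos (x + -(π/2)) = Real.sin x := fun x => by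
    rw [← sub_eq_add_neg, Real.cos_sub_pi_div_two]
  have hsinn : ∀ x, Real.sin (x + -(π/2)) = -Real.cos x := fun x => by
    rw [← sub_eq_add_neg, Real.sin_sub_pi_div_two]
  have hlconv : Tendsto (fun t => l (g t)) atTop (𝓝 √(A0 / π)) := by
    have h1 : Tendsto (fun τ => √(A0 / (2 * H τ))) atTop (𝓝 √(A0 / (2 * (π / 2)))) :=
      ((tendsto_const_nhds (x := A0)).div (hH1.const_mul 2) (by positivity)).sqrt
    rw [mul_div_cancel₀ _ (two_ne_zero)] at h1
    exact h1.comp hginf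
  refine ⟨fun t σ => l (g t) • (gx (fr d) 0 (g t) σ, gx (fr d) (-(π/2)) (g t) σ), fun t => l (g t),
    fun t σ => σ + fr d (g t) σ, fun t σ => 1 + fr (ds d) (g t) σ, fun t σ => fr (As d) (g t) σ,
    hA0, ?_, ?_, fun t ht => hlpos _ (hgn t ht), ?_, ?_, ?_, ?_, ?_, ?_, hlconv⟩
  · intro σ
    simp only [hg0, hl0]
  · have h1 : ContDiffOn ℝ (⊤ : ℕ∞) (fun q : ℝ × ℝ => l q.1 •
      (gx (fr d) 0 q.1 q.2, gx (fr d) (-(π/2)) q.1 q.2)) (Ici 0 ×ˢ univ) :=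
      hlsm.smul ((hxsm 0).prodMk (hxsm _))
    refine h1.comp (f := fun q : ℝ × ℝ => (g q.1, q.2)) ?_ (fun q hq => ⟨hgn _ hq.1, mem_univ _⟩)
    exact (hgsm.comp contDiffOn_fst (fun q hq => hq.1)).prodMk contDiffOn_snd
  · intro t ht σ
    have h1 := (FF _ (hgn t ht)).xs 0 _ (mem (hgn t ht)) σ
    have h2 := (FF _ (hgn t ht)).xs (-(π/2)) _ (mem (hgn t ht)) σ
    rw [add_zero] at h1
    rw [hcoss] at h2
    exact (h1.prodMk h2).const_smul (l (g t))
  · intro t ht σ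
    exact (hasDerivAt_id σ).add ((FF _ (hgn t ht)).ψs _ (mem (hgn t ht)) σ)
  · intro t ht σ
    simp only
    rw [gx_anti ((FF _ (hgn t ht)).pψ _), gx_anti ((FF _ (hgn t ht)).pψ _), ← smul_neg]
    rfl
  · intro t ht σ
    have hgt := hgn t ht
    have h1 := ((FF _ hgt).xt 0 _ (mem hgt) σ).mono_of_mem_nhdsWithin (nh _ hgt)
    have h2 := ((FF _ hgt).xt (-(π/2)) _ (mem hgt) σ).mono_of_mem_nhdsWithin (nh _ hgt)
    have h3 := (hlt _ hgt).smul (h1.prodMk h2)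
    have h4 := h3.scomp t (hgd' t ht) (fun s hs => hgn s hs)
    refine h4.congr_deriv ?_
    have h5 : 2 / A0 * H (g t) = 1 / l (g t) ^ 2 := by
      have := hHpos _ hgt
      rw [hlsq _ hgt]; field_simp
    have h6 := hlpos _ hgt
    rw [h5]
    simp only [hcoss, hsinn, add_zero]
    ext
    · simp only [Prod.smul_mk, Prod.mk_add_mk, smul_eq_mul]
      field_simp
      ring
    · simp only [Prod.smul_mk, Prod.mk_add_mk, smul_eq_mul]
      field_simp
      ring
  · intro ε hε
    obtain ⟨T0, h⟩ := hk0 ε hε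
    obtain ⟨T, hT⟩ := eventually_atTop.1 (hginf.eventually_ge_atTop T0)
    refine ⟨T, fun t ht σ => ?_⟩
    simpa using h _ (hT t (le_of_lt ht)) σ
  · intro ε hε
    set R := √(A0 / π)
    have hR : 0 < R := Real.sqrt_pos.2 (by positivity)
    obtain ⟨T0, h⟩ := hr1 (ε / (2 * (R + 1))) (by positivity)
    obtain ⟨T, hT⟩ := eventually_atTop.1 (hginf.eventually_ge_atTop T0)
    obtain ⟨T', hT'⟩ := Metric.tendsto_atTop.1 hlconv (min 1 (ε / 2)) (by positivity)
    refine ⟨max (max T T') 0, fun t ht σ => ?_⟩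
    have ht0 : 0 ≤ t := (le_max_right _ _).trans ht.le
    have h1 := h _ (hT t (((le_max_left _ _).trans (le_max_left _ _)).trans ht.le)) σ
    have h2 := hT' t (((le_max_right _ _).trans (le_max_left _ _)).trans ht.le)
    rw [Real.dist_eq] at h2
    have hlp := hlpos _ (hgn t ht0)
    have hv : vnorm (l (g t) • (gx (fr d) 0 (g t) σ, gx (fr d) (-(π/2)) (g t) σ))
        = l (g t) * √(gx (fr d) 0 (g t) σ ^ 2 + gx (fr d) (-(π/2)) (g t) σ ^ 2) := by
      unfold vnorm
      simp only [Prod.smul_mk, smul_eq_mul]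
      rw [show (l (g t) * gx (fr d) 0 (g t) σ) ^ 2 + (l (g t) * gx (fr d) (-(π/2)) (g t) σ) ^ 2
        = l (g t) ^ 2 * (gx (fr d) 0 (g t) σ ^ 2 + gx (fr d) (-(π/2)) (g t) σ ^ 2) by ring,
        Real.sqrt_mul (sq_nonneg _), Real.sqrt_sq hlp.le]
    simp only [hv]
    set r := √(gx (fr d) 0 (g t) σ ^ 2 + gx (fr d) (-(π/2)) (g t) σ ^ 2)
    have h3 : |l (g t) - R| < 1 := h2.trans_le (min_le_left _ _)
    have h4 : |l (g t) - R| < ε / 2 := h2.trans_le (min_le_right _ _)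
    have h5 : l (g t) < R + 1 := by linarith [(abs_lt.1 h3).2]
    have h6 : |l (g t) * (r - 1)| < ε / 2 := by
      rw [abs_mul, abs_of_pos hlp]
      calc l (g t) * |r - 1| ≤ (R + 1) * |r - 1| := by gcongr
        _ < (R + 1) * (ε / (2 * (R + 1))) := by gcongr
        _ = ε / 2 := by field_simp
    calc |l (g t) * r - R| = |l (g t) * (r - 1) + (l (g t) - R)| := by ring_nf
      _ ≤ _ := abs_add_le _ _
      _ < ε := by linarith

end GF

open scoped Topology ComplexConjugate

namespace GF

theorem vnorm_smul_cs {r : ℝ} (hr : 0 ≤ r) (A : ℝ) : vnorm (r • (Real.cos A, Real.sin A)) = r := by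
  unfold vnorm
  simp only [Prod.smul_mk, smul_eq_mul]
  rw [show (r * Real.cos A) ^ 2 + (r * Real.sin A) ^ 2 = r ^ 2 by
    linear_combination r ^ 2 * Real.sin_sq_add_cos_sq A]
  exact Real.sqrt_sq hr

theorem curve_data {Y : ℝ → ℝ × ℝ} {ℓ : ℝ} {Ang κ σ0 σ1 σ2 : ℝ → ℝ} (hℓ : 0 < ℓ)
    (hY : ∀ σ, HasDerivAt Y (ℓ • (Real.cos (Ang σ), Real.sin (Ang σ))) σ)
    (hA : ∀ σ, HasDerivAt Ang (κ σ) σ)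
    (h1 : ∀ φ, HasDerivAt σ0 (σ1 φ) φ) (h2 : ∀ φ, HasDerivAt σ1 (σ2 φ) φ) (hpos : ∀ φ, 0 < σ1 φ)
    (hper : ∀ φ, σ0 (φ + 2 * π) = σ0 φ + 2 * π) :
    (∀ φ, deriv (fun φ => Y (σ0 φ)) φ = (σ1 φ * ℓ) • (Real.cos (Ang (σ0 φ)), Real.sin (Ang (σ0 φ)))) ∧
    (∀ φ, vnorm (deriv (fun φ => Y (σ0 φ)) φ) = σ1 φ * ℓ) ∧
    (∀ φ, unitTangent (fun φ => Y (σ0 φ)) φ = (Real.cos (Ang (σ0 φ)), Real.sin (Ang (σ0 φ)))) ∧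
    (∀ φ, innerNormal (fun φ => Y (σ0 φ)) φ = (-Real.sin (Ang (σ0 φ)), Real.cos (Ang (σ0 φ)))) ∧
    (∀ φ, curv (fun φ => Y (σ0 φ)) φ = κ (σ0 φ) / ℓ) ∧
    clen (fun φ => Y (σ0 φ)) = 2 * π * ℓ := by
  have hd : ∀ φ, deriv (fun φ => Y (σ0 φ)) φ
      = (σ1 φ * ℓ) • (Real.cos (Ang (σ0 φ)), Real.sin (Ang (σ0 φ))) := by
    intro φ
    have := ((hY (σ0 φ)).scomp φ (h1 φ)).deriv
    rw [smul_smul] at this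
    exact this
  have hp : ∀ φ, 0 < σ1 φ * ℓ := fun φ => mul_pos (hpos φ) hℓ
  have hv : ∀ φ, vnorm (deriv (fun φ => Y (σ0 φ)) φ) = σ1 φ * ℓ := by
    intro φ; rw [hd, vnorm_smul_cs (hp φ).le]
  have hT : ∀ φ, unitTangent (fun φ => Y (σ0 φ)) φ
      = (Real.cos (Ang (σ0 φ)), Real.sin (Ang (σ0 φ))) := by
    intro φ
    unfold unitTangent
    rw [hv, hd, smul_smul, inv_mul_cancel₀ (hp φ).ne', one_smul]
  refine ⟨hd, hv, hT, fun φ => by unfold innerNormal; rw [hT], fun φ => ?_, ?_⟩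
  · unfold curv
    rw [hv]
    have hA' := (hA (σ0 φ)).comp φ (h1 φ)
    have hdd := (((h2 φ).mul_const ℓ).smul (hA'.cos.prodMk hA'.sin)).deriv
    have hdd2 : deriv (deriv (fun φ => Y (σ0 φ))) φ = deriv ((fun φ => σ1 φ * ℓ) •
        fun x => (Real.cos ((Ang ∘ σ0) x), Real.sin ((Ang ∘ σ0) x))) φ := by
      rw [funext hd]; rfl
    rw [hdd2, hdd, hd]
    unfold vdet
    simp only [Prod.smul_mk, Prod.mk_add_mk, smul_eq_mul, Function.comp]
    have := hp φ
    rw [div_eq_div_iff (by positivity) hℓ.ne']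
    linear_combination (σ1 φ ^ 3 * ℓ ^ 3 * κ (σ0 φ)) * Real.sin_sq_add_cos_sq (Ang (σ0 φ))
  · unfold clen
    simp only [hv]
    rw [intervalIntegral.integral_mul_const]
    have hc : Continuous σ1 := continuous_iff_continuousAt.2 fun φ => (h2 φ).continuousAt
    rw [intervalIntegral.integral_eq_sub_of_hasDerivAt (fun φ _ => h1 φ) (hc.intervalIntegrable _ _)]
    have := hper 0
    rw [zero_add] at this
    rw [this]; ring

theorem main_assembly {X₀ : ℝ → ℝ × ℝ} {A₀ : ℝ}
    (d0 : ℤ → ℂ) (hcs : ∀ n, d0 (-n) = conj (d0 n))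
    (hi : ∀ m, Summable (fun n => wt n ^ m * ‖d0 n‖)) {b : ℝ} (hb : 0 < b)
    (hp : ∀ σ, b ≤ gp (fr (fun n _ => d0 n)) 0 σ) {ℓ0 : ℝ} (hℓ0 : 0 < ℓ0)
    (hA : A₀ = ℓ0 ^ 2 * (2 * gP (fr (fun n _ => d0 n)) 0 π)) {σ0 σ1 : ℝ → ℝ}
    (h0 : ContDiff ℝ (⊤ : ℕ∞) σ0)
    (h1 : ∀ φ, HasDerivAt σ0 (σ1 φ) φ) (hpos : ∀ φ, 0 < σ1 φ)
    (hper : ∀ φ, σ0 (φ + 2 * π) = σ0 φ + 2 * π)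
    (hX : ∀ φ, X₀ φ = ℓ0 • (gx (fr (fun n _ => d0 n)) 0 0 (σ0 φ),
      gx (fr (fun n _ => d0 n)) (-(π/2)) 0 (σ0 φ))) :
    ∃ X : ℝ → ℝ → ℝ × ℝ,
      IsGAPFSolutionOn X X₀ (Set.Ici 0) ∧
      (∃ T₀ : ℝ, ∀ t > T₀, ∀ φ, 0 < curv (X t) φ) ∧
      (∃ c : ℝ × ℝ, ∀ ε > 0, ∃ T : ℝ, ∀ t > T, ∀ φ,
        |vnorm (X t φ - c) - Real.sqrt (A₀ / π)| < ε) ∧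
      (∀ ε > 0, ∃ T : ℝ, ∀ t > T, ∀ φ,
        |curv (X t) φ - Real.sqrt (π / A₀)| < ε) := by
  have hπ := Real.pi_pos
  obtain ⟨Y, ℓ, Ang, κ, a, hA0, hY0, hYs, hℓ, hYσ, hAσ, hanti, hYt, hκ, hr, hℓc⟩ :=
    core_flow d0 hcs hi hb hp hℓ0 hA
  have h2 : ∀ φ, HasDerivAt σ1 (deriv σ1 φ) φ := by
    have e : σ1 = deriv σ0 := funext fun φ => (h1 φ).deriv.symm
    have : ContDiff ℝ (⊤ : ℕ∞) (deriv σ0) := (contDiff_infty_iff_deriv.1 h0).2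
    rw [e]
    exact fun φ => (this.differentiable (by simp) φ).hasDerivAt
  have D := fun t (ht : t ≥ 0) => curve_data (hℓ t ht) (hYσ t ht) (hAσ t ht) h1 h2 hpos hper
  have hXs : ContDiffOn ℝ (⊤ : ℕ∞) (fun q : ℝ × ℝ => Y q.1 (σ0 q.2)) (Ici 0 ×ˢ univ) :=
    hYs.comp (f := fun q : ℝ × ℝ => (q.1, σ0 q.2))
      (contDiff_fst.prodMk (h0.comp contDiff_snd)).contDiffOn (fun q hq => ⟨hq.1, mem_univ _⟩)
  have hκ2 : ∀ ε > 0, ∃ T ≥ 0, ∀ t > T, ∀ φ, |κ t φ / ℓ t - Real.sqrt (π / A₀)| < ε := by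
    intro ε hε
    have hR : 0 < √(A₀ / π) := Real.sqrt_pos.2 (by positivity)
    have hRi : Real.sqrt (π / A₀) = (√(A₀ / π))⁻¹ := by
      rw [← Real.sqrt_inv, inv_div]
    rw [hRi]
    have hinv := hℓc.inv₀ hR.ne'
    set R := √(A₀ / π)
    obtain ⟨T1, hT1⟩ := Metric.tendsto_atTop.1 hinv (min 1 (ε / 2)) (by positivity)
    obtain ⟨T2, hT2⟩ := hκ (ε / (2 * (R⁻¹ + 1))) (by positivity)
    refine ⟨max (max T1 T2) 0, le_max_right _ _, fun t ht φ => ?_⟩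
    have ht0 : 0 ≤ t := (le_max_right _ _).trans ht.le
    have e1 := hT1 t (((le_max_left _ _).trans (le_max_left _ _)).trans ht.le)
    have e2 := hT2 t (lt_of_le_of_lt ((le_max_right _ _).trans (le_max_left _ _)) ht) φ
    rw [Real.dist_eq] at e1
    have hlp := inv_pos.2 (hℓ t ht0)
    have h3 : |(ℓ t)⁻¹ - R⁻¹| < 1 := e1.trans_le (min_le_left _ _)
    have h4 : |(ℓ t)⁻¹ - R⁻¹| < ε / 2 := e1.trans_le (min_le_right _ _)
    have h5 : (ℓ t)⁻¹ < R⁻¹ + 1 := by linarith [(abs_lt.1 h3).2]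
    have h6 : |(ℓ t)⁻¹ * (κ t φ - 1)| < ε / 2 := by
      rw [abs_mul, abs_of_pos hlp]
      calc (ℓ t)⁻¹ * |κ t φ - 1| ≤ (R⁻¹ + 1) * |κ t φ - 1| := by gcongr
        _ < (R⁻¹ + 1) * (ε / (2 * (R⁻¹ + 1))) := by gcongr
        _ = ε / 2 := by field_simp
    calc |κ t φ / ℓ t - R⁻¹| = |(ℓ t)⁻¹ * (κ t φ - 1) + ((ℓ t)⁻¹ - R⁻¹)| := by
          rw [div_eq_mul_inv]; ring_nf
      _ ≤ _ := abs_add_le _ _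
      _ < ε := by linarith
  refine ⟨fun t φ => Y t (σ0 φ), ⟨?_, ?_, hXs, ?_⟩, ?_, ?_, ?_⟩
  · intro φ; rw [hX, hY0]
  · intro t ht
    refine ⟨?_, ?_, ?_⟩
    · rw [← contDiffOn_univ]
      exact hXs.comp (f := fun φ : ℝ => (t, φ)) (by fun_prop) (fun φ _ => ⟨ht, mem_univ _⟩)
    · intro φ
      simp only [hper]
      rw [two_mul, ← add_assoc, hanti t ht, hanti t ht, neg_neg]
    · intro φ h
      have := (D t ht).2.1 φ
      rw [h] at this
      have h3 := mul_pos (hpos φ) (hℓ t ht)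
      rw [← this] at h3
      simp [vnorm] at h3
  · refine ⟨fun t φ => a t (σ0 φ) / ℓ t, fun t ht φ => ?_⟩
    obtain ⟨_, _, hT, hN, hc, hl⟩ := D t ht
    refine (hYt t ht (σ0 φ)).congr_deriv ?_
    rw [hT, hN, hc, hl]
    have := hℓ t ht
    ext
    · simp only [Prod.smul_mk, Prod.mk_add_mk, smul_eq_mul]
      field_simp
      ring
    · simp only [Prod.smul_mk, Prod.mk_add_mk, smul_eq_mul]
      field_simp
      ring
  · obtain ⟨T, hT0, hT⟩ := hκ2 (Real.sqrt (π / A₀)) (Real.sqrt_pos.2 (by positivity))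
    refine ⟨T, fun t ht φ => ?_⟩
    rw [(D t (hT0.trans (le_of_lt ht))).2.2.2.2.1]
    have := (abs_lt.1 (hT t ht (σ0 φ))).1
    linarith
  · refine ⟨0, fun ε hε => ?_⟩
    obtain ⟨T, hT⟩ := hr ε hε
    exact ⟨T, fun t ht φ => by simpa using hT t ht (σ0 φ)⟩
  · intro ε hε
    obtain ⟨T, hT0, hT⟩ := hκ2 ε hε
    refine ⟨T, fun t ht φ => ?_⟩
    rw [(D t (hT0.trans (le_of_lt ht))).2.2.2.2.1]
    exact hT t ht (σ0 φ)

end GF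

open scoped Topology ComplexConjugate

namespace GF

/-- Fourier coefficients of a `π`-periodic function -/
def fc (f : ℝ → ℂ) (n : ℤ) : ℂ := (π : ℂ)⁻¹ * ∫ x in (0:ℝ)..π, em (-n) x * f x

theorem fc_bound {f : ℝ → ℂ} (hf : Continuous f) : ∃ C, ∀ n, ‖fc f n‖ ≤ C := by
  obtain ⟨C, hC⟩ := (isCompact_Icc (a := (0:ℝ)) (b := π)).exists_bound_of_continuousOn hf.continuousOn
  refine ⟨‖(π : ℂ)⁻¹‖ * (C * |π - 0|), fun n => ?_⟩
  unfold fc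
  rw [norm_mul]
  gcongr
  refine intervalIntegral.norm_integral_le_of_norm_le_const fun x hx => ?_
  rw [norm_mul, norm_em, one_mul]
  rw [uIoc_of_le Real.pi_pos.le] at hx
  exact hC x ⟨hx.1.le, hx.2⟩

theorem fc_deriv {f f' : ℝ → ℂ} (hf : ∀ x, HasDerivAt f (f' x) x) (hc : Continuous f')
    (hp : ∀ x, f (x + π) = f x) (n : ℤ) : (2 * Complex.I * n) * fc f n = fc f' n := by
  have hcf : Continuous f := continuous_iff_continuousAt.2 fun x => (hf x).continuousAt
  have hd : ∀ x ∈ uIcc 0 π, HasDerivAt (fun x => em (-n) x * f x)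
      (-(2 * Complex.I * n) * (em (-n) x * f x) + em (-n) x * f' x) x := by
    intro x _
    refine ((hasDerivAt_em (-n) x).mul (hf x)).congr_deriv ?_
    push_cast; ring
  have c1 : Continuous (fun x => em (-n) x * f x) := (continuous_em _).mul hcf
  have c2 : Continuous (fun x => em (-n) x * f' x) := (continuous_em _).mul hc
  have c3 : Continuous (fun x => -(2 * Complex.I * n) * (em (-n) x * f x)) := continuous_const.mul c1
  have h := intervalIntegral.integral_eq_sub_of_hasDerivAt hd
    ((c3.add c2).intervalIntegrable _ _)
  have e1 : em (-n) π = em (-n) 0 := by simpa using em_periodic (-n) 0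
  have e2 : f π = f 0 := by simpa using hp 0
  rw [intervalIntegral.integral_add (c3.intervalIntegrable _ _)
    (c2.intervalIntegrable _ _), intervalIntegral.integral_const_mul, e1, e2, sub_self] at h
  unfold fc
  linear_combination (-(π:ℂ)⁻¹) * h

theorem fc_decay (k : ℕ) : ∀ f : ℝ → ℂ, ContDiff ℝ (⊤ : ℕ∞) f → (∀ x, f (x + π) = f x) →
    ∃ C, ∀ n, wt n ^ k * ‖fc f n‖ ≤ C := by
  induction k with
  | zero =>
    intro f hf _
    obtain ⟨C, hC⟩ := fc_bound hf.continuous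
    exact ⟨C, fun n => by simpa using hC n⟩
  | succ k ih =>
    intro f hf hp
    have hf' : ContDiff ℝ (⊤ : ℕ∞) (deriv f) := (contDiff_infty_iff_deriv.1 hf).2
    have hd : ∀ x, HasDerivAt f (deriv f x) x := fun x =>
      (hf.differentiable (by simp) x).hasDerivAt
    have hp' : ∀ x, deriv f (x + π) = deriv f x := by
      intro x
      rw [← deriv_comp_add_const]
      simp only [hp]
    obtain ⟨C, hC⟩ := ih _ hf' hp'
    obtain ⟨C0, hC0⟩ := fc_bound hf.continuous
    refine ⟨max C C0, fun n => ?_⟩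
    by_cases hn : n = 0
    · subst hn
      refine le_trans ?_ (le_max_right _ _)
      simpa [wt] using hC0 0
    · refine le_trans ?_ ((hC n).trans (le_max_left _ _))
      rw [← fc_deriv hd hf'.continuous hp n, norm_mul, norm_two_I, pow_succ, mul_assoc]
      have h1 : (1:ℝ) ≤ |(n:ℝ)| := by
        rw [← Int.cast_abs]; exact_mod_cast Int.one_le_abs hn
      have h2 : wt n ≤ 2 * |(n:ℝ)| := by unfold wt; linarith
      have := (pow_pos (wt_pos n) k).le
      gcongr

theorem summable_wt_inv : Summable (fun n : ℤ => (wt n ^ 2)⁻¹) := by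
  have h : Summable (fun n : ℤ => 1 / (n:ℝ) ^ 2) :=
    Real.summable_one_div_int_pow.2 (by norm_num)
  refine Summable.of_norm_bounded_eventually (g := fun n : ℤ => 1 / (n:ℝ) ^ 2) h ?_
  filter_upwards [(finite_singleton (0:ℤ)).compl_mem_cofinite] with n hn
  have hn' : (n:ℝ) ≠ 0 := by exact_mod_cast hn
  have := wt_pos n
  rw [Real.norm_of_nonneg (by positivity), one_div, ← sq_abs (n:ℝ)]
  gcongr
  unfold wt; linarith

theorem fourier_data {ψ : ℝ → ℝ} (hψ : ContDiff ℝ (⊤ : ℕ∞) ψ) (hp : ∀ x, ψ (x + π) = ψ x) :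
    ∃ d0 : ℤ → ℂ, (∀ n, d0 (-n) = conj (d0 n)) ∧
      (∀ m, Summable (fun n => wt n ^ m * ‖d0 n‖)) ∧ fr (fun n _ => d0 n) 0 = ψ := by
  have hπ := Real.pi_pos
  have hf : ContDiff ℝ (⊤ : ℕ∞) (fun x => (ψ x : ℂ)) := Complex.ofRealCLM.contDiff.comp hψ
  have hfp : Function.Periodic (fun x => (ψ x : ℂ)) π := fun x => by simp only [hp]
  have hs : ∀ m, Summable (fun n => wt n ^ m * ‖fc (fun x => (ψ x : ℂ)) n‖) := by
    intro m
    obtain ⟨C, hC⟩ := fc_decay (m + 2) _ hf hfp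
    refine (summable_wt_inv.mul_left C).of_nonneg_of_le (fun n => ?_) (fun n => ?_)
    · have := wt_pos n; positivity
    · have h1 := hC n
      have h2 := pow_pos (wt_pos n) 2
      rw [← div_eq_mul_inv, le_div_iff₀ h2]
      calc _ = wt n ^ (m + 2) * ‖fc (fun x => (ψ x : ℂ)) n‖ := by ring
        _ ≤ C := h1
  refine ⟨fc (fun x => (ψ x : ℂ)), fun n => ?_, hs, ?_⟩
  · unfold fc
    rw [map_mul, map_inv₀, Complex.conj_ofReal]
    congr 1
    rw [intervalIntegral.integral_of_le hπ.le, intervalIntegral.integral_of_le hπ.le, ← integral_conj]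
    simp only [map_mul, em_conj, Complex.conj_ofReal]
  · have : Fact (0 < π) := ⟨hπ⟩
    let F : C(AddCircle π, ℂ) := ⟨hfp.lift, by
      exact continuous_coinduced_dom.2 hf.continuous⟩
    have hfour : ∀ (n : ℤ) (x : ℝ), fourier n (x : AddCircle π) = em n x := by
      intro n x
      rw [fourier_coe_apply]; unfold em
      congr 1
      have : (π:ℂ) ≠ 0 := by exact_mod_cast hπ.ne'
      field_simp
    have hco : ∀ n, fourierCoeff F n = fc (fun x => (ψ x : ℂ)) n := by
      intro n
      rw [fourierCoeff_eq_intervalIntegral F n 0, zero_add]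
      unfold fc
      simp only [hfour, smul_eq_mul]
      rw [Complex.real_smul, one_div, Complex.ofReal_inv]
      rfl
    have hsum : Summable (fourierCoeff F) := by
      refine Summable.of_norm ?_
      simpa [hco] using hs 0
    funext x
    have h := (has_pointwise_sum_fourier_series_of_summable hsum (x : AddCircle π)).tsum_eq
    unfold fr ev
    simp only [hco, hfour, smul_eq_mul] at h
    rw [h]
    exact Complex.ofReal_re _

end GF

open scoped Topology ComplexConjugate

namespace GF

theorem smooth_of_ode {u g : ℝ → ℝ} (hu : ∀ t, HasDerivAt u (g (u t)) t)
    (hg : ContDiff ℝ (⊤ : ℕ∞) g) : ContDiff ℝ (⊤ : ℕ∞) u := by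
  rw [contDiff_infty]
  intro n
  induction n with
  | zero => exact contDiff_zero.2 (continuous_iff_continuousAt.2 fun x => (hu x).continuousAt)
  | succ n ih =>
    rw [show ((n + 1 : ℕ) : WithTop ℕ∞) = (n : WithTop ℕ∞) + 1 by norm_cast, contDiff_succ_iff_deriv]
    refine ⟨fun x => (hu x).differentiableAt, by simp, ?_⟩
    have e : deriv u = g ∘ u := funext fun x => (hu x).deriv
    rw [e]
    exact (contDiff_infty.1 hg n).comp ih

theorem smooth_inv {f f' : ℝ → ℝ} {c : ℝ} (hc : 0 < c) (hf : ∀ x, HasDerivAt f (f' x) x)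
    (hf' : ∀ x, c ≤ f' x) (hs : ContDiff ℝ (⊤ : ℕ∞) f') : ∃ g : ℝ → ℝ, (∀ x, g (f x) = x) ∧
      (∀ y, f (g y) = y) ∧ StrictMono f ∧
      StrictMono g ∧ (∀ y, HasDerivAt g (f' (g y))⁻¹ y) ∧ ContDiff ℝ (⊤ : ℕ∞) g := by
  obtain ⟨g, h1, h2, h3, h4, h5⟩ := exists_inv hc hf hf'
  exact ⟨g, h1, h2, h3, h4, h5, smooth_of_ode (g := fun x => (f' x)⁻¹) h5
    (hs.inv fun x => (hc.trans_le (hf' x)).ne')⟩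

theorem smooth_of_deriv {f f' : ℝ → ℝ} (hf : ∀ x, HasDerivAt f (f' x) x)
    (hs : ContDiff ℝ (⊤ : ℕ∞) f') : ContDiff ℝ (⊤ : ℕ∞) f := by
  rw [contDiff_infty_iff_deriv]
  refine ⟨fun x => (hf x).differentiableAt, ?_⟩
  rwa [show deriv f = f' from funext fun x => (hf x).deriv]

theorem periodic_lower {f : ℝ → ℝ} {P : ℝ} (hP : P ≠ 0) (hf : Continuous f)
    (hp : Function.Periodic f P) (hpos : ∀ x, 0 < f x) : ∃ c > 0, ∀ x, c ≤ f x := by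
  obtain ⟨c, ⟨x, rfl⟩, hc⟩ := (hp.compact_of_continuous hP hf).exists_isLeast (range_nonempty f)
  exact ⟨f x, hpos x, fun y => hc ⟨y, rfl⟩⟩

theorem periodic_max {f : ℝ → ℝ} {P : ℝ} (hP : P ≠ 0) (hf : Continuous f)
    (hp : Function.Periodic f P) : ∃ x, ∀ y, f y ≤ f x := by
  obtain ⟨c, ⟨x, rfl⟩, hc⟩ := (hp.compact_of_continuous hP hf).exists_isGreatest (range_nonempty f)
  exact ⟨x, fun y => hc ⟨y, rfl⟩⟩

theorem hasDerivAt_prim {f : ℝ → ℝ} (hf : Continuous f) (x : ℝ) :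
    HasDerivAt (fun y => ∫ s in (0:ℝ)..y, f s) (f x) x :=
  intervalIntegral.integral_hasDerivAt_right (hf.intervalIntegrable _ _)
      (hf.stronglyMeasurableAtFilter _ _) hf.continuousAt

theorem add_of_deriv_per {f f' : ℝ → ℝ} {P : ℝ} (hf : ∀ x, HasDerivAt f (f' x) x)
    (hp : ∀ x, f' (x + P) = f' x) (x : ℝ) : f (x + P) = f x + (f P - f 0) := by
  have h : ∀ x, HasDerivAt (fun x => f (x + P) - f x) 0 x := fun x => by
    have := ((hf (x + P)).comp_add_const x P).sub (hf x)
    rw [hp, sub_self] at this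
    exact this
  have := is_const_of_deriv_eq_zero (fun x => (h x).differentiableAt) (fun x => (h x).deriv) x 0
  simp only [zero_add] at this
  linarith

/-- a smooth curve moving counterclockwise around the origin has a polar representation -/
theorem polar_lift {x y x' y' : ℝ → ℝ} (hx : ∀ φ, HasDerivAt x (x' φ) φ)
    (hy : ∀ φ, HasDerivAt y (y' φ) φ) (hx' : ContDiff ℝ (⊤ : ℕ∞) x') (hy' : ContDiff ℝ (⊤ : ℕ∞) y')
    (hD : ∀ φ, 0 < x φ * y' φ - y φ * x' φ) :
    ∃ θ θ' : ℝ → ℝ, (∀ φ, HasDerivAt θ (θ' φ) φ) ∧ ContDiff ℝ (⊤ : ℕ∞) θ' ∧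
      (∀ φ, θ' φ = (x φ * y' φ - y φ * x' φ) / (x φ ^ 2 + y φ ^ 2)) ∧
      (∀ φ, x φ = √(x φ ^ 2 + y φ ^ 2) * Real.cos (θ φ)) ∧
      (∀ φ, y φ = √(x φ ^ 2 + y φ ^ 2) * Real.sin (θ φ)) := by
  have hxs := smooth_of_deriv hx hx'
  have hys := smooth_of_deriv hy hy'
  have hr2 : ∀ φ, 0 < x φ ^ 2 + y φ ^ 2 := by
    intro φ
    by_contra h
    have h1 : x φ = 0 := by nlinarith [sq_nonneg (x φ), sq_nonneg (y φ)]
    have h2 : y φ = 0 := by nlinarith [sq_nonneg (x φ), sq_nonneg (y φ)]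
    have := hD φ
    rw [h1, h2] at this; simp at this
  set θ' : ℝ → ℝ := fun φ => (x φ * y' φ - y φ * x' φ) / (x φ ^ 2 + y φ ^ 2) with hθ'
  have hθs : ContDiff ℝ (⊤ : ℕ∞) θ' :=
    ((hxs.mul hy').sub (hys.mul hx')).div ((hxs.pow 2).add (hys.pow 2)) (fun φ => (hr2 φ).ne')
  set r : ℝ → ℝ := fun φ => √(x φ ^ 2 + y φ ^ 2) with hr
  have hrp : ∀ φ, 0 < r φ := fun φ => Real.sqrt_pos.2 (hr2 φ)
  have hrsq : ∀ φ, r φ ^ 2 = x φ ^ 2 + y φ ^ 2 := fun φ => Real.sq_sqrt (hr2 φ).le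
  have hrd : ∀ φ, HasDerivAt r ((x φ * x' φ + y φ * y' φ) / r φ) φ := by
    intro φ
    have := (((hx φ).pow 2).add ((hy φ).pow 2)).sqrt (hr2 φ).ne'
    refine this.congr_deriv ?_
    have := hrp φ
    simp only [Pi.add_apply, Pi.pow_apply]
    change _ / (2 * r φ) = _
    field_simp
    ring
  set z0 : ℂ := ⟨x 0, y 0⟩ with hz0
  have hz0n : ‖z0‖ = r 0 := by
    rw [Complex.norm_def, Complex.normSq_mk]; simp only [hr]; ring_nf
  set θ : ℝ → ℝ := fun φ => Complex.arg z0 + ∫ s in (0:ℝ)..φ, θ' s with hθ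
  have hθd : ∀ φ, HasDerivAt θ (θ' φ) φ := fun φ =>
    (hasDerivAt_prim hθs.continuous φ).const_add _
  have hθ0 : θ 0 = Complex.arg z0 := by simp [hθ]
  have hz0' : z0 ≠ 0 := by
    intro h; have := hrp 0; rw [← hz0n, h] at this; simp at this
  have c0 : r 0 * Real.cos (θ 0) = x 0 := by
    rw [hθ0, Complex.cos_arg hz0', hz0n]
    have := (hrp 0).ne'
    field_simp [hz0]
    simp [hz0]
  have s0 : r 0 * Real.sin (θ 0) = y 0 := by
    rw [hθ0, Complex.sin_arg, hz0n]
    have := (hrp 0).ne'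
    field_simp [hz0]
    simp [hz0]
  -- U / r and V / r are constant
  have hU : ∀ φ, HasDerivAt (fun φ => (x φ * Real.cos (θ φ) + y φ * Real.sin (θ φ)) / r φ) 0 φ := by
    intro φ
    have h := ((((hx φ).mul (hθd φ).cos).add ((hy φ).mul (hθd φ).sin)).div (hrd φ) (hrp φ).ne')
    refine h.congr_deriv ?_
    have h1 := hrp φ
    have h2 : θ' φ = (x φ * y' φ - y φ * x' φ) / r φ ^ 2 := by rw [hrsq]
    have h3 := hrsq φ
    rw [h2]
    simp only [Pi.add_apply, Pi.mul_apply]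
    field_simp
    rw [mul_zero]
    simp only [h3]
    ring
  have hV : ∀ φ, HasDerivAt (fun φ => (y φ * Real.cos (θ φ) - x φ * Real.sin (θ φ)) / r φ) 0 φ := by
    intro φ
    have h := ((((hy φ).mul (hθd φ).cos).sub ((hx φ).mul (hθd φ).sin)).div (hrd φ) (hrp φ).ne')
    refine h.congr_deriv ?_
    have h1 := hrp φ
    have h2 : θ' φ = (x φ * y' φ - y φ * x' φ) / r φ ^ 2 := by rw [hrsq]
    have h3 := hrsq φ
    rw [h2]
    simp only [Pi.sub_apply, Pi.mul_apply]
    field_simp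
    rw [mul_zero]
    simp only [h3]
    ring
  have hUc : ∀ φ, x φ * Real.cos (θ φ) + y φ * Real.sin (θ φ) = r φ := by
    intro φ
    have h := is_const_of_deriv_eq_zero (fun x => (hU x).differentiableAt) (fun x => (hU x).deriv) φ 0
    rw [div_eq_div_iff (hrp _).ne' (hrp _).ne'] at h
    have h2 : x 0 * Real.cos (θ 0) + y 0 * Real.sin (θ 0) = r 0 := by
      rw [← c0, ← s0]
      linear_combination r 0 * Real.sin_sq_add_cos_sq (θ 0)
    rw [h2] at h
    exact mul_right_cancel₀ (hrp 0).ne' (by linarith)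
  have hVc : ∀ φ, y φ * Real.cos (θ φ) - x φ * Real.sin (θ φ) = 0 := by
    intro φ
    have h := is_const_of_deriv_eq_zero (fun x => (hV x).differentiableAt) (fun x => (hV x).deriv) φ 0
    rw [div_eq_div_iff (hrp _).ne' (hrp _).ne'] at h
    have h2 : y 0 * Real.cos (θ 0) - x 0 * Real.sin (θ 0) = 0 := by
      rw [← c0, ← s0]; ring
    rw [h2, zero_mul] at h
    exact (mul_eq_zero.1 h).resolve_right (hrp 0).ne'
  refine ⟨θ, θ', hθd, hθs, fun φ => rfl, fun φ => ?_, fun φ => ?_⟩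
  · change x φ = r φ * _
    rw [← hUc φ]
    linear_combination (-x φ) * Real.sin_sq_add_cos_sq (θ φ) - Real.sin (θ φ) * hVc φ
  · change y φ = r φ * _
    rw [← hUc φ]
    linear_combination (-y φ) * Real.sin_sq_add_cos_sq (θ φ) + Real.cos (θ φ) * hVc φ

end GF

open scoped Topology ComplexConjugate

namespace GF

theorem inj_aux {X : ℝ → ℝ × ℝ} (hp : Function.Periodic X (2 * π))
    (hinj : Set.InjOn X (Set.Ico 0 (2 * π))) {a b : ℝ} (h : X a = X b) (hab : a < b)
    (hb : b < a + 2 * π) : False := by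
  have hπ : (0:ℝ) < 2 * π := by positivity
  have key : ∀ c, X (toIcoMod hπ 0 c) = X c := fun c => by
    rw [toIcoMod]; exact hp.sub_zsmul_eq _
  have hm : ∀ c, toIcoMod hπ 0 c ∈ Ico 0 (2 * π) := fun c => by
    have := toIcoMod_mem_Ico hπ 0 c
    rwa [zero_add] at this
  have h1 := hinj (hm a) (hm b) (by rw [key, key, h])
  rw [toIcoMod, toIcoMod, zsmul_eq_mul, zsmul_eq_mul] at h1
  set m := toIcoDiv hπ 0 a
  set n := toIcoDiv hπ 0 b
  have h2 : b - a = ((n - m : ℤ) : ℝ) * (2 * π) := by push_cast; linarith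
  have h3 : (0:ℝ) < ((n - m : ℤ) : ℝ) := by
    by_contra h; push Not at h; nlinarith
  have h4 : ((n - m : ℤ) : ℝ) < 1 := by
    by_contra h; push Not at h; nlinarith
  have h5 : 0 < n - m := by exact_mod_cast h3
  have h6 : n - m < 1 := by exact_mod_cast h4
  omega

theorem angle_aux {a b : ℝ} (hc : Real.cos a = Real.cos b) (hs : Real.sin a = Real.sin b) :
    ∃ n : ℤ, a = b + n * (2 * π) := by
  obtain ⟨n, hn⟩ := Real.Angle.angle_eq_iff_two_pi_dvd_sub.1 (Real.Angle.cos_sin_inj hc hs)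
  exact ⟨n, by linarith⟩

theorem polar_curve {X₀ : ℝ → ℝ × ℝ}
    (hX₀ : IsSmoothClosedCurve X₀) (hemb : IsEmbeddedCurve X₀)
    (hstar : StarShapedWrt X₀ 0) (hsym : CentroSymmetricWrt X₀ 0) :
    ∃ R θ θ' : ℝ → ℝ, ContDiff ℝ (⊤ : ℕ∞) R ∧ (∀ u, 0 < R u) ∧ (∀ u, R (u + π) = R u) ∧
      (∀ φ, HasDerivAt θ (θ' φ) φ) ∧ ContDiff ℝ (⊤ : ℕ∞) θ' ∧ (∀ φ, 0 < θ' φ) ∧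
      (∀ φ, θ (φ + 2 * π) = θ φ + 2 * π) ∧
      (∀ φ, X₀ φ = R (θ φ) • (Real.cos (θ φ), Real.sin (θ φ))) := by
  have hπ := Real.pi_pos
  set x : ℝ → ℝ := fun φ => (X₀ φ).1 with hxdef
  set y : ℝ → ℝ := fun φ => (X₀ φ).2 with hydef
  have hxs : ContDiff ℝ (⊤ : ℕ∞) x := contDiff_fst.comp hX₀.smooth
  have hys : ContDiff ℝ (⊤ : ℕ∞) y := contDiff_snd.comp hX₀.smooth
  have hx : ∀ φ, HasDerivAt x (deriv x φ) φ := fun φ => (hxs.differentiable (by simp) φ).hasDerivAt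
  have hy : ∀ φ, HasDerivAt y (deriv y φ) φ := fun φ => (hys.differentiable (by simp) φ).hasDerivAt
  have hdX : ∀ φ, deriv X₀ φ = (deriv x φ, deriv y φ) := fun φ => ((hx φ).prodMk (hy φ)).deriv
  have hxp : ∀ φ, x (φ + 2 * π) = x φ := fun φ => by simp only [hxdef, hX₀.periodic φ]
  have hyp : ∀ φ, y (φ + 2 * π) = y φ := fun φ => by simp only [hydef, hX₀.periodic φ]
  have hxp' : ∀ φ, deriv x (φ + 2 * π) = deriv x φ := fun φ => by
    rw [← deriv_comp_add_const]; simp only [hxp]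
  have hyp' : ∀ φ, deriv y (φ + 2 * π) = deriv y φ := fun φ => by
    rw [← deriv_comp_add_const]; simp only [hyp]
  have hD : ∀ φ, 0 < x φ * deriv y φ - y φ * deriv x φ := by
    intro φ
    have h := hstar φ
    unfold unitTangent vdet at h
    rw [hdX] at h
    simp only [sub_zero, Prod.smul_mk, smul_eq_mul] at h
    set v := vnorm (deriv x φ, deriv y φ)
    have hv : 0 ≤ v⁻¹ := inv_nonneg.2 (Real.sqrt_nonneg _)
    by_contra hn
    push Not at hn
    have h3 := mul_nonpos_of_nonneg_of_nonpos hv hn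
    have : (X₀ φ).1 * (v⁻¹ * deriv y φ) - (X₀ φ).2 * (v⁻¹ * deriv x φ)
      = v⁻¹ * (x φ * deriv y φ - y φ * deriv x φ) := by simp only [hxdef, hydef]; ring
    linarith
  obtain ⟨θ, θ', hθ, hθs, hθe, hc, hs⟩ := polar_lift hx hy (contDiff_infty_iff_deriv.1 hxs).2
    (contDiff_infty_iff_deriv.1 hys).2 hD
  have hr2 : ∀ φ, 0 < x φ ^ 2 + y φ ^ 2 := by
    intro φ
    by_contra h
    have h1 : x φ = 0 := by nlinarith [sq_nonneg (x φ), sq_nonneg (y φ)]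
    have h2 : y φ = 0 := by nlinarith [sq_nonneg (x φ), sq_nonneg (y φ)]
    have := hD φ
    rw [h1, h2] at this; simp at this
  have hθpos : ∀ φ, 0 < θ' φ := fun φ => by rw [hθe]; exact div_pos (hD φ) (hr2 φ)
  have hθper : ∀ φ, θ' (φ + 2 * π) = θ' φ := fun φ => by
    rw [hθe, hθe, hxp, hyp, hxp', hyp']
  obtain ⟨c, hc0, hcl⟩ := periodic_lower (by positivity : 2 * π ≠ 0) hθs.continuous hθper hθpos
  obtain ⟨Φ, hΦ1, hΦ2, hθm, hΦm, hΦd, hΦs⟩ := smooth_inv hc0 hθ hcl hθs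
  set r : ℝ → ℝ := fun φ => √(x φ ^ 2 + y φ ^ 2) with hr
  have hrp : ∀ φ, 0 < r φ := fun φ => Real.sqrt_pos.2 (hr2 φ)
  have hrs : ContDiff ℝ (⊤ : ℕ∞) r := ((hxs.pow 2).add (hys.pow 2)).sqrt (fun φ => (hr2 φ).ne')
  have hrper : ∀ φ, r (φ + 2 * π) = r φ := fun φ => by simp only [hr, hxp, hyp]
  have hXpol : ∀ φ, X₀ φ = r φ • (Real.cos (θ φ), Real.sin (θ φ)) := by
    intro φ
    ext
    · exact hc φ
    · exact hs φ
  set R : ℝ → ℝ := fun u => r (Φ u) with hR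
  have hRs : ContDiff ℝ (⊤ : ℕ∞) R := hrs.comp hΦs
  have hXR : ∀ u, X₀ (Φ u) = R u • (Real.cos u, Real.sin u) := fun u => by
    rw [hXpol, hΦ2]
  set W := θ (2 * π) - θ 0 with hW
  have hWadd : ∀ φ, θ (φ + 2 * π) = θ φ + W := add_of_deriv_per hθ hθper
  have hW0 : 0 < W := sub_pos.2 (hθm (by positivity))
  have hΦW : ∀ u, Φ (u + W) = Φ u + 2 * π := fun u => by
    apply hθm.injective; rw [hΦ2, hWadd, hΦ2]
  have hRW : Function.Periodic R W := fun u => by simp only [hR, hΦW, hrper]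
  have hWn : ∃ n : ℤ, W = n * (2 * π) := by
    have h1 := hrper 0
    rw [zero_add] at h1
    have h2 : X₀ (2 * π) = X₀ 0 := by simpa using hX₀.periodic 0
    rw [hXpol, hXpol 0, h1] at h2
    simp only [Prod.smul_mk, smul_eq_mul, Prod.mk.injEq] at h2
    obtain ⟨n, hn⟩ := angle_aux (mul_left_cancel₀ (hrp 0).ne' h2.1)
      (mul_left_cancel₀ (hrp 0).ne' h2.2)
    exact ⟨n, by rw [hW, hn]; ring⟩
  have hWle : ¬ 2 * π < W := by
    intro hlt
    obtain ⟨u0, hu0⟩ := periodic_max hW0.ne' hRs.continuous hRW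
    have hcont : Continuous (fun u => R (u + 2 * π) - R u) :=
      (hRs.continuous.comp (by fun_prop)).sub hRs.continuous
    obtain ⟨u, -, hu⟩ := intermediate_value_Icc' (a := u0 - 2 * π) (b := u0) (by linarith)
      hcont.continuousOn (show (0:ℝ) ∈ _ from ⟨by simpa using hu0 (u0 + 2 * π), by
        simpa using hu0 (u0 - 2 * π)⟩)
    have hu' : R (u + 2 * π) = R u := by simpa [sub_eq_zero] using hu
    have hXe : X₀ (Φ u) = X₀ (Φ (u + 2 * π)) := by
      rw [hXR, hXR, hu', Real.cos_add_two_pi, Real.sin_add_two_pi]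
    refine inj_aux hX₀.periodic hemb hXe (hΦm (by linarith)) ?_
    rw [← hΦW]
    exact hΦm (by linarith)
  have hW2 : W = 2 * π := by
    obtain ⟨n, hn⟩ := hWn
    have h1 : (0:ℝ) < n := by by_contra h; push Not at h; nlinarith
    have h2 : ¬ (1:ℝ) < n := by intro h; apply hWle; nlinarith
    have h3 : 0 < n := by exact_mod_cast h1
    have h4 : ¬ 1 < n := by exact_mod_cast h2
    have h5 : n = 1 := by omega
    rw [hn, h5]; simp
  rw [hW2] at hWadd hRW
  refine ⟨R, θ, θ', hRs, fun u => hrp _, fun u => ?_, hθ, hθs, hθpos, hWadd, fun φ => ?_⟩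
  · have h1 : (2:ℝ) • (0 : ℝ × ℝ) - X₀ (Φ u) ∈ range X₀ := by
      unfold CentroSymmetricWrt at hsym
      rw [← hsym]
      exact ⟨_, ⟨Φ u, rfl⟩, rfl⟩
    obtain ⟨φ, hφ⟩ := h1
    rw [smul_zero, zero_sub, hXpol φ, hXR] at hφ
    have hφ1 := congrArg Prod.fst hφ
    have hφ2 := congrArg Prod.snd hφ
    simp only [Prod.smul_mk, smul_eq_mul, Prod.fst_neg, Prod.snd_neg] at hφ1 hφ2
    have hRu : 0 < R u := hrp _
    have hrφ := hrp φ
    have hsq : r φ ^ 2 = R u ^ 2 := by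
      have e1 := Real.sin_sq_add_cos_sq (θ φ)
      have e2 := Real.sin_sq_add_cos_sq u
      have e3 : (r φ * Real.cos (θ φ)) ^ 2 + (r φ * Real.sin (θ φ)) ^ 2
        = (R u * Real.cos u) ^ 2 + (R u * Real.sin u) ^ 2 := by rw [hφ1, hφ2]; ring
      linear_combination e3 - r φ ^ 2 * e1 + R u ^ 2 * e2
    have hre : r φ = R u := by
      rwa [sq_eq_sq₀ hrφ.le hRu.le] at hsq
    rw [hre] at hφ1 hφ2
    obtain ⟨n, hn⟩ := angle_aux (a := θ φ) (b := u + π)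
      (by rw [Real.cos_add_pi]; exact mul_left_cancel₀ hRu.ne' (by linarith))
      (by rw [Real.sin_add_pi]; exact mul_left_cancel₀ hRu.ne' (by linarith))
    have h2 : R (θ φ) = r φ := by simp only [hR, hΦ1]
    rw [← hre, ← h2, hn]
    have := (hRW.int_mul n) (u + π)
    rw [this]
  · rw [hXpol]; simp only [hR, hΦ1]

end GF

open scoped Topology ComplexConjugate

namespace GF

theorem initial_data {X₀ : ℝ → ℝ × ℝ} {R θ θ' : ℝ → ℝ} (hRs : ContDiff ℝ (⊤ : ℕ∞) R)
    (hRp : ∀ u, 0 < R u) (hRper : ∀ u, R (u + π) = R u)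
    (hθ : ∀ φ, HasDerivAt θ (θ' φ) φ) (hθs : ContDiff ℝ (⊤ : ℕ∞) θ') (hθp : ∀ φ, 0 < θ' φ)
    (hθper : ∀ φ, θ (φ + 2 * π) = θ φ + 2 * π)
    (hX : ∀ φ, X₀ φ = R (θ φ) • (Real.cos (θ φ), Real.sin (θ φ))) :
    ∃ (d0 : ℤ → ℂ) (b ℓ0 : ℝ) (σ0 σ1 : ℝ → ℝ), (∀ n, d0 (-n) = conj (d0 n)) ∧
      (∀ m, Summable (fun n => wt n ^ m * ‖d0 n‖)) ∧ 0 < b ∧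
      (∀ σ, b ≤ gp (fr (fun n _ => d0 n)) 0 σ) ∧ 0 < ℓ0 ∧
      carea X₀ = ℓ0 ^ 2 * (2 * gP (fr (fun n _ => d0 n)) 0 π) ∧
      ContDiff ℝ (⊤ : ℕ∞) σ0 ∧ (∀ φ, HasDerivAt σ0 (σ1 φ) φ) ∧ (∀ φ, 0 < σ1 φ) ∧
      (∀ φ, σ0 (φ + 2 * π) = σ0 φ + 2 * π) ∧
      (∀ φ, X₀ φ = ℓ0 • (gx (fr (fun n _ => d0 n)) 0 0 (σ0 φ),
        gx (fr (fun n _ => d0 n)) (-(π/2)) 0 (σ0 φ))) := by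
  have hπ := Real.pi_pos
  set R1 := deriv R with hR1
  have hR1s : ContDiff ℝ (⊤ : ℕ∞) R1 := (contDiff_infty_iff_deriv.1 hRs).2
  have hRd : ∀ u, HasDerivAt R (R1 u) u := fun u => (hRs.differentiable (by simp) u).hasDerivAt
  have hR1per : ∀ u, R1 (u + π) = R1 u := fun u => by
    rw [hR1, ← deriv_comp_add_const]; simp only [hRper]
  have hv2 : ∀ u, 0 < R1 u ^ 2 + R u ^ 2 := fun u => by have := hRp u; positivity
  set v : ℝ → ℝ := fun u => √(R1 u ^ 2 + R u ^ 2) with hv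
  have hvp : ∀ u, 0 < v u := fun u => Real.sqrt_pos.2 (hv2 u)
  have hvsq : ∀ u, v u ^ 2 = R1 u ^ 2 + R u ^ 2 := fun u => Real.sq_sqrt (hv2 u).le
  have hvs : ContDiff ℝ (⊤ : ℕ∞) v := ((hR1s.pow 2).add (hRs.pow 2)).sqrt (fun u => (hv2 u).ne')
  have hvper : ∀ u, v (u + π) = v u := fun u => by simp only [hv, hRper, hR1per]
  set S : ℝ → ℝ := fun u => ∫ t in (0:ℝ)..u, v t with hS
  have hSd : ∀ u, HasDerivAt S (v u) u := hasDerivAt_prim hvs.continuous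
  have hS0 : S 0 = 0 := by simp [hS]
  have hSadd : ∀ u, S (u + π) = S u + S π := fun u => by
    rw [add_of_deriv_per hSd hvper, hS0, sub_zero]
  obtain ⟨cv, hcv, hcvl⟩ := periodic_lower hπ.ne' hvs.continuous hvper hvp
  have hSmono : StrictMono S := strictMono_of_deriv_pos fun u => by rw [(hSd u).deriv]; exact hvp u
  set ℓ0 := S π / π with hℓ0
  have hSπ : 0 < S π := by rw [← hS0]; exact hSmono hπ
  have hℓ0p : 0 < ℓ0 := div_pos hSπ hπ
  set s : ℝ → ℝ := fun u => S u / ℓ0 with hs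
  have hsd : ∀ u, HasDerivAt s (v u / ℓ0) u := fun u => (hSd u).div_const _
  have hsadd : ∀ u, s (u + π) = s u + π := fun u => by
    simp only [hs, hSadd, add_div]
    congr 1
    rw [hℓ0]; field_simp
  obtain ⟨U, hU1, hU2, hsm, hUm, hUd, hUs⟩ := smooth_inv (c := cv / ℓ0) (f' := fun u => v u / ℓ0)
    (by positivity) hsd (fun u => by have := hcvl u; gcongr) (hvs.div_const _)
  have hUadd : ∀ t, U (t + π) = U t + π := fun t => by
    apply hsm.injective; rw [hU2, hsadd, hU2]
  set A : ℝ → ℝ := fun u => u + π / 2 - Real.arctan (R1 u / R u) with hA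
  have hAs : ContDiff ℝ (⊤ : ℕ∞) A :=
    (contDiff_id.add contDiff_const).sub
      (Real.contDiff_arctan.comp (hR1s.div hRs (fun u => (hRp u).ne')))
  have hAper : ∀ u, A (u + π) = A u + π := fun u => by
    simp only [hA, hRper, hR1per]; ring
  have hsq : ∀ u, √(1 + (R1 u / R u) ^ 2) = v u / R u := fun u => by
    have h1 := hRp u
    rw [show 1 + (R1 u / R u) ^ 2 = (v u / R u) ^ 2 by
      rw [div_pow, div_pow, hvsq]; field_simp; ring]
    exact Real.sqrt_sq (div_pos (hvp u) h1).le
  have hcb : ∀ u, Real.cos (Real.arctan (R1 u / R u)) = R u / v u := fun u => by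
    rw [Real.cos_arctan, hsq, one_div, inv_div]
  have hsb : ∀ u, Real.sin (Real.arctan (R1 u / R u)) = R1 u / v u := fun u => by
    have h1 := hRp u
    have h2 := hvp u
    rw [Real.sin_arctan, hsq]; field_simp
  have hcA : ∀ u, Real.cos (A u) = (R1 u * Real.cos u - R u * Real.sin u) / v u := fun u => by
    simp only [hA]
    rw [show u + π / 2 - Real.arctan (R1 u / R u) = (u - Real.arctan (R1 u / R u)) + π / 2 by ring,
      Real.cos_add_pi_div_two, Real.sin_sub, hcb, hsb]
    ring
  have hsA : ∀ u, Real.sin (A u) = (R1 u * Real.sin u + R u * Real.cos u) / v u := fun u => by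
    simp only [hA]
    rw [show u + π / 2 - Real.arctan (R1 u / R u) = (u - Real.arctan (R1 u / R u)) + π / 2 by ring,
      Real.sin_add_pi_div_two, Real.cos_sub, hcb, hsb]
    ring
  have hψs : ContDiff ℝ (⊤ : ℕ∞) (fun t => A (U t) - t) := (hAs.comp hUs).sub contDiff_id
  have hψper : ∀ t, A (U (t + π)) - (t + π) = A (U t) - t := fun t => by
    rw [hUadd, hAper]; ring
  obtain ⟨d0, hd1, hd2, hd3⟩ := fourier_data hψs hψper
  set ψ := fr (fun n _ => d0 n)
  have hψ : ∀ t, t + ψ 0 t = A (U t) := fun t => by rw [hd3]; ring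
  have hcA' : Continuous (fun t => A (U t)) := (hAs.comp hUs).continuous
  have hx1d : ∀ t, HasDerivAt (fun t => R (U t) * Real.cos (U t) / ℓ0) (Real.cos (A (U t))) t := by
    intro t
    have h := (((hRd (U t)).comp t (hUd t)).mul (hUd t).cos).div_const ℓ0
    refine h.congr_deriv ?_
    have := hvp (U t)
    rw [hcA]
    simp only [Function.comp]
    field_simp
    ring
  have hx2d : ∀ t, HasDerivAt (fun t => R (U t) * Real.sin (U t) / ℓ0) (Real.sin (A (U t))) t := by
    intro t
    have h := (((hRd (U t)).comp t (hUd t)).mul (hUd t).sin).div_const ℓ0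
    refine h.congr_deriv ?_
    have := hvp (U t)
    rw [hsA]
    simp only [Function.comp]
    field_simp
  have hgx1 : ∀ t, gx ψ 0 0 t = R (U t) * Real.cos (U t) / ℓ0 := by
    intro t
    unfold gx
    simp only [hψ, add_zero]
    rw [intervalIntegral.integral_eq_sub_of_hasDerivAt (fun t _ => hx1d t)
      ((Real.continuous_cos.comp hcA').intervalIntegrable _ _)]
    rw [hUadd, hRper, Real.cos_add_pi]; ring
  have hgx2 : ∀ t, gx ψ (-(π/2)) 0 t = R (U t) * Real.sin (U t) / ℓ0 := by
    intro t
    unfold gx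
    simp only [hψ, ← sub_eq_add_neg, Real.cos_sub_pi_div_two]
    rw [intervalIntegral.integral_eq_sub_of_hasDerivAt (fun t _ => hx2d t)
      ((Real.continuous_sin.comp hcA').intervalIntegrable _ _)]
    rw [hUadd, hRper, Real.sin_add_pi]; ring
  have hgp : ∀ t, gp ψ 0 t = R (U t) ^ 2 / (ℓ0 * v (U t)) := by
    intro t
    unfold gp
    rw [hgx1, hgx2, hψ, hcA, hsA]
    have := hvp (U t)
    field_simp
    linear_combination R (U t) ^ 2 * Real.sin_sq_add_cos_sq (U t)
  obtain ⟨b, hb, hbl⟩ := periodic_lower (f := fun u => R u ^ 2 / (ℓ0 * v u)) hπ.ne'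
    ((hRs.continuous.pow 2).div (continuous_const.mul hvs.continuous)
      (fun u => (mul_pos hℓ0p (hvp u)).ne'))
    (fun u => by simp only [hRper, hvper])
    (fun u => by have := hvp u; have := hRp u; positivity)
  have hgpc : Continuous (gp ψ 0) := by
    have hRU := (hRs.comp hUs).continuous
    have hvU := (hvs.comp hUs).continuous
    have e : gp ψ 0 = fun t => R (U t) ^ 2 / (ℓ0 * v (U t)) := funext hgp
    rw [e]
    exact (hRU.pow 2).div (continuous_const.mul hvU) (fun u => (mul_pos hℓ0p (hvp (U u))).ne')
  have hgpper : ∀ t, gp ψ 0 (t + π) = gp ψ 0 t := fun t => by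
    rw [hgp, hgp, hUadd, hRper, hvper]
  have hσd : ∀ φ, HasDerivAt (fun φ => s (θ φ)) (v (θ φ) / ℓ0 * θ' φ) φ := fun φ =>
    (hsd (θ φ)).comp φ (hθ φ)
  have hσper : ∀ φ, s (θ (φ + 2 * π)) = s (θ φ) + 2 * π := fun φ => by
    rw [hθper, two_mul, ← add_assoc, hsadd, hsadd]; ring
  have hθsm := smooth_of_deriv hθ hθs
  have hss : ContDiff ℝ (⊤ : ℕ∞) s := smooth_of_deriv hsd (hvs.div_const _)
  refine ⟨d0, b, ℓ0, fun φ => s (θ φ), fun φ => v (θ φ) / ℓ0 * θ' φ, hd1, hd2, hb,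
    fun t => by rw [hgp]; exact hbl _, hℓ0p, ?_, hss.comp hθsm, hσd,
    fun φ => by have := hvp (θ φ); have := hθp φ; positivity, hσper, fun φ => ?_⟩
  · have hdX : ∀ φ, deriv X₀ φ = θ' φ • (R1 (θ φ) * Real.cos (θ φ) - R (θ φ) * Real.sin (θ φ),
        R1 (θ φ) * Real.sin (θ φ) + R (θ φ) * Real.cos (θ φ)) := by
      intro φ
      have h := ((hRd (θ φ)).comp φ (hθ φ)).smul ((hθ φ).cos.prodMk (hθ φ).sin)
      have e : X₀ = (R ∘ θ) • fun φ => (Real.cos (θ φ), Real.sin (θ φ)) := funext hX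
      rw [e, h.deriv]
      ext
      · simp only [Prod.smul_mk, Prod.mk_add_mk, smul_eq_mul, Function.comp]; ring
      · simp only [Prod.smul_mk, Prod.mk_add_mk, smul_eq_mul, Function.comp]; ring
    set Q : ℝ → ℝ := fun t => ∫ r in (0:ℝ)..t, gp ψ 0 r with hQ
    have hQd : ∀ t, HasDerivAt Q (gp ψ 0 t) t := hasDerivAt_prim hgpc
    have hQ0 : Q 0 = 0 := by simp [hQ]
    have hQadd : ∀ t, Q (t + π) = Q t + Q π := fun t => by
      rw [add_of_deriv_per hQd hgpper, hQ0, sub_zero]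
    have hintg : ∀ φ, vdet (X₀ φ) (deriv X₀ φ)
        = ℓ0 ^ 2 * (gp ψ 0 (s (θ φ)) * (v (θ φ) / ℓ0 * θ' φ)) := by
      intro φ
      rw [hdX, hX, hgp, hU1]
      unfold vdet
      simp only [Prod.smul_mk, smul_eq_mul]
      have := hvp (θ φ)
      field_simp
      linear_combination R (θ φ) ^ 2 * θ' φ * Real.sin_sq_add_cos_sq (θ φ)
    have hF : ∀ φ ∈ uIcc 0 (2 * π), HasDerivAt (fun φ => ℓ0 ^ 2 * Q (s (θ φ)))
        (ℓ0 ^ 2 * (gp ψ 0 (s (θ φ)) * (v (θ φ) / ℓ0 * θ' φ))) φ := fun φ _ =>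
      ((hQd _).comp φ (hσd φ)).const_mul _
    have hvθ := (hvs.comp hθsm).continuous
    have hgσ := hgpc.comp (hss.comp hθsm).continuous
    have hcc : Continuous (fun φ => ℓ0 ^ 2 * (gp ψ 0 (s (θ φ)) * (v (θ φ) / ℓ0 * θ' φ))) :=
      continuous_const.mul (hgσ.mul ((hvθ.div_const _).mul hθs.continuous))
    unfold carea
    simp only [hintg]
    rw [intervalIntegral.integral_eq_sub_of_hasDerivAt hF (hcc.intervalIntegrable _ _)]
    have h0 := hσper 0
    rw [zero_add] at h0
    rw [h0, two_mul π, ← add_assoc, hQadd, hQadd]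
    unfold gP
    change _ = ℓ0 ^ 2 * (2 * (1 / 2 * Q π))
    ring
  · rw [hX, hgx1, hgx2, hU1]
    ext
    · simp only [Prod.smul_mk, smul_eq_mul]; field_simp
    · simp only [Prod.smul_mk, smul_eq_mul]; field_simp

end GF

/-- Main theorem: Gage's area-preserving flow with a smooth, embedded, star-shaped,
centrosymmetric initial curve exists for all time, becomes convex in finite time, and
converges to a circle of radius `√(A₀/π)`; in particular its curvature converges
uniformly to `√(π/A₀)`. -/
theorem gapf_starshaped_centrosymmetric_main
    (X₀ : ℝ → ℝ × ℝ) (A₀ : ℝ)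
    (hX₀ : IsSmoothClosedCurve X₀) (hemb : IsEmbeddedCurve X₀)
    (hstar : StarShapedWrt X₀ 0) (hsym : CentroSymmetricWrt X₀ 0)
    (hA : A₀ = carea X₀) :
    ∃ X : ℝ → ℝ → ℝ × ℝ,
      IsGAPFSolutionOn X X₀ (Set.Ici 0) ∧
      (∃ T₀ : ℝ, ∀ t > T₀, ∀ φ, 0 < curv (X t) φ) ∧
      (∃ c : ℝ × ℝ, ∀ ε > 0, ∃ T : ℝ, ∀ t > T, ∀ φ,
        |vnorm (X t φ - c) - Real.sqrt (A₀ / π)| < ε) ∧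
      (∀ ε > 0, ∃ T : ℝ, ∀ t > T, ∀ φ,
        |curv (X t) φ - Real.sqrt (π / A₀)| < ε) := by
  obtain ⟨R, θ, θ', a1, a2, a3, a4, a5, a6, a7, a8⟩ := GF.polar_curve hX₀ hemb hstar hsym
  obtain ⟨d0, b, ℓ0, σ0, σ1, h1, h2, h3, h4, h5, h6, h7, h8, h9, h10, h11⟩ :=
    GF.initial_data a1 a2 a3 a4 a5 a6 a7 a8
  exact GF.main_assembly d0 h1 h2 h3 h4 h5 (hA.trans h6) h7 h8 h9 h10 h11
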